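/- arXiv:2107.08647 — 2 statements merged into one kernel-verified Lean document; each statement's English description precedes it below -/
import Mathlib

section
/- Let α > 0 and m_i > 0 with m_i → ∞. Let f_i ∈ C^∞(S³) with ∫_{S³} f_i dμ_{S³} = 0, let u_i be the biharmonic extension of f_i to 𝔹⁴ with zero Neumann boundary condition, and assume the normalization (1/2)[ ∫_{𝔹⁴} (Δu_i)² dx + 2 ∫_{S³} |∇f_i|²_{S³} dμ_{S³} ] = 1 and log ∫_{S³} e^{3 m_i f_i} dμ_{S³} ≥ α m_i². Assume moreover that u_i ⇀ u weakly in H²(𝔹⁴), (Δu_i)² dx ⇀ (Δu)² dx + σ as measures on 𝔹⁴, and e^{3 m_i f_i} / ∫_{S³} e^{3 m_i f_i} dμ_{S³} ⇀ ν as measures on S³. Define σ̂({x}) = σ(𝒞({x})) for x ∈ S³ and let { x ∈ S³ : σ̂({x}) ≥ (16/3)π² α } = { x₁, …, x_N }. Then ν = Σ_{i=1}^N ν_i δ_{x_i} with ν_i ≥ 0 and Σ_{i=1}^N ν_i = 1. -/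
open MeasureTheory Metric Filter
open scoped ENNReal RealInnerProductSpace

noncomputable section

abbrev E (n : ℕ) : Type := EuclideanSpace ℝ (Fin n)

/-- The standard surface measure on the unit sphere `S^{n-1}`, as a Borel measure on `ℝⁿ`. -/
def sphMeasure (n : ℕ) : Measure (E n) :=
  Measure.map Subtype.val ((volume : Measure (E n)).toSphere)

/-- The cone `𝒞(Ω) = { rξ : 0 ≤ r ≤ 1, ξ ∈ Ω }` with vertex at the origin and base `Ω`. -/
def cone (n : ℕ) (Ω : Set (E n)) : Set (E n) :=
  {x | ∃ r : ℝ, 0 ≤ r ∧ r ≤ 1 ∧ ∃ ξ ∈ Ω, x = r • ξ}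

/-- The Euclidean Laplacian `Δu = Σ_i ∂²u/∂x_i²`. -/
def lap (n : ℕ) (u : E n → ℝ) (x : E n) : ℝ :=
  ∑ i : Fin n, fderiv ℝ (fun y => fderiv ℝ u y (EuclideanSpace.single i 1)) x
    (EuclideanSpace.single i 1)

/-- `|∇f|²_{S^{n-1}}` at a point `x` of the unit sphere: the squared norm of the tangential
gradient, i.e. `‖∇f‖² - ⟨∇f, x⟩²`. -/
def tgradNormSq (n : ℕ) (f : E n → ℝ) (x : E n) : ℝ :=
  ‖gradient f x‖ ^ 2 - (fderiv ℝ f x x) ^ 2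


/-! ### The surface measure -/

abbrev Sg : Measure (E 4) := sphMeasure 4

lemma measEmb_sph : MeasurableEmbedding (Subtype.val : sphere (0 : E 4) 1 → E 4) :=
  MeasurableEmbedding.subtype_coe isClosed_sphere.measurableSet

instance instFinSg : IsFiniteMeasure (sphMeasure 4) := by
  unfold sphMeasure; infer_instance

lemma sph_ae : ∀ᵐ x ∂(sphMeasure 4), ‖x‖ = 1 := by
  unfold sphMeasure
  rw [measEmb_sph.ae_map_iff]
  exact Eventually.of_forall fun x => by simp

lemma sph_integral (g : E 4 → ℝ) :
    ∫ x, g x ∂(sphMeasure 4) = ∫ ξ, g ξ ∂((volume : Measure (E 4)).toSphere) := by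
  unfold sphMeasure
  rw [measEmb_sph.integral_map]

lemma fr4 : Module.finrank ℝ (E 4) = 4 := by simp

lemma vol_ball_one : (volume : Measure (E 4)).real (ball 0 1) = Real.pi ^ 2 / 2 := by
  rw [measureReal_def, EuclideanSpace.volume_ball]
  have h : Real.Gamma ((4:ℝ) / 2 + 1) = 2 := by
    rw [show ((4:ℝ) / 2 + 1) = ((2:ℕ):ℝ) + 1 by norm_num, Real.Gamma_nat_eq_factorial]
    norm_num [Nat.factorial]
  have h2 : (Real.sqrt Real.pi) ^ 4 = Real.pi ^ 2 := by
    rw [show 4 = 2 * 2 by norm_num, pow_mul, Real.sq_sqrt Real.pi_pos.le]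
  simp only [Fintype.card_fin, ENNReal.ofReal_one, one_pow, one_mul]
  norm_num [h, h2]
  positivity

lemma sph_mass : (sphMeasure 4).real Set.univ = 2 * Real.pi ^ 2 := by
  have h : (sphMeasure 4).real Set.univ = ((volume : Measure (E 4)).toSphere).real Set.univ := by
    unfold sphMeasure
    rw [measureReal_def, Measure.map_apply measEmb_sph.measurable MeasurableSet.univ]
    simp [measureReal_def]
  rw [h, Measure.toSphere_real_apply_univ, vol_ball_one, fr4]
  push_cast; ring

lemma polar_ball (f : E 4 → ℝ) (hf : Continuous f) :
    ∫ y in ball (0 : E 4) 1, f y =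
      ∫ ξ, (∫ r in (0:ℝ)..1, r ^ 3 * f (r • ξ)) ∂(sphMeasure 4) := by
  set μ : Measure (E 4) := volume
  have hintg : IntegrableOn f (ball (0 : E 4) 1) μ :=
    (hf.continuousOn.integrableOn_compact (isCompact_closedBall 0 1)).mono_set ball_subset_closedBall
  set F : E 4 → ℝ := (ball (0 : E 4) 1).indicator f with hF
  have hFi : Integrable F μ := by rwa [hF, integrable_indicator_iff measurableSet_ball]
  rw [sph_integral (fun ξ => ∫ r in (0:ℝ)..1, r ^ 3 * f (r • ξ))]
  have mp := μ.measurePreserving_homeomorphUnitSphereProd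
  have emb := (homeomorphUnitSphereProd (E 4)).measurableEmbedding
  set Φ : sphere (0 : E 4) 1 × Set.Ioi (0:ℝ) → ℝ := fun z => F (z.2.1 • z.1.1) with hΦ
  have hcomp : ∀ x : ({0}ᶜ : Set (E 4)), Φ (homeomorphUnitSphereProd (E 4) x) = F x := by
    intro x
    have hx : ‖(x : E 4)‖ ≠ 0 := norm_ne_zero_iff.2 x.2
    simp [hΦ, smul_smul, mul_inv_cancel₀ hx]
  have h1 : ∫ y in ball (0 : E 4) 1, f y = ∫ z, Φ z ∂(μ.toSphere.prod (Measure.volumeIoiPow (Module.finrank ℝ (E 4) - 1))) := by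
    rw [← mp.integral_comp emb, ← integral_indicator measurableSet_ball]
    simp_rw [hcomp]
    rw [integral_subtype_comap (measurableSet_singleton _).compl F, restrict_compl_singleton]
  have h2 : Integrable Φ (μ.toSphere.prod (Measure.volumeIoiPow (Module.finrank ℝ (E 4) - 1))) := by
    rw [← mp.integrable_comp_emb emb]
    have : Φ ∘ (homeomorphUnitSphereProd (E 4)) = fun x : ({0}ᶜ : Set (E 4)) => F x := by
      ext x; exact hcomp x
    rw [this]
    have := (integrableOn_iff_comap_subtypeVal (f := F) (μ := μ) (measurableSet_singleton (0 : E 4)).compl).1 hFi.integrableOn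
    exact this
  rw [h1, integral_prod _ h2]
  congr 1
  ext ξ
  simp only [Measure.volumeIoiPow, ENNReal.ofReal, fr4]
  rw [integral_withDensity_eq_integral_smul ((measurable_subtype_coe.pow_const _).real_toNNReal),
    integral_subtype_comap measurableSet_Ioi (fun a => Real.toNNReal (a ^ (4 - 1)) • F (a • ξ.1)),
    intervalIntegral.integral_of_le zero_le_one, integral_Ioc_eq_integral_Ioo]
  rw [← integral_indicator measurableSet_Ioi, ← integral_indicator measurableSet_Ioo]
  congr 1
  ext r
  have hξ : ‖ξ.1‖ = 1 := by simp
  by_cases h0 : 0 < r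
  · by_cases h1 : r < 1
    · have : r • ξ.1 ∈ ball (0 : E 4) 1 := by
        simp [norm_smul, hξ, abs_of_pos h0, h1]
      rw [Set.indicator_of_mem (Set.mem_Ioi.2 h0), Set.indicator_of_mem (Set.mem_Ioo.2 ⟨h0, h1⟩), hF,
        Set.indicator_of_mem this, NNReal.smul_def, Real.coe_toNNReal _ (pow_nonneg h0.le _)]
      simp
    · have : r • ξ.1 ∉ ball (0 : E 4) 1 := by
        simp [norm_smul, hξ, abs_of_pos h0]; linarith
      rw [Set.indicator_of_mem (Set.mem_Ioi.2 h0), Set.indicator_of_notMem (fun h => h1 h.2), hF,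
        Set.indicator_of_notMem this]
      simp
  · rw [Set.indicator_of_notMem (by simpa using h0), Set.indicator_of_notMem (fun h => h0 h.1)]

lemma euler_ball (H : E 4 → ℝ) (hH : ContDiff ℝ 1 H) :
    ∫ y in ball (0 : E 4) 1, (4 * H y + fderiv ℝ H y y) = ∫ ξ, H ξ ∂(sphMeasure 4) := by
  have hc : Continuous (fun y => fderiv ℝ H y y) :=
    (hH.continuous_fderiv one_ne_zero).clm_apply continuous_id
  rw [polar_ball (fun y => 4 * H y + fderiv ℝ H y y) ((continuous_const.mul hH.continuous).add hc)]
  congr 1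
  ext ξ
  have hd : ∀ r : ℝ, HasDerivAt (fun r : ℝ => r ^ 4 * H (r • ξ))
      (r ^ 3 * (4 * H (r • ξ) + fderiv ℝ H (r • ξ) (r • ξ))) r := by
    intro r
    have h1 : HasDerivAt (fun r : ℝ => r • ξ) ξ r := by
      simpa using (hasDerivAt_id r).smul_const ξ
    have h2 : HasDerivAt (fun r : ℝ => H (r • ξ)) (fderiv ℝ H (r • ξ) ξ) r :=
      ((hH.differentiable one_ne_zero) (r • ξ)).hasFDerivAt.comp_hasDerivAt r h1
    have h3 := (hasDerivAt_pow 4 r).mul h2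
    refine h3.congr_deriv ?_
    simp only [map_smul, smul_eq_mul]; push_cast; ring
  rw [intervalIntegral.integral_eq_sub_of_hasDerivAt (fun r _ => hd r)]
  · simp
  · apply Continuous.intervalIntegrable
    have : Continuous fun r : ℝ => r • ξ := by fun_prop
    exact (continuous_id.pow 3).mul ((continuous_const.mul (hH.continuous.comp this)).add (hc.comp this))


/-! ### The divergence theorem on the unit ball -/

abbrev ee (j : Fin 4) : E 4 := EuclideanSpace.single j 1

lemma sum_coord (y : E 4) : ∑ j, y j • ee j = y := by
  ext k
  simp [ee, Finset.sum_apply, Pi.single_apply]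

lemma clm_sum (L : E 4 →L[ℝ] ℝ) (y : E 4) : ∑ j, y j * L (ee j) = L y := by
  conv_rhs => rw [← sum_coord y]
  simp [map_sum]

lemma norm_sq_coord (y : E 4) : ‖y‖ ^ 2 = ∑ j, y j ^ 2 := by
  rw [EuclideanSpace.norm_sq_eq]; simp

def Th (s : ℝ) : ℝ := s * deriv Real.smoothTransition s

lemma Th_zero_of_nonpos {s : ℝ} (hs : s ≤ 0) : Th s = 0 := by
  unfold Th
  rcases hs.lt_or_eq with h | h
  · have : Real.smoothTransition =ᶠ[nhds s] fun _ => 0 := by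
      filter_upwards [Iio_mem_nhds h] with a ha
      exact Real.smoothTransition.zero_of_nonpos (le_of_lt ha)
    rw [this.deriv_eq]; simp
  · simp [h]

lemma Th_zero_of_gt {s : ℝ} (hs : 1 < s) : Th s = 0 := by
  unfold Th
  have : Real.smoothTransition =ᶠ[nhds s] fun _ => 1 := by
    filter_upwards [Ioi_mem_nhds hs] with a ha
    exact Real.smoothTransition.one_of_one_le (le_of_lt ha)
  rw [this.deriv_eq]; simp

lemma Th_cont : Continuous Th := by
  unfold Th
  exact continuous_id.mul ((Real.smoothTransition.contDiff (n := 1)).continuous_deriv le_rfl)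

lemma Th_bound : ∃ M, ∀ s, |Th s| ≤ M := by
  obtain ⟨M, hM⟩ := (isCompact_Icc (a := (0:ℝ)) (b := 1)).exists_bound_of_continuousOn Th_cont.continuousOn
  refine ⟨max M 0, fun s => ?_⟩
  by_cases h0 : s ≤ 0
  · simp [Th_zero_of_nonpos h0]
  by_cases h1 : 1 < s
  · simp [Th_zero_of_gt h1]
  · exact (hM s ⟨by linarith, by linarith⟩).trans (le_max_left _ _)

def chi (n : ℝ) (y : E 4) : ℝ := Real.smoothTransition (n * (1 - ‖y‖ ^ 2))

lemma chi_contDiff (n : ℝ) : ContDiff ℝ 1 (chi n) := by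
  unfold chi
  exact (Real.smoothTransition.contDiff (n := 1)).comp
    (contDiff_const.mul (contDiff_const.sub (contDiff_norm_sq ℝ)))

lemma chi_fderiv (n : ℝ) (y v : E 4) :
    fderiv ℝ (chi n) y v = deriv Real.smoothTransition (n * (1 - ‖y‖ ^ 2)) * (n * (-(2 * inner ℝ y v))) := by
  have h1 : HasFDerivAt (fun y : E 4 => n * (1 - ‖y‖ ^ 2)) (n • (-((2:ℕ) • innerSL ℝ y))) y := by
    have := (hasStrictFDerivAt_norm_sq y).hasFDerivAt
    exact (this.const_sub 1).const_mul n
  have h2 : HasDerivAt Real.smoothTransition (deriv Real.smoothTransition (n * (1 - ‖y‖ ^ 2))) (n * (1 - ‖y‖ ^ 2)) :=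
    (((Real.smoothTransition.contDiff (n := 1)).differentiable one_ne_zero) _).hasDerivAt
  have h3 := h2.comp_hasFDerivAt y h1
  have : fderiv ℝ (chi n) y = _ := h3.fderiv
  rw [this]; simp

lemma chi_zero {n : ℝ} (hn : 0 ≤ n) {y : E 4} (hy : 1 ≤ ‖y‖) : chi n y = 0 := by
  unfold chi
  apply Real.smoothTransition.zero_of_nonpos
  apply mul_nonpos_of_nonneg_of_nonpos hn
  nlinarith

lemma chi_supp {n : ℝ} (hn : 0 ≤ n) : HasCompactSupport (chi n) := by
  refine HasCompactSupport.intro (isCompact_closedBall (0 : E 4) 1) fun y hy => chi_zero hn ?_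
  simp at hy; exact hy.le

lemma chi_ibp {n : ℝ} (hn : 0 ≤ n) (V : E 4 → ℝ) (hV : ContDiff ℝ 1 V) (v : E 4) :
    Integrable (fun y => chi n y * fderiv ℝ V y v) ∧ Integrable (fun y => fderiv ℝ (chi n) y v * V y) ∧
    ∫ y, chi n y * fderiv ℝ V y v = - ∫ y, fderiv ℝ (chi n) y v * V y := by
  have hc := (chi_contDiff n)
  have hs := chi_supp hn
  have c1 : Continuous fun y => fderiv ℝ V y v := (hV.continuous_fderiv one_ne_zero).clm_apply continuous_const
  have c2 : Continuous fun y => fderiv ℝ (chi n) y v := (hc.continuous_fderiv one_ne_zero).clm_apply continuous_const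
  have i1 : Integrable (fun y => fderiv ℝ (chi n) y v * V y) :=
    (c2.mul hV.continuous).integrable_of_hasCompactSupport ((hs.fderiv_apply (𝕜 := ℝ) v).mul_right)
  have i2 : Integrable (fun y => chi n y * fderiv ℝ V y v) :=
    (hc.continuous.mul c1).integrable_of_hasCompactSupport hs.mul_right
  refine ⟨i2, i1, ?_⟩
  apply integral_mul_fderiv_eq_neg_fderiv_mul_of_integrable i1 i2
  · exact (hc.continuous.mul hV.continuous).integrable_of_hasCompactSupport hs.mul_right
  · intro x _; exact hc.differentiable one_ne_zero x
  · intro x _; exact hV.differentiable one_ne_zero x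

lemma contDiff_coord (i : Fin 4) : ContDiff ℝ 1 (fun y : E 4 => y i) :=
  (EuclideanSpace.proj (𝕜 := ℝ) i).contDiff

lemma hasFDerivAt_coord (i : Fin 4) (y : E 4) :
    HasFDerivAt (fun y : E 4 => y i) (EuclideanSpace.proj (𝕜 := ℝ) i) y :=
  (EuclideanSpace.proj (𝕜 := ℝ) i).hasFDerivAt

lemma divg_ball (G : E 4 → ℝ) (hG : ContDiff ℝ 1 G) (i : Fin 4) :
    ∫ y in ball (0 : E 4) 1, fderiv ℝ G y (ee i) = ∫ y, G y * y i ∂(sphMeasure 4) := by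
  set D : E 4 → ℝ := fun y => fderiv ℝ G y (ee i) - y i * fderiv ℝ G y y - 5 * (G y * y i) with hD
  have cG' : ∀ v, Continuous fun y => fderiv ℝ G y v := fun v =>
    (hG.continuous_fderiv one_ne_zero).clm_apply continuous_const
  have cGy : Continuous fun y => fderiv ℝ G y y :=
    (hG.continuous_fderiv one_ne_zero).clm_apply continuous_id
  have ci : Continuous fun y : E 4 => y i := (contDiff_coord i).continuous
  have cD : Continuous D := ((cG' _).sub (ci.mul cGy)).sub (continuous_const.mul (hG.continuous.mul ci))
  -- the tangential field
  set V : Fin 4 → E 4 → ℝ := fun j y => G y * ((if i = j then 1 else 0) - y i * y j) with hV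
  have hVc : ∀ j, ContDiff ℝ 1 (V j) := fun j =>
    hG.mul (contDiff_const.sub ((contDiff_coord i).mul (contDiff_coord j)))
  have hVd : ∀ y, ∑ j, fderiv ℝ (V j) y (ee j) = D y := by
    intro y
    have h1 : ∀ j, fderiv ℝ (V j) y (ee j) = fderiv ℝ G y (ee j) * ((if i = j then 1 else 0) - y i * y j)
        - G y * (y i + y j * (if i = j then 1 else 0)) := by
      intro j
      have h := ((hG.differentiable one_ne_zero) y).hasFDerivAt.mul
        (((hasFDerivAt_coord i y).mul (hasFDerivAt_coord j y)).const_sub (if i = j then (1:ℝ) else 0))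
      have h' : fderiv ℝ (V j) y = _ := h.fderiv
      rw [h']
      by_cases hij : i = j
      · subst hij; simp [ee]; ring
      · simp [ee, hij]; ring
    simp_rw [h1, mul_sub, mul_add]
    simp only [Finset.sum_sub_distrib, Finset.sum_add_distrib, mul_ite, mul_one, mul_zero, Finset.sum_ite_eq, Finset.mem_univ, if_true]
    have h2 : ∑ j, fderiv ℝ G y (ee j) * (y i * y j) = y i * fderiv ℝ G y y := by
      rw [← clm_sum (fderiv ℝ G y) y, Finset.mul_sum]
      congr 1; ext j; ring
    rw [h2]
    simp [hD]; ring
  have key : ∀ n : ℕ, ∫ y, chi n y * D y = ∫ y, 2 * Th (n * (1 - ‖y‖ ^ 2)) * (y i * G y) := by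
    intro n
    have hn : (0:ℝ) ≤ n := n.cast_nonneg
    calc ∫ y, chi n y * D y = ∫ y, ∑ j, chi n y * fderiv ℝ (V j) y (ee j) := by
          congr 1; ext y; rw [← Finset.mul_sum, hVd]
      _ = ∑ j, ∫ y, chi n y * fderiv ℝ (V j) y (ee j) :=
          integral_finsetSum _ fun j _ => (chi_ibp hn (V j) (hVc j) (ee j)).1
      _ = ∑ j, - ∫ y, fderiv ℝ (chi n) y (ee j) * V j y := by
          congr 1; ext j; exact (chi_ibp hn (V j) (hVc j) (ee j)).2.2
      _ = - ∫ y, ∑ j, fderiv ℝ (chi n) y (ee j) * V j y := by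
          rw [integral_finsetSum _ fun j _ => (chi_ibp hn (V j) (hVc j) (ee j)).2.1, Finset.sum_neg_distrib]
      _ = _ := by
          rw [← integral_neg]
          congr 1; ext y
          have h3 : ∀ j, fderiv ℝ (chi n) y (ee j) * V j y =
              (-(2 * n * deriv Real.smoothTransition (n * (1 - ‖y‖ ^ 2)) * G y)) * (y j * (if i = j then 1 else 0) - y i * y j ^ 2) := by
            intro j
            rw [chi_fderiv]
            have : inner ℝ y (ee j) = y j := by
              rw [EuclideanSpace.inner_single_right]; simp
            rw [this, hV]; ring
          simp_rw [h3]
          rw [← Finset.mul_sum, Finset.sum_sub_distrib, ← Finset.mul_sum, ← norm_sq_coord]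
          simp only [mul_ite, mul_one, mul_zero, Finset.sum_ite_eq, Finset.mem_univ, if_true]
          unfold Th; ring
  -- limits
  have hbi : ∀ f : E 4 → ℝ, Continuous f → Integrable ((closedBall (0 : E 4) 1).indicator fun y => |f y|) := by
    intro f hf
    rw [integrable_indicator_iff isClosed_closedBall.measurableSet]
    exact hf.abs.continuousOn.integrableOn_compact (isCompact_closedBall 0 1)
  have lim1 : Tendsto (fun n : ℕ => ∫ y, chi n y * D y) atTop (nhds (∫ y, (ball (0 : E 4) 1).indicator D y)) := by
    refine tendsto_integral_of_dominated_convergence _ (fun n => ((chi_contDiff _).continuous.mul cD).aestronglyMeasurable)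
      (hbi D cD) (fun n => Eventually.of_forall fun y => ?_) (Eventually.of_forall fun y => ?_)
    · by_cases hy : y ∈ closedBall (0 : E 4) 1
      · rw [Set.indicator_of_mem hy, Real.norm_eq_abs, abs_mul]
        have : |chi n y| ≤ 1 := by
          unfold chi
          rw [abs_of_nonneg (Real.smoothTransition.nonneg _)]
          exact Real.smoothTransition.le_one _
        exact mul_le_of_le_one_left (abs_nonneg _) this
      · rw [Set.indicator_of_notMem hy, chi_zero n.cast_nonneg]
        · simp
        · simp at hy; exact hy.le
    · by_cases hy : y ∈ ball (0 : E 4) 1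
      · rw [Set.indicator_of_mem hy]
        have hy' : 0 < 1 - ‖y‖ ^ 2 := by
          simp at hy; nlinarith [norm_nonneg y]
        have h := (tendsto_natCast_atTop_atTop (R := ℝ)).atTop_mul_const hy'
        refine tendsto_const_nhds.congr' ?_
        filter_upwards [h.eventually_ge_atTop 1] with n hn
        unfold chi
        rw [Real.smoothTransition.one_of_one_le hn, one_mul]
      · rw [Set.indicator_of_notMem hy]
        refine tendsto_const_nhds.congr fun n => ?_
        rw [chi_zero n.cast_nonneg (by simpa using hy), zero_mul]
  obtain ⟨M, hM⟩ := Th_bound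
  have lim2 : Tendsto (fun n : ℕ => ∫ y, 2 * Th (n * (1 - ‖y‖ ^ 2)) * (y i * G y)) atTop (nhds (∫ y : E 4, (0:ℝ))) := by
    refine tendsto_integral_of_dominated_convergence _ (fun n => ?_)
      ((hbi (fun y => y i * G y) (ci.mul hG.continuous)).const_mul (2 * M)) (fun n => Eventually.of_forall fun y => ?_) (Eventually.of_forall fun y => ?_)
    · apply Continuous.aestronglyMeasurable
      exact (continuous_const.mul (Th_cont.comp (by fun_prop))).mul (ci.mul hG.continuous)
    · by_cases hy : y ∈ closedBall (0 : E 4) 1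
      · rw [Set.indicator_of_mem hy, Real.norm_eq_abs, abs_mul, abs_mul, abs_of_pos (by norm_num : (0:ℝ) < 2)]
        gcongr; exact hM _
      · rw [Set.indicator_of_notMem hy, Th_zero_of_nonpos]
        · simp
        · simp at hy
          apply mul_nonpos_of_nonneg_of_nonpos n.cast_nonneg
          nlinarith
    · by_cases hy : 0 < 1 - ‖y‖ ^ 2
      · have h := (tendsto_natCast_atTop_atTop (R := ℝ)).atTop_mul_const hy
        refine tendsto_const_nhds.congr' ?_
        filter_upwards [h.eventually_gt_atTop 1] with n hn
        rw [Th_zero_of_gt hn]; simp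
      · refine tendsto_const_nhds.congr fun n => ?_
        rw [Th_zero_of_nonpos (mul_nonpos_of_nonneg_of_nonpos n.cast_nonneg (not_lt.1 hy))]; simp
  have hzero : ∫ y in ball (0 : E 4) 1, D y = 0 := by
    rw [← integral_indicator measurableSet_ball]
    have := tendsto_nhds_unique (lim1.congr key) lim2
    simpa using this
  have hEu := euler_ball (fun y => G y * y i) (hG.mul (contDiff_coord i))
  rw [← hEu]
  have bint : ∀ f : E 4 → ℝ, Continuous f → IntegrableOn f (ball (0 : E 4) 1) := fun f hf =>
    (hf.continuousOn.integrableOn_compact (isCompact_closedBall 0 1)).mono_set ball_subset_closedBall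
  have hfe : ∀ y, 4 * (G y * y i) + fderiv ℝ (fun y => G y * y i) y y = fderiv ℝ G y (ee i) - D y := by
    intro y
    have h := ((hG.differentiable one_ne_zero) y).hasFDerivAt.mul (hasFDerivAt_coord i y)
    have h' : fderiv ℝ (fun y => G y * y i) y = _ := h.fderiv
    rw [h']
    simp [hD]; ring
  simp_rw [hfe]
  rw [integral_sub (bint _ (cG' _)) (bint _ cD), hzero, sub_zero]

/-- Green's second identity on the unit ball. -/
lemma green_ball (K u : E 4 → ℝ) (hK : ContDiff ℝ (⊤ : ℕ∞) K) (hu : ContDiff ℝ (⊤ : ℕ∞) u) :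
    ∫ y in ball (0 : E 4) 1, (K y * lap 4 u y - u y * lap 4 K y) =
      ∫ y, (K y * fderiv ℝ u y y - u y * fderiv ℝ K y y) ∂(sphMeasure 4) := by
  have d1 : ∀ (f : E 4 → ℝ), ContDiff ℝ (⊤ : ℕ∞) f → ∀ i, ContDiff ℝ (⊤ : ℕ∞) (fun y => fderiv ℝ f y (ee i)) := by
    intro f hf i
    exact (hf.fderiv_right (m := (⊤ : ℕ∞)) (by simp)).clm_apply contDiff_const
  have le1 : (1 : WithTop ℕ∞) ≤ ((⊤ : ℕ∞) : WithTop ℕ∞) := by exact_mod_cast le_top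
  have dif : ∀ (f : E 4 → ℝ), ContDiff ℝ (⊤ : ℕ∞) f → Differentiable ℝ f := fun f hf => hf.differentiable (by simp)
  set G : Fin 4 → E 4 → ℝ := fun i y => K y * fderiv ℝ u y (ee i) - u y * fderiv ℝ K y (ee i) with hG
  have hGc : ∀ i, ContDiff ℝ 1 (G i) := fun i =>
    (((hK.mul (d1 u hu i)).sub (hu.mul (d1 K hK i)))).of_le le1
  have hdiv : ∀ y, ∑ i, fderiv ℝ (G i) y (ee i) = K y * lap 4 u y - u y * lap 4 K y := by
    intro y
    have : ∀ i, fderiv ℝ (G i) y (ee i) = K y * fderiv ℝ (fun y => fderiv ℝ u y (ee i)) y (ee i)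
        - u y * fderiv ℝ (fun y => fderiv ℝ K y (ee i)) y (ee i) := by
      intro i
      have h := ((dif K hK y).hasFDerivAt.mul (dif _ (d1 u hu i) y).hasFDerivAt).sub
        ((dif u hu y).hasFDerivAt.mul (dif _ (d1 K hK i) y).hasFDerivAt)
      have h' : fderiv ℝ (G i) y = _ := h.fderiv
      rw [h']; simp; ring
    simp_rw [this]
    rw [Finset.sum_sub_distrib, ← Finset.mul_sum, ← Finset.mul_sum]; rfl
  have hbd : ∀ y, ∑ i, G i y * y i = K y * fderiv ℝ u y y - u y * fderiv ℝ K y y := by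
    intro y
    rw [← clm_sum (fderiv ℝ u y) y, ← clm_sum (fderiv ℝ K y) y, Finset.mul_sum, Finset.mul_sum, ← Finset.sum_sub_distrib]
    congr 1; ext i; simp [hG]; ring
  simp_rw [← hdiv, ← hbd]
  rw [integral_finsetSum, integral_finsetSum]
  · congr 1; ext i; exact divg_ball _ (hGc i) i
  · intro i _
    have hc : Continuous fun y => G i y * y i := (hGc i).continuous.mul (contDiff_coord i).continuous
    obtain ⟨C, hC⟩ := (isCompact_closedBall (0 : E 4) 1).exists_bound_of_continuousOn hc.continuousOn
    refine Integrable.of_bound hc.aestronglyMeasurable C ?_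
    filter_upwards [sph_ae] with x hx
    exact hC x (by simp [hx])
  · intro i _
    have hc : Continuous fun y => fderiv ℝ (G i) y (ee i) := ((hGc i).continuous_fderiv one_ne_zero).clm_apply continuous_const
    exact (hc.continuousOn.integrableOn_compact (isCompact_closedBall 0 1)).mono_set ball_subset_closedBall


/-! ### Growth of measures and potentials -/

open scoped Pointwise in
lemma sph_growth_aux (y : E 4) (r : ℝ) (hr : 0 < r) (hr1 : r ≤ 1) :
    (sphMeasure 4).real (ball y r) ≤ 32 * Real.pi ^ 2 * r ^ 3 := by
  set s : Set (sphere (0 : E 4) 1) := Subtype.val ⁻¹' (ball y r) with hs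
  have hsm : MeasurableSet s := measEmb_sph.measurable measurableSet_ball
  set A : Set (E 4) := Set.Ioo (0:ℝ) 1 • (Subtype.val '' s) with hA
  have h1 : (sphMeasure 4).real (ball y r) = 4 * (volume : Measure (E 4)).real A := by
    unfold sphMeasure
    rw [measureReal_def, Measure.map_apply measEmb_sph.measurable measurableSet_ball,
      Measure.toSphere_apply' _ hsm, fr4, ENNReal.toReal_mul]
    simp [measureReal_def, hA, hs]
  have hAb : A ⊆ ball 0 1 := by
    rintro _ ⟨t, ht, _, ⟨ξ, hξ, rfl⟩, rfl⟩
    simp [norm_smul, abs_of_pos ht.1, ht.2]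
  have hfin : (volume : Measure (E 4)) A ≠ ⊤ := ((measure_mono hAb).trans_lt measure_ball_lt_top).ne
  have hsub : A ⊆ ((1 - r) • A) ∪ ball y (2 * r) := by
    rintro _ ⟨t, ht, _, ⟨ξ, hξ, rfl⟩, rfl⟩
    by_cases h : t < 1 - r
    · left
      have h0 : 0 < 1 - r := ht.1.trans h
      refine ⟨(t / (1 - r)) • ξ.1, ⟨t / (1 - r), ⟨div_pos ht.1 h0, (div_lt_one h0).2 h⟩, ξ.1, ⟨ξ, hξ, rfl⟩, rfl⟩, ?_⟩
      simp only [smul_smul]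
      rw [mul_div_cancel₀ _ h0.ne']
    · right
      have hξ' : dist ξ.1 y < r := hξ
      have : dist (t • ξ.1) ξ.1 ≤ r := by
        rw [dist_eq_norm, show t • ξ.1 - ξ.1 = (t - 1) • ξ.1 by rw [sub_smul, one_smul], norm_smul]
        simp only [norm_eq_of_mem_sphere, mul_one, Real.norm_eq_abs]
        rw [abs_le]; constructor <;> linarith [ht.2]
      simp only [mem_ball]
      linarith [dist_triangle (t • ξ.1) ξ.1 y]
  have h2 : (volume : Measure (E 4)).real A ≤ (1 - r) ^ 4 * (volume : Measure (E 4)).real A + 16 * r ^ 4 * (Real.pi ^ 2 / 2) := by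
    have hf2 : (volume : Measure (E 4)) ((1 - r) • A) ≠ ⊤ := by
      rw [Measure.addHaar_smul]; exact ENNReal.mul_ne_top ENNReal.ofReal_ne_top hfin
    calc (volume : Measure (E 4)).real A ≤ (volume : Measure (E 4)).real (((1 - r) • A) ∪ ball y (2 * r)) :=
          measureReal_mono hsub (by
            exact (measure_union_lt_top hf2.lt_top measure_ball_lt_top).ne)
      _ ≤ (volume : Measure (E 4)).real ((1 - r) • A) + (volume : Measure (E 4)).real (ball y (2 * r)) := measureReal_union_le _ _
      _ = _ := by
        congr 1
        · rw [measureReal_def, Measure.addHaar_smul, ENNReal.toReal_mul, fr4, ENNReal.toReal_ofReal (abs_nonneg _),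
            abs_of_nonneg (by positivity), measureReal_def]
        · rw [measureReal_def, Measure.addHaar_ball _ _ (by positivity), ENNReal.toReal_mul, fr4,
            ENNReal.toReal_ofReal (by positivity), ← measureReal_def, vol_ball_one]
          ring
  have h3 : (1 - r) ^ 4 ≤ 1 - r := by
    have := pow_le_of_le_one (by linarith : 0 ≤ 1 - r) (by linarith) (n := 4) (by norm_num)
    exact this
  have h4 : (1 - r) ^ 4 * (volume : Measure (E 4)).real A ≤ (1 - r) * (volume : Measure (E 4)).real A :=
    mul_le_mul_of_nonneg_right h3 measureReal_nonneg
  have h5 : r * (volume : Measure (E 4)).real A ≤ r * (8 * Real.pi ^ 2 * r ^ 3) := by nlinarith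
  have h6 := le_of_mul_le_mul_left h5 hr
  rw [h1]; linarith

lemma sph_growth (y : E 4) (r : ℝ) (hr : 0 < r) :
    sphMeasure 4 (ball y r) ≤ ENNReal.ofReal (32 * Real.pi ^ 2 * r ^ 3) := by
  rw [← ENNReal.ofReal_toReal (measure_ne_top (sphMeasure 4) (ball y r))]
  apply ENNReal.ofReal_le_ofReal
  rcases le_or_gt r 1 with h | h
  · exact sph_growth_aux y r hr h
  · have h1 : (sphMeasure 4).real (ball y r) ≤ (sphMeasure 4).real Set.univ := measureReal_mono (Set.subset_univ _)
    rw [sph_mass] at h1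
    have h2 : 1 ≤ r ^ 3 := one_le_pow₀ h.le
    have : (0:ℝ) < Real.pi ^ 2 := by positivity
    change (sphMeasure 4).real (ball y r) ≤ _
    nlinarith

lemma vol_growth (y : E 4) (r : ℝ) (hr : 0 < r) :
    (volume : Measure (E 4)) (ball y r) ≤ ENNReal.ofReal (Real.pi ^ 2 / 2 * r ^ 4) := by
  rw [Measure.addHaar_ball _ _ hr.le, fr4, ← ENNReal.ofReal_toReal (measure_ball_lt_top (μ := (volume : Measure (E 4))) (x := 0) (r := 1)).ne,
    ← measureReal_def, vol_ball_one, ← ENNReal.ofReal_mul (by positivity)]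
  apply le_of_eq; congr 1; ring

lemma pot_bound (μ : Measure (E 4)) (C : ℝ) (hC : 0 ≤ C) (d p : ℕ) (hp : 0 < p) (hpd : p < d)
    (h : ∀ y r, 0 < r → μ (ball y r) ≤ ENNReal.ofReal (C * r ^ d)) (y : E 4) (r : ℝ) (hr : 0 < r) :
    ∫⁻ x in ball y r, ENNReal.ofReal ((‖x - y‖ ^ p)⁻¹) ∂μ ≤ ENNReal.ofReal (C * 2 ^ (d + p + 1) * r ^ (d - p)) := by
  have hpt : ∀ x ∈ ball y r, ENNReal.ofReal ((‖x - y‖ ^ p)⁻¹) ≤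
      ∑' k : ℕ, (ball y (r * (1/2) ^ k * 2)).indicator (fun _ => ENNReal.ofReal (((r * (1/2) ^ (k+1)) ^ p)⁻¹)) x := by
    intro x hx
    rcases eq_or_ne x y with rfl | hne
    · simp [hp.ne']
    · have hpos : 0 < ‖x - y‖ := norm_pos_iff.2 (sub_ne_zero.2 hne)
      rw [mem_ball, dist_eq_norm] at hx
      obtain ⟨k, hk1, hk2⟩ := exists_nat_pow_near_of_lt_one (x := ‖x - y‖ / r) (y := (1/2 : ℝ)) (by positivity)
        ((div_le_one hr).2 hx.le) (by norm_num) (by norm_num)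
      rw [lt_div_iff₀ hr] at hk1
      rw [div_le_iff₀ hr] at hk2
      have hmem : x ∈ ball y (r * (1/2) ^ k * 2) := by
        rw [mem_ball, dist_eq_norm]; nlinarith
      refine le_trans ?_ (ENNReal.le_tsum k)
      rw [Set.indicator_of_mem hmem]
      apply ENNReal.ofReal_le_ofReal
      apply inv_anti₀ (by positivity)
      gcongr; linarith
  calc ∫⁻ x in ball y r, ENNReal.ofReal ((‖x - y‖ ^ p)⁻¹) ∂μ
      ≤ ∫⁻ x in ball y r, ∑' k : ℕ, (ball y (r * (1/2) ^ k * 2)).indicator (fun _ => ENNReal.ofReal (((r * (1/2) ^ (k+1)) ^ p)⁻¹)) x ∂μ :=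
        setLIntegral_mono' measurableSet_ball hpt
    _ ≤ ∫⁻ x, ∑' k : ℕ, (ball y (r * (1/2) ^ k * 2)).indicator (fun _ => ENNReal.ofReal (((r * (1/2) ^ (k+1)) ^ p)⁻¹)) x ∂μ :=
        setLIntegral_le_lintegral _ _
    _ = ∑' k : ℕ, ENNReal.ofReal (((r * (1/2) ^ (k+1)) ^ p)⁻¹) * μ (ball y (r * (1/2) ^ k * 2)) := by
        rw [lintegral_tsum (fun k => (measurable_const.indicator measurableSet_ball).aemeasurable)]
        congr 1; ext k
        rw [lintegral_indicator_const measurableSet_ball]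
    _ ≤ ∑' k : ℕ, ENNReal.ofReal ((C * 2 ^ (d + p) * r ^ (d - p)) * (1/2) ^ k) := by
        refine ENNReal.tsum_le_tsum fun k => ?_
        calc _ ≤ ENNReal.ofReal (((r * (1/2) ^ (k+1)) ^ p)⁻¹) * ENNReal.ofReal (C * (r * (1/2) ^ k * 2) ^ d) := by
              gcongr; exact h _ _ (by positivity)
          _ = ENNReal.ofReal (((r * (1/2) ^ (k+1)) ^ p)⁻¹ * (C * (r * (1/2) ^ k * 2) ^ d)) := by
              rw [← ENNReal.ofReal_mul (by positivity)]
          _ ≤ _ := by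
              apply ENNReal.ofReal_le_ofReal
              obtain ⟨e, rfl⟩ : ∃ e, d = p + e := ⟨d - p, by omega⟩
              have he : 1 ≤ e := by omega
              rw [Nat.add_sub_cancel_left]
              have hq : (0:ℝ) < (1/2) ^ k := by positivity
              have hq1 : ((1/2 : ℝ) ^ k) ^ e ≤ (1/2) ^ k :=
                pow_le_of_le_one hq.le (pow_le_one₀ (by norm_num) (by norm_num)) (by omega)
              have : ((r * (1/2) ^ (k+1)) ^ p)⁻¹ * (C * (r * (1/2) ^ k * 2) ^ (p + e)) =
                  C * 2 ^ (p + e + p) * r ^ e * ((1/2) ^ k) ^ e := by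
                rw [pow_succ (1/2 : ℝ) k]
                generalize (1/2 : ℝ) ^ k = q at *
                have : (r * (q * (1/2))) ^ p * 2 ^ p = (r * q) ^ p := by
                  rw [← mul_pow]; congr 1; ring
                have h2 : (r * q * 2) ^ (p + e) = (r * (q * (1/2))) ^ p * 2 ^ p * (2 ^ p * (r ^ e * q ^ e * 2 ^ e)) := by
                  rw [this]; simp only [mul_pow, pow_add]; ring
                rw [h2]
                field_simp
                ring
              rw [this]
              gcongr
    _ = ENNReal.ofReal (C * 2 ^ (d + p + 1) * r ^ (d - p)) := by
        rw [← ENNReal.ofReal_tsum_of_nonneg (fun k => by positivity)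
          ((summable_geometric_of_lt_one (by norm_num) (by norm_num)).mul_left _), tsum_mul_left, tsum_geometric_two]
        congr 1; ring

/-- Cauchy-Schwarz for lower integrals. -/
lemma cs_lint {α : Type*} [MeasurableSpace α] (μ : Measure α) (f g : α → ℝ≥0∞) (hf : AEMeasurable f μ) (hg : AEMeasurable g μ) :
    (∫⁻ x, f x * g x ∂μ) ^ 2 ≤ (∫⁻ x, f x ^ 2 ∂μ) * ∫⁻ x, g x ^ 2 ∂μ := by
  have h := ENNReal.lintegral_mul_le_Lp_mul_Lq μ (Real.HolderConjugate.two_two) hf hg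
  have h2 : ∀ a : ℝ≥0∞, (a ^ (1 / (2:ℝ))) ^ 2 = a := by
    intro a
    rw [← ENNReal.rpow_natCast, ← ENNReal.rpow_mul]; norm_num
  simp only [ENNReal.rpow_two] at h
  calc _ ≤ _ := pow_le_pow_left' h 2
    _ = _ := by rw [mul_pow, h2, h2]

lemma radial_log (r : ℝ) (hr : 0 < r) (hr2 : r ≤ 2) :
    ∫⁻ z : E 4, ENNReal.ofReal ((Set.Ico r 2).indicator (fun s => (s ^ 4)⁻¹) ‖z‖) = ENNReal.ofReal (2 * Real.pi ^ 2 * Real.log (2 / r)) := by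
  have hm : Measurable ((Set.Ico r 2).indicator (fun s : ℝ => (s ^ 4)⁻¹)) :=
    ((measurable_id.pow_const 4).inv).indicator measurableSet_Ico
  have hnn : ∀ s, 0 ≤ (Set.Ico r 2).indicator (fun s : ℝ => (s ^ 4)⁻¹) s := by
    intro s; apply Set.indicator_nonneg; intro s hs; positivity
  have hintg : Integrable (fun z : E 4 => (Set.Ico r 2).indicator (fun s => (s ^ 4)⁻¹) ‖z‖) := by
    have : IntegrableOn (fun z : E 4 => (Set.Ico r 2).indicator (fun s => (s ^ 4)⁻¹) ‖z‖) (ball 0 2) := by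
      refine Measure.integrableOn_of_bounded (M := (r ^ 4)⁻¹) measure_ball_lt_top.ne (hm.comp measurable_norm).aestronglyMeasurable ?_
      refine Eventually.of_forall fun z => ?_
      rw [Real.norm_eq_abs, abs_of_nonneg (hnn _)]
      by_cases h : ‖z‖ ∈ Set.Ico r 2
      · rw [Set.indicator_of_mem h]
        exact inv_anti₀ (by positivity) (by gcongr; exact h.1)
      · rw [Set.indicator_of_notMem h]; positivity
    rw [← integrableOn_iff_integrable_of_support_subset (s := ball (0 : E 4) 2)]
    · exact this
    · intro z hz
      by_contra h
      apply hz
      apply Set.indicator_of_notMem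
      simp at h
      intro h'; linarith [h'.2]
  rw [← ofReal_integral_eq_lintegral_ofReal hintg (Eventually.of_forall fun z => hnn _)]
  congr 1
  rw [integral_fun_norm_addHaar volume ((Set.Ico r 2).indicator (fun s => (s ^ 4)⁻¹)), vol_ball_one, fr4]
  have : ∫ s in Set.Ioi (0:ℝ), s ^ (4 - 1) • (Set.Ico r 2).indicator (fun s => (s ^ 4)⁻¹) s = Real.log (2 / r) := by
    rw [← integral_inv_of_pos hr (by norm_num), intervalIntegral.integral_of_le hr2, ← integral_Ico_eq_integral_Ioc,
      ← integral_indicator measurableSet_Ioi, ← integral_indicator measurableSet_Ico]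
    congr 1; ext s
    by_cases h : s ∈ Set.Ico r 2
    · have h0 : 0 < s := hr.trans_le h.1
      rw [Set.indicator_of_mem (Set.mem_Ioi.2 h0), Set.indicator_of_mem h, Set.indicator_of_mem h, smul_eq_mul]
      field_simp
    · rw [Set.indicator_of_notMem h]
      by_cases h0 : s ∈ Set.Ioi (0:ℝ)
      · rw [Set.indicator_of_mem h0, Set.indicator_of_notMem h, smul_zero]
      · rw [Set.indicator_of_notMem h0]
  rw [this]; simp; ring

/-- The sharp half-ball estimate. -/
lemma half_log (x : E 4) (hx : ‖x‖ = 1) (r : ℝ) (hr : 0 < r) (hr2 : r ≤ 2) :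
    ∫⁻ y in ball (0 : E 4) 1 ∩ (ball x r)ᶜ, ENNReal.ofReal ((‖x - y‖ ^ 4)⁻¹) ≤ ENNReal.ofReal (Real.pi ^ 2 * Real.log (2 / r)) := by
  set F : E 4 → ℝ≥0∞ := fun z => ENNReal.ofReal ((Set.Ico r 2).indicator (fun s => (s ^ 4)⁻¹) ‖z‖) with hF
  have hFm : Measurable F := by
    have hm : Measurable ((Set.Ico r 2).indicator (fun s : ℝ => (s ^ 4)⁻¹)) :=
      ((measurable_id.pow_const 4).inv).indicator measurableSet_Ico
    exact ENNReal.measurable_ofReal.comp (hm.comp measurable_norm)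
  have hFn : ∀ z, F (-z) = F z := by intro z; simp [hF]
  set H : Set (E 4) := {z | inner ℝ x z < 0} with hH
  have hHm : MeasurableSet H := (isOpen_lt (by fun_prop) continuous_const).measurableSet
  set H' : Set (E 4) := {z | 0 < inner ℝ x z} with hH'
  have hH'm : MeasurableSet H' := (isOpen_lt continuous_const (by fun_prop)).measurableSet
  have h1 : ∫⁻ y in ball (0 : E 4) 1 ∩ (ball x r)ᶜ, ENNReal.ofReal ((‖x - y‖ ^ 4)⁻¹) ≤ ∫⁻ z in H, F z := by
    rw [← lintegral_indicator hHm, ← lintegral_indicator (measurableSet_ball.inter measurableSet_ball.compl),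
      ← lintegral_add_right_eq_self (μ := volume) _ x]
    apply lintegral_mono
    intro z
    by_cases hz : z + x ∈ ball (0 : E 4) 1 ∩ (ball x r)ᶜ
    · simp only
      rw [Set.indicator_of_mem hz]
      obtain ⟨hz1, hz2⟩ := hz
      simp only [mem_ball, dist_zero_right] at hz1
      simp only [Set.mem_compl_iff, mem_ball, dist_eq_norm, add_sub_cancel_right, not_lt] at hz2
      have hzn : ‖z‖ < 2 := by
        have := norm_sub_le (z + x) x
        rw [add_sub_cancel_right] at this; linarith
      have hzH : z ∈ H := by
        have := norm_add_sq_real z x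
        rw [hx] at this
        have h3 : ‖z + x‖ ^ 2 < 1 := by nlinarith [norm_nonneg (z + x)]
        have h4 : 0 < ‖z‖ ^ 2 := by have := hr.trans_le hz2; positivity
        rw [hH, Set.mem_ofPred_eq, real_inner_comm]; linarith
      rw [Set.indicator_of_mem hzH, hF]
      simp only
      rw [Set.indicator_of_mem (Set.mem_Ico.2 ⟨hz2, hzn⟩)]
      rw [show x - (z + x) = -z by abel, norm_neg]
    · simp only
      rw [Set.indicator_of_notMem hz]; simp
  have h2 : ∫⁻ z in H, F z = ∫⁻ z in H', F z := by
    rw [← lintegral_indicator hHm, ← lintegral_indicator hH'm, ← lintegral_neg_eq_self]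
    congr 1; ext z
    have : -z ∈ H ↔ z ∈ H' := by simp [hH, hH']
    by_cases hz : z ∈ H'
    · rw [Set.indicator_of_mem hz, Set.indicator_of_mem (this.2 hz), hFn]
    · rw [Set.indicator_of_notMem hz, Set.indicator_of_notMem (fun h => hz (this.1 h))]
  have h3 : (∫⁻ z in H, F z) + ∫⁻ z in H', F z ≤ ENNReal.ofReal (2 * Real.pi ^ 2 * Real.log (2 / r)) := by
    rw [← radial_log r hr hr2, ← lintegral_union hH'm]
    · exact setLIntegral_le_lintegral _ _
    · rw [Set.disjoint_left]; intro z h h'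
      simp only [hH, hH', Set.mem_ofPred_eq] at h h'; linarith
  rw [← h2, ← two_mul] at h3
  refine h1.trans ?_
  rw [mul_assoc, ENNReal.ofReal_mul (by norm_num)] at h3
  simp only [ENNReal.ofReal_ofNat] at h3
  exact (ENNReal.mul_le_mul_iff_right (by norm_num) (by norm_num)).1 h3


lemma fderiv_smooth (f : E 4 → ℝ) (hf : ContDiff ℝ (⊤ : ℕ∞) f) (v : E 4) :
    ContDiff ℝ (⊤ : ℕ∞) (fun y => fderiv ℝ f y v) :=
  (hf.fderiv_right (m := (⊤ : ℕ∞)) (by simp)).clm_apply contDiff_const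

lemma lap_cont (f : E 4 → ℝ) (hf : ContDiff ℝ (⊤ : ℕ∞) f) : Continuous (lap 4 f) := by
  unfold lap
  refine continuous_finsetSum _ fun i _ => ?_
  exact (fderiv_smooth _ (fderiv_smooth f hf _) _).continuous

lemma lap_congr {f g : E 4 → ℝ} {y : E 4} (h : f =ᶠ[nhds y] g) : lap 4 f y = lap 4 g y := by
  unfold lap
  refine Finset.sum_congr rfl fun i _ => ?_
  have : (fun y => fderiv ℝ f y (EuclideanSpace.single i 1)) =ᶠ[nhds y]
      (fun y => fderiv ℝ g y (EuclideanSpace.single i 1)) := by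
    filter_upwards [h.fderiv (𝕜 := ℝ)] with z hz
    rw [hz]
  rw [this.fderiv_eq]

def Kt (x : E 4) (t : ℝ) (y : E 4) : ℝ := (‖x - t • y‖ ^ 2)⁻¹

lemma Kt_hasFDerivAt (x : E 4) (t : ℝ) (y : E 4) (h : x - t • y ≠ 0) :
    HasFDerivAt (Kt x t) ((2 * t * ((‖x - t • y‖ ^ 2) ^ 2)⁻¹) • innerSL ℝ (x - t • y)) y := by
  have h1 : HasFDerivAt (fun y : E 4 => x - t • y) (-(t • ContinuousLinearMap.id ℝ (E 4))) y := by
    simpa using (((hasFDerivAt_id y).const_smul t).const_sub x)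
  have h2 := ((hasStrictFDerivAt_norm_sq (x - t • y)).hasFDerivAt.comp y h1)
  have hq : ‖x - t • y‖ ^ 2 ≠ 0 := by positivity
  have h3 := (hasDerivAt_inv hq).comp_hasFDerivAt y h2
  refine h3.congr_fderiv ?_
  ext v
  simp
  ring

lemma Kt_fderiv (x : E 4) (t : ℝ) (y v : E 4) (h : x - t • y ≠ 0) :
    fderiv ℝ (Kt x t) y v = 2 * t * ((‖x - t • y‖ ^ 2) ^ 2)⁻¹ * inner ℝ (x - t • y) v := by
  rw [(Kt_hasFDerivAt x t y h).fderiv]; rfl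

lemma Kt_lap (x : E 4) (t : ℝ) (y : E 4) (h : x - t • y ≠ 0) : lap 4 (Kt x t) y = 0 := by
  have hev : ∀ᶠ z in nhds y, x - t • z ≠ 0 :=
    (show Continuous fun z : E 4 => x - t • z by fun_prop).continuousAt.eventually_ne h
  have hq : ‖x - t • y‖ ^ 2 ≠ 0 := by positivity
  have key : ∀ i : Fin 4, fderiv ℝ (fun y => fderiv ℝ (Kt x t) y (EuclideanSpace.single i 1)) y
      (EuclideanSpace.single i 1) = 8 * t ^ 2 * ((‖x - t • y‖ ^ 2)⁻¹) ^ 3 * ((x - t • y) i) ^ 2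
        - 2 * t ^ 2 * ((‖x - t • y‖ ^ 2)⁻¹) ^ 2 := by
    intro i
    have hsing : ∀ w : E 4, inner ℝ w (EuclideanSpace.single i (1:ℝ)) = w i := by
      intro w; simp [EuclideanSpace.inner_single_right]
    have e1 : (fun y => fderiv ℝ (Kt x t) y (EuclideanSpace.single i 1)) =ᶠ[nhds y]
        fun z => 2 * t * (Kt x t z ^ 2 * (x i - t * z i)) := by
      filter_upwards [hev] with z hz
      rw [Kt_fderiv x t z _ hz]
      rw [hsing]
      simp [Kt]
      ring
    rw [e1.fderiv_eq]
    have h2 : HasFDerivAt (fun z : E 4 => x i - t * z i) (-(t • EuclideanSpace.proj (𝕜 := ℝ) i)) y :=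
      ((hasFDerivAt_coord i y).const_mul t).const_sub (x i)
    have h3 := (((Kt_hasFDerivAt x t y h).pow 2).mul h2).const_mul (2 * t)
    have h3' : HasFDerivAt (fun z => 2 * t * (Kt x t z ^ 2 * (x i - t * z i))) _ y := h3
    rw [h3'.fderiv]
    simp [Kt, hsing]
    field_simp
    ring
  unfold lap
  simp only [key]
  rw [Finset.sum_sub_distrib, ← Finset.mul_sum, ← norm_sq_coord]
  simp
  field_simp
  ring

lemma Kt_ne (x : E 4) (hx : ‖x‖ = 1) (t : ℝ) (ht : 0 ≤ t) (y : E 4) (hy : t * ‖y‖ < 1) : x - t • y ≠ 0 := by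
  intro h
  rw [sub_eq_zero] at h
  have : ‖x‖ = t * ‖y‖ := by rw [h, norm_smul, Real.norm_of_nonneg ht]
  linarith

lemma green_K (x : E 4) (hx : ‖x‖ = 1) (t : ℝ) (ht : 0 ≤ t) (ht1 : t < 1) (u : E 4 → ℝ)
    (hu : ContDiff ℝ (⊤ : ℕ∞) u) :
    ∫ y in ball (0 : E 4) 1, Kt x t y * lap 4 u y =
      ∫ y, (Kt x t y * fderiv ℝ u y y - u y * fderiv ℝ (Kt x t) y y) ∂(sphMeasure 4) := by
  let b : ContDiffBump (0 : E 4) := ⟨1 + (1 - t) / 4, 1 + (1 - t) / 2, by linarith, by linarith⟩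
  have hb1 : b.rIn = 1 + (1 - t) / 4 := rfl
  have hb2 : b.rOut = 1 + (1 - t) / 2 := rfl
  set K : E 4 → ℝ := fun y => b y * Kt x t y with hK
  have hKs : ContDiff ℝ (⊤ : ℕ∞) K := by
    rw [contDiff_iff_contDiffAt]
    intro y
    by_cases hy : y ∈ tsupport K
    swap
    · exact (contDiffAt_const (c := (0:ℝ))).congr_of_eventuallyEq (notMem_tsupport_iff_eventuallyEq.1 hy)
    have hy' : y ∈ tsupport b := tsupport_mul_subset_left hy
    rw [b.tsupport_eq] at hy'
    have hn : ‖y‖ ≤ 1 + (1 - t) / 2 := by simpa [hb2] using hy'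
    have hne := Kt_ne x hx t ht y (by nlinarith)
    refine (b.contDiff (n := (⊤ : ℕ∞))).contDiffAt.mul ?_
    unfold Kt
    refine ContDiffAt.inv ?_ (by positivity)
    exact ((contDiff_norm_sq ℝ).comp (by fun_prop : ContDiff ℝ _ fun y : E 4 => x - t • y)).contDiffAt
  have hloc : ∀ y : E 4, ‖y‖ ≤ 1 → K =ᶠ[nhds y] Kt x t := by
    intro y hy
    have : y ∈ ball (0 : E 4) b.rIn := by simp [hb1]; linarith
    filter_upwards [isOpen_ball.mem_nhds this] with z hz
    rw [hK]; simp only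
    rw [b.one_of_mem_closedBall (ball_subset_closedBall hz), one_mul]
  have g := green_ball K u hKs hu
  have e1 : ∫ y in ball (0 : E 4) 1, (K y * lap 4 u y - u y * lap 4 K y) = ∫ y in ball (0 : E 4) 1, Kt x t y * lap 4 u y := by
    refine setIntegral_congr_fun measurableSet_ball fun y hy => ?_
    have hn : ‖y‖ < 1 := by simpa using hy
    rw [lap_congr (hloc y hn.le), Kt_lap x t y (Kt_ne x hx t ht y (by nlinarith [norm_nonneg y])),
      (hloc y hn.le).eq_of_nhds]
    ring
  rw [← e1, g]
  refine integral_congr_ae ?_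
  filter_upwards [sph_ae] with y hy
  rw [(hloc y hy.le).fderiv_eq, (hloc y hy.le).eq_of_nhds]


lemma geo_a (x y : E 4) (hx : ‖x‖ = 1) (hy : ‖y‖ ≤ 1) (t : ℝ) : 1 - |t| ≤ ‖x - t • y‖ := by
  have := norm_sub_norm_le x (t • y)
  rw [norm_smul, hx, Real.norm_eq_abs] at this
  nlinarith [abs_nonneg t]

lemma geo_b (x y : E 4) (hx : ‖x‖ = 1) (hy : ‖y‖ ≤ 1) (t : ℝ) (ht : 0 ≤ t) (ht1 : t ≤ 1) :
    ‖x - y‖ ≤ 2 * ‖x - t • y‖ := by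
  have h1 := geo_a x y hx hy t
  rw [abs_of_nonneg ht] at h1
  have h2 : x - y = (x - t • y) + (-(1 - t)) • y := by module
  have h3 := norm_add_le (x - t • y) ((-(1 - t)) • y)
  rw [← h2, norm_smul, norm_neg, Real.norm_of_nonneg (by linarith)] at h3
  nlinarith

lemma geo_c (x y : E 4) (hx : ‖x‖ = 1) (hy : ‖y‖ ≤ 1) (t : ℝ) (ht : 0 ≤ t) (ht1 : t ≤ 1) :
    t * ‖x - y‖ ≤ ‖x - t • y‖ := by
  have h1 := norm_sub_sq_real x (t • y)
  have h2 := norm_sub_sq_real x y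
  rw [inner_smul_right, norm_smul, Real.norm_of_nonneg ht] at h1
  have h3 : inner ℝ x y ≤ 1 := by
    have := real_inner_le_norm x y
    rw [hx] at this; linarith
  apply le_of_sq_le_sq _ (norm_nonneg _)
  rw [mul_pow, h1, h2, hx]
  nlinarith [mul_nonneg ht (sub_nonneg.2 ht1)]

lemma Kt_nonneg (x : E 4) (t : ℝ) (y : E 4) : 0 ≤ Kt x t y := by unfold Kt; positivity

lemma Kt_le (x y : E 4) (hx : ‖x‖ = 1) (hy : ‖y‖ ≤ 1) (t : ℝ) (ht1 : |t| < 1) :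
    Kt x t y ≤ ((1 - |t|) ^ 2)⁻¹ := by
  unfold Kt
  have := geo_a x y hx hy t
  have h : 0 < 1 - |t| := by linarith
  gcongr

lemma Kt_ne' (x : E 4) (hx : ‖x‖ = 1) (t : ℝ) (ht : |t| < 1) (y : E 4) (hy : ‖y‖ ≤ 1) : x - t • y ≠ 0 := by
  have := geo_a x y hx hy t
  have h : 0 < ‖x - t • y‖ := by linarith
  exact norm_pos_iff.1 h

lemma Kt_meas (x : E 4) (t : ℝ) : Measurable (Kt x t) := by
  unfold Kt
  exact ((by fun_prop : Continuous fun y : E 4 => ‖x - t • y‖ ^ 2).measurable).inv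

lemma bdd_ball (u : E 4 → ℝ) (hu : Continuous u) : ∃ C, 0 ≤ C ∧ ∀ y : E 4, ‖y‖ ≤ 1 → |u y| ≤ C := by
  obtain ⟨C, hC⟩ := (isCompact_closedBall (0 : E 4) 1).exists_bound_of_continuousOn hu.continuousOn
  refine ⟨max C 0, le_max_right _ _, fun y hy => (hC y (by simpa using hy)).trans (le_max_left _ _)⟩

/-- bounded measurable functions are integrable on the sphere. -/
lemma sph_int_of_bound (g : E 4 → ℝ) (hg : Measurable g) (C : ℝ) (h : ∀ y, ‖y‖ = 1 → |g y| ≤ C) :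
    Integrable g (sphMeasure 4) := by
  refine Integrable.of_bound hg.aestronglyMeasurable C ?_
  filter_upwards [sph_ae] with x hx using h x hx

lemma ball_int_of_bound (g : E 4 → ℝ) (hg : Measurable g) (C : ℝ) (h : ∀ y, ‖y‖ < 1 → |g y| ≤ C) :
    IntegrableOn g (ball (0 : E 4) 1) := by
  have : IsFiniteMeasure ((volume : Measure (E 4)).restrict (ball 0 1)) :=
    ⟨by simp [measure_ball_lt_top]⟩
  refine Integrable.of_bound hg.aestronglyMeasurable C ?_
  filter_upwards [ae_restrict_mem measurableSet_ball] with x hx using h x (by simpa using hx)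

def Vt (u : E 4 → ℝ) (x : E 4) (t : ℝ) : ℝ := ∫ y, u y * Kt x t y ∂(sphMeasure 4)
def Jt (u : E 4 → ℝ) (x : E 4) (t : ℝ) : ℝ := ∫ y in ball (0 : E 4) 1, Kt x t y * lap 4 u y

lemma Kt_bd (x : E 4) (hx : ‖x‖ = 1) (t : ℝ) (y : E 4) (hy : ‖y‖ = 1) (h : x - t • y ≠ 0) :
    fderiv ℝ (Kt x t) y y = (1 - t ^ 2) * Kt x t y ^ 2 - Kt x t y := by
  rw [Kt_fderiv x t y y h]
  unfold Kt
  have h1 := norm_sub_sq_real x (t • y)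
  rw [inner_smul_right, norm_smul, hx, hy, mul_one, Real.norm_eq_abs, sq_abs] at h1
  have hq : ‖x - t • y‖ ^ 2 ≠ 0 := by positivity
  rw [inner_sub_left, inner_smul_left, real_inner_self_eq_norm_sq, hy]
  simp only [conj_trivial]
  have h2 : 2 * t * (inner ℝ x y - t * 1 ^ 2) = 1 - t ^ 2 - ‖x - t • y‖ ^ 2 := by rw [h1]; ring
  set q := ‖x - t • y‖ ^ 2
  field_simp
  linarith

lemma Jt_eq (u : E 4 → ℝ) (hu : ContDiff ℝ (⊤ : ℕ∞) u)
    (hn : ∀ y ∈ sphere (0 : E 4) 1, fderiv ℝ u y y = 0) (x : E 4) (hx : ‖x‖ = 1) (t : ℝ)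
    (ht : 0 ≤ t) (ht1 : t < 1) :
    Jt u x t = Vt u x t - (1 - t ^ 2) * ∫ y, u y * Kt x t y ^ 2 ∂(sphMeasure 4) := by
  have habs : |t| < 1 := by rw [abs_of_nonneg ht]; exact ht1
  obtain ⟨C, hC0, hC⟩ := bdd_ball u hu.continuous
  unfold Jt Vt
  rw [green_K x hx t ht ht1 u hu, ← integral_const_mul, ← integral_sub]
  · refine integral_congr_ae ?_
    filter_upwards [sph_ae] with y hy
    rw [hn y (by simpa using hy), Kt_bd x hx t y hy (Kt_ne' x hx t habs y hy.le)]
    ring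
  · refine sph_int_of_bound _ (hu.continuous.measurable.mul (Kt_meas x t)) (C * ((1 - |t|) ^ 2)⁻¹) fun y hy => ?_
    rw [abs_mul, abs_of_nonneg (Kt_nonneg x t y)]
    exact mul_le_mul (hC y hy.le) (Kt_le x y hx hy.le t habs) (Kt_nonneg x t y) hC0
  · refine Integrable.const_mul ?_ _
    refine sph_int_of_bound _ (hu.continuous.measurable.mul ((Kt_meas x t).pow_const 2)) (C * (((1 - |t|) ^ 2)⁻¹) ^ 2) fun y hy => ?_
    rw [abs_mul, abs_of_nonneg (by positivity : 0 ≤ Kt x t y ^ 2)]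
    exact mul_le_mul (hC y hy.le) (pow_le_pow_left₀ (Kt_nonneg x t y) (Kt_le x y hx hy.le t habs) 2) (by positivity) hC0

lemma Kt_deriv_t (x y : E 4) (hx : ‖x‖ = 1) (hy : ‖y‖ = 1) (t : ℝ) (ht : |t| < 1) :
    HasDerivAt (fun s => Kt x s y) ((2 * inner ℝ x y - 2 * t) * Kt x t y ^ 2) t := by
  have h0 : ∀ s, ‖x - s • y‖ ^ 2 = 1 - 2 * s * inner ℝ x y + s ^ 2 := by
    intro s
    have h1 := norm_sub_sq_real x (s • y)
    rw [inner_smul_right, norm_smul, hx, hy, mul_one, Real.norm_eq_abs, sq_abs] at h1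
    rw [h1]; ring
  have hne := Kt_ne' x hx t ht y hy.le
  have hq : ‖x - t • y‖ ^ 2 ≠ 0 := by positivity
  unfold Kt
  simp only [h0] at hq ⊢
  have h1 : HasDerivAt (fun s : ℝ => 1 - 2 * s * inner ℝ x y + s ^ 2) (-(2 * inner ℝ x y) + 2 * t) t := by
    refine HasDerivAt.congr_deriv (((((hasDerivAt_id' t).const_mul 2).mul_const (inner ℝ x y)).const_sub 1).add (hasDerivAt_pow 2 t)) ?_
    simp
  refine (h1.inv hq).congr_deriv ?_
  field_simp
  ring

lemma Vt_deriv (u : E 4 → ℝ) (hu : ContDiff ℝ (⊤ : ℕ∞) u) (x : E 4) (hx : ‖x‖ = 1) (t : ℝ) (ht : |t| < 1) :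
    HasDerivAt (Vt u x) (∫ y, u y * ((2 * inner ℝ x y - 2 * t) * Kt x t y ^ 2) ∂(sphMeasure 4)) t := by
  obtain ⟨C, hC0, hC⟩ := bdd_ball u hu.continuous
  obtain ⟨s, hs1, hs2⟩ := exists_between ht
  have hintg : ∀ s, |s| < 1 → Integrable (fun y => u y * Kt x s y) (sphMeasure 4) := by
    intro s hs
    refine sph_int_of_bound _ (hu.continuous.measurable.mul (Kt_meas x s)) (C * ((1 - |s|) ^ 2)⁻¹) fun y hy => ?_
    rw [abs_mul, abs_of_nonneg (Kt_nonneg x s y)]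
    exact mul_le_mul (hC y hy.le) (Kt_le x y hx hy.le s hs) (Kt_nonneg x s y) hC0
  have hmem : {r : ℝ | |r| < s} ∈ nhds t := (isOpen_lt continuous_abs continuous_const).mem_nhds hs1
  refine (hasDerivAt_integral_of_dominated_loc_of_deriv_le (F := fun t y => u y * Kt x t y)
    (F' := fun t y => u y * ((2 * inner ℝ x y - 2 * t) * Kt x t y ^ 2))
    (bound := fun _ => C * (4 * (((1 - s) ^ 2)⁻¹) ^ 2)) hmem ?_ (hintg t ht) ?_ ?_ (integrable_const _) ?_).2
  · exact Eventually.of_forall fun s => (hu.continuous.measurable.mul (Kt_meas x s)).aestronglyMeasurable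
  · exact (hu.continuous.measurable.mul (((by fun_prop : Continuous fun y : E 4 => 2 * inner ℝ x y - 2 * t).measurable).mul
      ((Kt_meas x t).pow_const 2))).aestronglyMeasurable
  · filter_upwards [sph_ae] with y hy r hr
    have hr' : |r| < s := hr
    rw [Real.norm_eq_abs, abs_mul, abs_mul, abs_of_nonneg (by positivity : 0 ≤ Kt x r y ^ 2)]
    have hin : |inner ℝ x y| ≤ 1 := by
      have := abs_real_inner_le_norm x y; rw [hx, hy] at this; linarith
    have h4 : |2 * inner ℝ x y - 2 * r| ≤ 4 := by
      rw [abs_le] at hin ⊢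
      have := abs_lt.1 (hr'.trans hs2)
      constructor <;> linarith
    have hK : Kt x r y ≤ ((1 - s) ^ 2)⁻¹ := by
      refine (Kt_le x y hx hy.le r (hr'.trans hs2)).trans ?_
      have : 0 < 1 - s := by linarith
      have : 1 - s ≤ 1 - |r| := by linarith
      gcongr
    have := Kt_nonneg x r y
    have := hC y hy.le
    gcongr
  · filter_upwards [sph_ae] with y hy r hr
    have hr' : |r| < s := hr
    exact (Kt_deriv_t x y hx hy r (hr'.trans hs2)).const_mul (u y)

lemma Vt_deriv' (u : E 4 → ℝ) (hu : ContDiff ℝ (⊤ : ℕ∞) u)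
    (hn : ∀ y ∈ sphere (0 : E 4) 1, fderiv ℝ u y y = 0) (x : E 4) (hx : ‖x‖ = 1) (t : ℝ) (ht : 0 < t) (ht1 : t < 1) :
    HasDerivAt (Vt u x) (- Jt u x t / t) t := by
  have habs : |t| < 1 := by rw [abs_of_nonneg ht.le]; exact ht1
  convert Vt_deriv u hu x hx t habs using 1
  unfold Jt
  rw [green_K x hx t ht.le ht1 u hu, ← integral_neg, ← integral_div]
  refine integral_congr_ae ?_
  filter_upwards [sph_ae] with y hy
  have hne := Kt_ne' x hx t habs y hy.le
  rw [hn y (by simpa using hy), Kt_fderiv x t y y hne, inner_sub_left, inner_smul_left, real_inner_self_eq_norm_sq, hy]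
  unfold Kt
  simp only [conj_trivial]
  field_simp
  ring

lemma Vt_le (u : E 4 → ℝ) (hu : ContDiff ℝ (⊤ : ℕ∞) u)
    (hn : ∀ y ∈ sphere (0 : E 4) 1, fderiv ℝ u y y = 0) (x : E 4) (hx : ‖x‖ = 1) (B : ℝ) 
    (hB : ∀ t, 0 < t → t < 1 → - Jt u x t / t ≤ B / √(1 - t)) (t : ℝ) (ht : 0 ≤ t) (ht1 : t < 1) :
    Vt u x t ≤ Vt u x 0 + 2 * B * (1 - √(1 - t)) := by
  have hg : ∀ s, s < 1 → HasDerivAt (fun s : ℝ => Vt u x s - 2 * B * (1 - √(1 - s)))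
      (deriv (Vt u x) s - B / √(1 - s)) s ∨ ¬ DifferentiableAt ℝ (Vt u x) s := by
    intro s hs
    by_cases hd : DifferentiableAt ℝ (Vt u x) s
    · left
      have h1 : HasDerivAt (fun s : ℝ => 1 - s) (-1) s := by simpa using (hasDerivAt_id s).const_sub 1
      have h2 := ((h1.sqrt (by linarith : (1 - s) ≠ 0)).const_sub 1).const_mul (2 * B)
      refine (hd.hasDerivAt.sub h2).congr_deriv ?_
      have : 0 < √(1 - s) := Real.sqrt_pos.2 (by linarith)
      field_simp
    · exact Or.inr hd
  have hab : ∀ s : ℝ, 0 ≤ s → s < 1 → |s| < 1 := fun s h h' => by rwa [abs_of_nonneg h]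
  have hg' : ∀ s, 0 ≤ s → s < 1 → HasDerivAt (fun s : ℝ => Vt u x s - 2 * B * (1 - √(1 - s)))
      (deriv (Vt u x) s - B / √(1 - s)) s := fun s h h' =>
    (hg s h').resolve_right (not_not.2 (Vt_deriv u hu x hx s (hab s h h')).differentiableAt)
  have hanti : AntitoneOn (fun s : ℝ => Vt u x s - 2 * B * (1 - √(1 - s))) (Set.Icc 0 t) := by
    apply antitoneOn_of_deriv_nonpos (convex_Icc 0 t)
    · intro s hs
      exact (hg' s hs.1 (hs.2.trans_lt ht1)).continuousAt.continuousWithinAt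
    · intro s hs
      rw [interior_Icc] at hs
      exact (hg' s hs.1.le (hs.2.trans ht1)).differentiableAt.differentiableWithinAt
    · intro s hs
      rw [interior_Icc] at hs
      have hs1 := hs.2.trans ht1
      rw [(hg' s hs.1.le hs1).deriv, (Vt_deriv' u hu hn x hx s hs.1 hs1).deriv]
      linarith [hB s hs.1 hs1]
  have := hanti (Set.left_mem_Icc.2 ht) (Set.right_mem_Icc.2 ht) ht
  simp at this
  linarith


lemma Kt_zero (x : E 4) (hx : ‖x‖ = 1) : Kt x 0 = fun _ => 1 := by
  ext y; simp [Kt, hx]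

lemma lap_mean_zero (u : E 4 → ℝ) (hu : ContDiff ℝ (⊤ : ℕ∞) u)
    (hn : ∀ y ∈ sphere (0 : E 4) 1, fderiv ℝ u y y = 0) (x : E 4) (hx : ‖x‖ = 1) :
    ∫ y in ball (0 : E 4) 1, lap 4 u y = 0 := by
  have h := green_K x hx 0 le_rfl one_pos u hu
  rw [Kt_zero x hx] at h
  simp only [one_mul] at h
  rw [h]
  refine integral_eq_zero_of_ae ?_
  filter_upwards [sph_ae] with y hy
  rw [hn y (by simpa using hy)]
  simp

lemma cube_int (x : E 4) (hx : ‖x‖ = 1) :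
    IntegrableOn (fun y => (‖x - y‖ ^ 3)⁻¹) (ball (0 : E 4) 1) ∧
    ∫ y in ball (0 : E 4) 1, (‖x - y‖ ^ 3)⁻¹ ≤ 256 * Real.pi ^ 2 := by
  have hsub : ball (0 : E 4) 1 ⊆ ball x 2 := by
    intro y hy
    rw [mem_ball, dist_zero_right] at hy
    rw [mem_ball, dist_eq_norm]
    have := norm_sub_le y x; linarith
  have h := pot_bound volume (Real.pi ^ 2 / 2) (by positivity) 4 3 (by norm_num) (by norm_num) vol_growth x 2 two_pos
  have h2 : ∫⁻ y in ball (0 : E 4) 1, ENNReal.ofReal ((‖x - y‖ ^ 3)⁻¹) ≤ ENNReal.ofReal (256 * Real.pi ^ 2) := by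
    refine (lintegral_mono_set hsub).trans ?_
    simp_rw [norm_sub_rev x]
    refine h.trans (le_of_eq ?_)
    congr 1; ring
  have hm : Measurable fun y => (‖x - y‖ ^ 3)⁻¹ :=
    ((by fun_prop : Continuous fun y : E 4 => ‖x - y‖ ^ 3).measurable).inv
  have hnn : ∀ y, 0 ≤ (‖x - y‖ ^ 3)⁻¹ := fun y => by positivity
  have hi : IntegrableOn (fun y => (‖x - y‖ ^ 3)⁻¹) (ball (0 : E 4) 1) := by
    refine ⟨hm.aestronglyMeasurable, ?_⟩
    rw [hasFiniteIntegral_iff_ofReal (Eventually.of_forall hnn)]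
    exact h2.trans_lt ENNReal.ofReal_lt_top
  refine ⟨hi, ?_⟩
  rw [integral_eq_lintegral_of_nonneg_ae (Eventually.of_forall hnn) hm.aestronglyMeasurable]
  exact ENNReal.toReal_le_of_le_ofReal (by positivity) h2

lemma Jt_bound (u : E 4 → ℝ) (hu : ContDiff ℝ (⊤ : ℕ∞) u)
    (hn : ∀ y ∈ sphere (0 : E 4) 1, fderiv ℝ u y y = 0) (x : E 4) (hx : ‖x‖ = 1) (t : ℝ) (ht : 0 < t) (ht1 : t < 1) :
    |Jt u x t / t| ≤ (3 / 2 * (2048 * Real.pi ^ 2 + ∫ y in ball (0 : E 4) 1, (lap 4 u y) ^ 2)) / √(1 - t) := by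
  have habs : |t| < 1 := by rw [abs_of_nonneg ht.le]; exact ht1
  have hlc := lap_cont u hu
  obtain ⟨C, hC0, hC⟩ := bdd_ball _ hlc
  obtain ⟨ci, cb⟩ := cube_int x hx
  set s := √(1 - t) with hs
  have hs0 : 0 < s := Real.sqrt_pos.2 (by linarith)
  have hss : s * s = 1 - t := Real.mul_self_sqrt (by linarith)
  have i1 : IntegrableOn (fun y => Kt x t y * lap 4 u y) (ball (0 : E 4) 1) := by
    refine ball_int_of_bound _ ((Kt_meas x t).mul hlc.measurable) (((1 - |t|) ^ 2)⁻¹ * C) fun y hy => ?_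
    rw [abs_mul, abs_of_nonneg (Kt_nonneg x t y)]
    exact mul_le_mul (Kt_le x y hx hy.le t habs) (hC y hy.le) (abs_nonneg _) (by positivity)
  have i2 : IntegrableOn (fun y => lap 4 u y) (ball (0 : E 4) 1) :=
    ball_int_of_bound _ hlc.measurable C fun y hy => hC y hy.le
  have i3 : IntegrableOn (fun y => (lap 4 u y) ^ 2) (ball (0 : E 4) 1) :=
    ball_int_of_bound _ (hlc.measurable.pow_const 2) (C ^ 2) fun y hy => by
      rw [abs_pow]; exact pow_le_pow_left₀ (abs_nonneg _) (hC y hy.le) 2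
  have e : Jt u x t / t = ∫ y in ball (0 : E 4) 1, (Kt x t y - 1) / t * lap 4 u y := by
    have : ∫ y in ball (0 : E 4) 1, (Kt x t y * lap 4 u y - lap 4 u y) = Jt u x t := by
      rw [integral_sub i1 i2, lap_mean_zero u hu hn x hx, sub_zero]; rfl
    rw [← this, ← integral_div]
    congr 1; ext y; ring
  have hpt : ∀ y ∈ ball (0 : E 4) 1, ‖(Kt x t y - 1) / t * lap 4 u y‖ ≤
      (3 / 2) * (8 / s * (‖x - y‖ ^ 3)⁻¹ + (lap 4 u y) ^ 2 / s) := by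
    intro y hy
    have hy1 : ‖y‖ < 1 := by simpa using hy
    have hne := Kt_ne' x hx t habs y hy1.le
    have hq : 0 < ‖x - t • y‖ := by positivity
    have hK : |(Kt x t y - 1) / t| ≤ 3 * Kt x t y := by
      rw [abs_div, abs_of_pos ht, div_le_iff₀ ht]
      have h1 := norm_sub_sq_real x (t • y)
      rw [inner_smul_right, norm_smul, hx, Real.norm_of_nonneg ht.le] at h1
      have hin := abs_real_inner_le_norm x y
      rw [hx, one_mul] at hin
      have h5 : |1 - ‖x - t • y‖ ^ 2| ≤ 3 * t := by
        rw [h1]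
        have h6 := abs_le.1 hin
        have : (t * ‖y‖) ^ 2 ≤ t := by
          have : ‖y‖ ^ 2 ≤ 1 := by nlinarith [norm_nonneg y]
          have : t ^ 2 ≤ t := by nlinarith
          rw [mul_pow]; nlinarith [sq_nonneg t]
        rw [abs_le]; constructor <;> nlinarith [sq_nonneg (t * ‖y‖)]
      unfold Kt
      have : (‖x - t • y‖ ^ 2)⁻¹ - 1 = (1 - ‖x - t • y‖ ^ 2) * (‖x - t • y‖ ^ 2)⁻¹ := by field_simp
      rw [this, abs_mul, abs_of_nonneg (by positivity : 0 ≤ (‖x - t • y‖ ^ 2)⁻¹)]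
      calc _ ≤ 3 * t * (‖x - t • y‖ ^ 2)⁻¹ := by gcongr
        _ = _ := by ring
    have hK2 : Kt x t y ^ 2 ≤ 8 / s ^ 2 * (‖x - y‖ ^ 3)⁻¹ := by
      have ha := geo_a x y hx hy1.le t
      rw [abs_of_nonneg ht.le] at ha
      have hb := geo_b x y hx hy1.le t ht.le ht1.le
      have hxy : 0 < ‖x - y‖ := by
        have := norm_sub_norm_le x y
        rw [hx] at this; linarith
      unfold Kt
      have h8 : ‖x - y‖ ^ 3 ≤ 8 * ‖x - t • y‖ ^ 3 := by
        calc _ ≤ (2 * ‖x - t • y‖) ^ 3 := by gcongr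
          _ = _ := by ring
      rw [show s ^ 2 = 1 - t by rw [sq, hss]]
      have h1t : 0 < 1 - t := by linarith
      rw [inv_pow, ← div_eq_mul_inv, div_div, inv_eq_one_div, div_le_div_iff₀ (by positivity) (by positivity)]
      calc 1 * ((1 - t) * ‖x - y‖ ^ 3) ≤ ‖x - t • y‖ * (8 * ‖x - t • y‖ ^ 3) := by
            rw [one_mul]; gcongr
        _ = _ := by ring
    rw [norm_mul, Real.norm_eq_abs, Real.norm_eq_abs]
    calc _ ≤ 3 * Kt x t y * |lap 4 u y| := by gcongr
      _ ≤ 3 / 2 * (s * Kt x t y ^ 2 + |lap 4 u y| ^ 2 / s) := by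
        have : 0 ≤ (s * Kt x t y - |lap 4 u y|) ^ 2 / s := by positivity
        have h9 : (s * Kt x t y - |lap 4 u y|) ^ 2 / s = s * Kt x t y ^ 2 - 2 * Kt x t y * |lap 4 u y| + |lap 4 u y| ^ 2 / s := by
          field_simp
          ring
        rw [h9] at this; linarith
      _ ≤ 3 / 2 * (s * (8 / s ^ 2 * (‖x - y‖ ^ 3)⁻¹) + |lap 4 u y| ^ 2 / s) := by gcongr
      _ = _ := by rw [sq_abs]; field_simp
  rw [e, ← Real.norm_eq_abs]
  refine (norm_integral_le_integral_norm _).trans ?_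
  have iR : IntegrableOn (fun y => (3 / 2) * (8 / s * (‖x - y‖ ^ 3)⁻¹ + (lap 4 u y) ^ 2 / s)) (ball (0 : E 4) 1) :=
    ((ci.const_mul _).add (i3.div_const _)).const_mul _
  have iL : IntegrableOn (fun y => ‖(Kt x t y - 1) / t * lap 4 u y‖) (ball (0 : E 4) 1) := by
    refine Integrable.norm ?_
    have := (i1.sub i2).div_const t
    refine this.congr (Eventually.of_forall fun y => ?_)
    simp only [Pi.sub_apply]; ring
  refine (setIntegral_mono_on iL iR measurableSet_ball hpt).trans ?_
  rw [integral_const_mul, integral_add (ci.const_mul _) (i3.div_const _), integral_const_mul, integral_div]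
  rw [mul_div_assoc, add_div]
  gcongr
  calc 8 / s * _ ≤ 8 / s * (256 * Real.pi ^ 2) := by gcongr
    _ = _ := by ring

lemma neumann_neg (u : E 4 → ℝ) (hn : ∀ y ∈ sphere (0 : E 4) 1, fderiv ℝ u y y = 0) :
    ∀ y ∈ sphere (0 : E 4) 1, fderiv ℝ (fun y => - u y) y y = 0 := by
  intro y hy
  rw [fderiv_fun_neg]; simp [hn y hy]

lemma lap_neg (u : E 4 → ℝ) (y : E 4) : lap 4 (fun y => - u y) y = - lap 4 u y := by
  unfold lap
  rw [← Finset.sum_neg_distrib]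
  refine Finset.sum_congr rfl fun i _ => ?_
  have : (fun y => fderiv ℝ (fun y => - u y) y (EuclideanSpace.single i 1)) =
      fun y => - fderiv ℝ u y (EuclideanSpace.single i 1) := by
    ext z; rw [fderiv_fun_neg]; rfl
  rw [this, fderiv_fun_neg]; rfl

lemma Vt_neg (u : E 4 → ℝ) (x : E 4) (t : ℝ) : Vt (fun y => - u y) x t = - Vt u x t := by
  unfold Vt; simp [integral_neg]

lemma Jt_neg (u : E 4 → ℝ) (x : E 4) (t : ℝ) : Jt (fun y => - u y) x t = - Jt u x t := by
  unfold Jt; simp [lap_neg, integral_neg]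

lemma Vt_zero (u : E 4 → ℝ) (x : E 4) (hx : ‖x‖ = 1) : Vt u x 0 = ∫ y, u y ∂(sphMeasure 4) := by
  unfold Vt; rw [Kt_zero x hx]; simp

lemma Vt_abs (u : E 4 → ℝ) (hu : ContDiff ℝ (⊤ : ℕ∞) u)
    (hn : ∀ y ∈ sphere (0 : E 4) 1, fderiv ℝ u y y = 0) (x : E 4) (hx : ‖x‖ = 1) (B : ℝ) 
    (hB : ∀ t, 0 < t → t < 1 → |Jt u x t / t| ≤ B / √(1 - t)) (t : ℝ) (ht : 0 ≤ t) (ht1 : t < 1) :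
    |Vt u x t - Vt u x 0| ≤ 2 * B := by
  have h1 := Vt_le u hu hn x hx B (fun t h h' => by
    rw [neg_div]; exact (neg_le_abs _).trans (hB t h h')) t ht ht1
  have h2 := Vt_le (fun y => - u y) hu.neg (neumann_neg u hn) x hx B (fun t h h' => by
    rw [Jt_neg, neg_neg]; exact (le_abs_self _).trans (hB t h h')) t ht ht1
  rw [Vt_neg, Vt_neg] at h2
  have hB0 : 0 ≤ B := by
    have := (abs_nonneg _).trans (hB (1/2) (by norm_num) (by norm_num))
    by_contra h
    have h3 : 0 < √(1 - 1 / 2) := Real.sqrt_pos.2 (by norm_num)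
    have := div_neg_of_neg_of_pos (not_le.1 h) h3
    linarith
  have h4 := Real.sqrt_nonneg (1 - t)
  rw [abs_le]; constructor <;> nlinarith

lemma mass_one (x : E 4) (hx : ‖x‖ = 1) (t : ℝ) (ht : 0 ≤ t) (ht1 : t < 1) :
    (1 - t ^ 2) * ∫ y, Kt x t y ^ 2 ∂(sphMeasure 4) = 2 * Real.pi ^ 2 := by
  have hn : ∀ y ∈ sphere (0 : E 4) 1, fderiv ℝ (fun _ : E 4 => (1:ℝ)) y y = 0 := by
    intro y _; simp
  have hl : ∀ y, lap 4 (fun _ : E 4 => (1:ℝ)) y = 0 := by intro y; simp [lap]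
  have hJ : ∀ t, Jt (fun _ => 1) x t = 0 := by intro t; simp [Jt, hl]
  have h := Vt_abs (fun _ => 1) contDiff_const hn x hx 0 (fun t _ _ => by simp [hJ]) t ht ht1
  have h2 := Jt_eq (fun _ => 1) contDiff_const hn x hx t ht ht1
  rw [hJ] at h2
  rw [Vt_zero _ x hx] at h
  simp only [mul_zero, abs_nonpos_iff, integral_const, smul_eq_mul, mul_one, sph_mass, one_mul] at h h2
  linarith


lemma sph_sq_int (x : E 4) (hx : ‖x‖ = 1) : Integrable (fun y => (‖x - y‖ ^ 2)⁻¹) (sphMeasure 4) := by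
  have h := pot_bound (sphMeasure 4) (32 * Real.pi ^ 2) (by positivity) 3 2 (by norm_num) (by norm_num) sph_growth x 3 (by norm_num)
  have hm : Measurable fun y => (‖x - y‖ ^ 2)⁻¹ :=
    ((by fun_prop : Continuous fun y : E 4 => ‖x - y‖ ^ 2).measurable).inv
  have hnn : ∀ y, 0 ≤ (‖x - y‖ ^ 2)⁻¹ := fun y => by positivity
  refine ⟨hm.aestronglyMeasurable, ?_⟩
  rw [hasFiniteIntegral_iff_ofReal (Eventually.of_forall hnn)]
  have hr : (sphMeasure 4).restrict (ball x 3) = sphMeasure 4 := by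
    refine Measure.restrict_eq_self_of_ae_mem ?_
    filter_upwards [sph_ae] with y hy
    rw [mem_ball, dist_eq_norm]
    have := norm_sub_le y x; linarith
  rw [hr] at h
  simp_rw [norm_sub_rev x]
  exact h.trans_lt ENNReal.ofReal_lt_top

lemma sph_null (x : E 4) : ∀ᵐ y ∂(sphMeasure 4), y ≠ x := by
  have h0 : sphMeasure 4 {x} = 0 := by
    have h1 : ∀ r : ℝ, 0 < r → sphMeasure 4 {x} ≤ ENNReal.ofReal (32 * Real.pi ^ 2 * r ^ 3) := fun r hr =>
      (measure_mono (by simpa using hr)).trans (sph_growth x r hr)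
    have h2 : Tendsto (fun r : ℝ => ENNReal.ofReal (32 * Real.pi ^ 2 * r ^ 3)) (nhdsWithin 0 (Set.Ioi 0)) (nhds 0) := by
      have : Continuous fun r : ℝ => ENNReal.ofReal (32 * Real.pi ^ 2 * r ^ 3) :=
        ENNReal.continuous_ofReal.comp (by fun_prop)
      have := (this.tendsto 0).mono_left (nhdsWithin_le_nhds (s := Set.Ioi 0))
      simpa using this
    refine le_antisymm (ge_of_tendsto h2 ?_) bot_le
    filter_upwards [self_mem_nhdsWithin] with r hr using h1 r hr
  exact (measure_eq_zero_iff_ae_notMem.1 h0).mono fun y hy => by simpa using hy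

lemma approx_id (u : E 4 → ℝ) (hu : ContDiff ℝ (⊤ : ℕ∞) u) (x : E 4) (hx : ‖x‖ = 1) :
    Tendsto (fun t : ℝ => ∫ y, (1 - t ^ 2) * ((u y - u x) * Kt x t y ^ 2) ∂(sphMeasure 4))
      (nhdsWithin 1 (Set.Iio 1)) (nhds 0) := by
  have hfc : Continuous (fderiv ℝ u) := hu.continuous_fderiv (by simp)
  obtain ⟨L, hL⟩ := (isCompact_closedBall (0 : E 4) 1).exists_bound_of_continuousOn hfc.continuousOn
  have hLip : ∀ y : E 4, ‖y‖ = 1 → |u y - u x| ≤ L * ‖y - x‖ := by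
    intro y hy
    exact (convex_closedBall (0 : E 4) 1).norm_image_sub_le_of_norm_fderiv_le
      (fun z _ => (hu.differentiable (by simp)) z) hL (by simp [hx]) (by simp [hy])
  have hL0 : 0 ≤ L := (norm_nonneg _).trans (hL 0 (by simp))
  have h0 : (0 : ℝ) = ∫ _ : E 4, (0 : ℝ) ∂(sphMeasure 4) := by simp
  rw [h0]
  refine tendsto_integral_filter_of_dominated_convergence (fun y => 16 * L * (‖x - y‖ ^ 2)⁻¹) ?_ ?_ ((sph_sq_int x hx).const_mul _) ?_
  · refine Eventually.of_forall fun t => Measurable.aestronglyMeasurable ?_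
    exact measurable_const.mul ((hu.continuous.measurable.sub measurable_const).mul ((Kt_meas x t).pow_const 2))
  · have hev : ∀ᶠ t in nhdsWithin (1:ℝ) (Set.Iio 1), 0 < t :=
      mem_nhdsWithin_of_mem_nhds (lt_mem_nhds one_pos)
    filter_upwards [hev, self_mem_nhdsWithin] with t ht0 ht1'
    have ht1 : t < 1 := ht1'
    filter_upwards [sph_ae, sph_null x] with y hy hyx
    have ha := geo_a x y hx hy.le t
    rw [abs_of_nonneg ht0.le] at ha
    have hb := geo_b x y hx hy.le t ht0.le ht1.le
    have hxy : 0 < ‖x - y‖ := norm_pos_iff.2 (sub_ne_zero.2 hyx.symm)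
    have hq : 0 < ‖x - t • y‖ := by linarith
    have h1t : 0 < 1 - t := by linarith
    have ht2 : 0 ≤ 1 - t ^ 2 := by nlinarith
    rw [Real.norm_eq_abs, abs_mul, abs_mul, abs_of_nonneg ht2, abs_of_nonneg (by positivity : 0 ≤ Kt x t y ^ 2)]
    have hl := hLip y hy
    rw [norm_sub_rev] at hl
    calc _ ≤ (2 * ‖x - t • y‖) * (L * ‖x - y‖ * Kt x t y ^ 2) := by
            gcongr; nlinarith
      _ ≤ _ := by
        unfold Kt
        have h8 : ‖x - y‖ ^ 3 ≤ 8 * ‖x - t • y‖ ^ 3 := by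
          calc _ ≤ (2 * ‖x - t • y‖) ^ 3 := by gcongr
            _ = _ := by ring
        have e1 : 2 * ‖x - t • y‖ * (L * ‖x - y‖ * ((‖x - t • y‖ ^ 2)⁻¹) ^ 2) = 2 * L * ‖x - y‖ / ‖x - t • y‖ ^ 3 := by
          field_simp
        rw [e1, ← div_eq_mul_inv, div_le_div_iff₀ (by positivity) (by positivity)]
        calc 2 * L * ‖x - y‖ * ‖x - y‖ ^ 2 = 2 * L * ‖x - y‖ ^ 3 := by ring
          _ ≤ 2 * L * (8 * ‖x - t • y‖ ^ 3) := by gcongr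
          _ = _ := by ring
  · filter_upwards [sph_null x] with y hyx
    have hxy : 0 < ‖x - y‖ := norm_pos_iff.2 (sub_ne_zero.2 hyx.symm)
    have hc : ContinuousAt (fun t : ℝ => (1 - t ^ 2) * ((u y - u x) * Kt x t y ^ 2)) 1 := by
      unfold Kt
      have : ContinuousAt (fun t : ℝ => (‖x - t • y‖ ^ 2)⁻¹) 1 := by
        refine ContinuousAt.inv₀ (by fun_prop) ?_
        simp only [one_smul]; positivity
      fun_prop
    have := hc.tendsto.mono_left (nhdsWithin_le_nhds (s := Set.Iio 1))
    simpa using this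

lemma rep_real (u : E 4 → ℝ) (hu : ContDiff ℝ (⊤ : ℕ∞) u)
    (hn : ∀ y ∈ sphere (0 : E 4) 1, fderiv ℝ u y y = 0) (hm : ∫ y, u y ∂(sphMeasure 4) = 0)
    (x : E 4) (hx : ‖x‖ = 1) :
    IntegrableOn (fun y => (‖x - y‖ ^ 2)⁻¹ * |lap 4 u y|) (ball (0 : E 4) 1) ∧
    2 * Real.pi ^ 2 * |u x| ≤ (∫ y in ball (0 : E 4) 1, (‖x - y‖ ^ 2)⁻¹ * |lap 4 u y|) +
      3 * (2048 * Real.pi ^ 2 + ∫ y in ball (0 : E 4) 1, (lap 4 u y) ^ 2) := by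
  have hlc := lap_cont u hu
  obtain ⟨C, hC0, hC⟩ := bdd_ball _ hlc
  obtain ⟨Cu, hCu0, hCu⟩ := bdd_ball _ hu.continuous
  obtain ⟨ci, -⟩ := cube_int x hx
  have hme : Measurable fun y => (‖x - y‖ ^ 2)⁻¹ * |lap 4 u y| :=
    ((by fun_prop : Continuous fun y : E 4 => ‖x - y‖ ^ 2).measurable).inv.mul hlc.abs.measurable
  have hI : IntegrableOn (fun y => (‖x - y‖ ^ 2)⁻¹ * |lap 4 u y|) (ball (0 : E 4) 1) := by
    refine Integrable.mono' (ci.const_mul (2 * C)) hme.aestronglyMeasurable ?_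
    filter_upwards [ae_restrict_mem measurableSet_ball] with y hy
    have hy1 : ‖y‖ < 1 := by simpa using hy
    rw [Real.norm_eq_abs, abs_mul, abs_abs, abs_of_nonneg (by positivity : 0 ≤ (‖x - y‖ ^ 2)⁻¹)]
    have hxy : 0 < ‖x - y‖ := by
      have := norm_sub_norm_le x y
      rw [hx] at this; linarith
    have hxy2 : ‖x - y‖ ≤ 2 := by
      have := norm_sub_le x y; linarith
    have h2 : (‖x - y‖ ^ 2)⁻¹ ≤ 2 * (‖x - y‖ ^ 3)⁻¹ := by
      rw [← div_eq_mul_inv, inv_eq_one_div, div_le_div_iff₀ (by positivity) (by positivity)]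
      nlinarith [sq_nonneg ‖x - y‖]
    calc _ ≤ (2 * (‖x - y‖ ^ 3)⁻¹) * C := mul_le_mul h2 (hC y hy1.le) (abs_nonneg _) (by positivity)
      _ = _ := by ring
  refine ⟨hI, ?_⟩
  set I := ∫ y in ball (0 : E 4) 1, (‖x - y‖ ^ 2)⁻¹ * |lap 4 u y| with hIdef
  set D := ∫ y in ball (0 : E 4) 1, (lap 4 u y) ^ 2 with hD
  have key : ∀ t : ℝ, 0 < t → t < 1 → 2 * Real.pi ^ 2 * |u x| ≤
      |∫ y, (1 - t ^ 2) * ((u y - u x) * Kt x t y ^ 2) ∂(sphMeasure 4)| + 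
      (3 * (2048 * Real.pi ^ 2 + D) + (t ^ 2)⁻¹ * I) := by
    intro t ht ht1
    have habs : |t| < 1 := by rw [abs_of_nonneg ht.le]; exact ht1
    have hV := Vt_abs u hu hn x hx _ (fun t h h' => Jt_bound u hu hn x hx t h h') t ht.le ht1
    rw [Vt_zero u x hx, hm, sub_zero, ← hD] at hV
    have hJ : |Jt u x t| ≤ (t ^ 2)⁻¹ * I := by
      unfold Jt
      rw [hIdef, ← integral_const_mul, ← Real.norm_eq_abs]
      refine norm_integral_le_of_norm_le (hI.const_mul _) ?_
      filter_upwards [ae_restrict_mem measurableSet_ball] with y hy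
      have hy1 : ‖y‖ < 1 := by simpa using hy
      have hxy : 0 < ‖x - y‖ := by
        have := norm_sub_norm_le x y
        rw [hx] at this; linarith
      rw [norm_mul, Real.norm_of_nonneg (Kt_nonneg x t y), Real.norm_eq_abs, ← mul_assoc]
      refine mul_le_mul_of_nonneg_right ?_ (abs_nonneg _)
      unfold Kt
      rw [← mul_inv, ← mul_pow]
      have := geo_c x y hx hy1.le t ht.le ht1.le
      gcongr
    have hE := Jt_eq u hu hn x hx t ht.le ht1
    have i1 : Integrable (fun y => u y * Kt x t y ^ 2) (sphMeasure 4) := by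
      refine sph_int_of_bound _ (hu.continuous.measurable.mul ((Kt_meas x t).pow_const 2)) (Cu * (((1 - |t|) ^ 2)⁻¹) ^ 2) fun y hy => ?_
      rw [abs_mul, abs_of_nonneg (by positivity : 0 ≤ Kt x t y ^ 2)]
      exact mul_le_mul (hCu y hy.le) (pow_le_pow_left₀ (Kt_nonneg x t y) (Kt_le x y hx hy.le t habs) 2) (by positivity) hCu0
    have i2 : Integrable (fun y => Kt x t y ^ 2) (sphMeasure 4) := by
      refine sph_int_of_bound _ ((Kt_meas x t).pow_const 2) ((((1 - |t|) ^ 2)⁻¹) ^ 2) fun y hy => ?_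
      rw [abs_of_nonneg (by positivity : 0 ≤ Kt x t y ^ 2)]
      exact (pow_le_pow_left₀ (Kt_nonneg x t y) (Kt_le x y hx hy.le t habs) 2)
    have hS : ∫ y, (1 - t ^ 2) * ((u y - u x) * Kt x t y ^ 2) ∂(sphMeasure 4) =
        (1 - t ^ 2) * (∫ y, u y * Kt x t y ^ 2 ∂(sphMeasure 4)) - u x * (2 * Real.pi ^ 2) := by
      rw [← mass_one x hx t ht.le ht1, integral_const_mul]
      simp_rw [sub_mul]
      rw [integral_sub i1 (i2.const_mul _), integral_const_mul]
      ring
    have h2 : 2 * Real.pi ^ 2 * |u x| = |u x * (2 * Real.pi ^ 2)| := by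
      rw [abs_mul, abs_of_pos (by positivity : 0 < 2 * Real.pi ^ 2)]; ring
    have h3 : u x * (2 * Real.pi ^ 2) = - (∫ y, (1 - t ^ 2) * ((u y - u x) * Kt x t y ^ 2) ∂(sphMeasure 4)) + (Vt u x t - Jt u x t) := by
      rw [hS, hE]; ring
    rw [h2, h3]
    refine (abs_add_le _ _).trans ?_
    rw [abs_neg]
    have := abs_sub (Vt u x t) (Jt u x t)
    linarith
  have hT : Tendsto (fun t : ℝ => |∫ y, (1 - t ^ 2) * ((u y - u x) * Kt x t y ^ 2) ∂(sphMeasure 4)| + 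
      (3 * (2048 * Real.pi ^ 2 + D) + (t ^ 2)⁻¹ * I)) (nhdsWithin 1 (Set.Iio 1))
      (nhds (|0| + (3 * (2048 * Real.pi ^ 2 + D) + ((1:ℝ) ^ 2)⁻¹ * I))) := by
    refine (approx_id u hu x hx).abs.add ?_
    have : ContinuousAt (fun t : ℝ => 3 * (2048 * Real.pi ^ 2 + D) + (t ^ 2)⁻¹ * I) 1 := by
      have : ContinuousAt (fun t : ℝ => (t ^ 2)⁻¹) 1 := ContinuousAt.inv₀ (by fun_prop) (by norm_num)
      fun_prop
    exact this.tendsto.mono_left nhdsWithin_le_nhds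
  have := ge_of_tendsto hT (b := 2 * Real.pi ^ 2 * |u x|) (by
    have hev : ∀ᶠ t in nhdsWithin (1:ℝ) (Set.Iio 1), 0 < t :=
      mem_nhdsWithin_of_mem_nhds (lt_mem_nhds one_pos)
    filter_upwards [hev, self_mem_nhdsWithin] with t h h' using key t h h')
  simp only [abs_zero, zero_add, one_pow, inv_one, one_mul] at this
  linarith


def Gk (p : ℕ) (r : ℝ) (z : E 4 × E 4) : ℝ≥0∞ :=
  {z : E 4 × E 4 | ‖z.1 - z.2‖ < r}.indicator (fun z => ENNReal.ofReal ((‖z.1 - z.2‖ ^ p)⁻¹)) z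

lemma Gk_meas (p : ℕ) (r : ℝ) : Measurable (Gk p r) := by
  unfold Gk
  refine Measurable.indicator ?_ (isOpen_lt (by fun_prop) continuous_const).measurableSet
  exact ENNReal.measurable_ofReal.comp ((by fun_prop : Continuous fun z : E 4 × E 4 => ‖z.1 - z.2‖ ^ p).measurable.inv)

lemma Gk_sq (r : ℝ) (z : E 4 × E 4) : Gk 1 r z ^ 2 = Gk 2 r z := by
  unfold Gk
  by_cases h : z ∈ {z : E 4 × E 4 | ‖z.1 - z.2‖ < r}
  · rw [Set.indicator_of_mem h, Set.indicator_of_mem h, ← ENNReal.ofReal_pow (by positivity)]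
    congr 1; rw [pow_one, inv_pow]
  · rw [Set.indicator_of_notMem h, Set.indicator_of_notMem h]; simp

lemma Gk_symm (p : ℕ) (r : ℝ) (x y : E 4) : Gk p r (x, y) = Gk p r (y, x) := by
  unfold Gk
  simp only [Set.indicator, Set.mem_ofPred_eq, norm_sub_rev x y]

lemma Gk_int (μ : Measure (E 4)) (p : ℕ) (r : ℝ) (y : E 4) :
    ∫⁻ x, Gk p r (x, y) ∂μ = ∫⁻ x in ball y r, ENNReal.ofReal ((‖x - y‖ ^ p)⁻¹) ∂μ := by
  rw [← lintegral_indicator measurableSet_ball]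
  refine lintegral_congr fun x => ?_
  unfold Gk
  simp only [Set.indicator, Set.mem_ofPred_eq, mem_ball, dist_eq_norm]

lemma near_sq (W : E 4 → ℝ≥0∞) (hW : Measurable W) (r : ℝ) (hr : 0 < r) :
    ∫⁻ x, (∫⁻ y in ball (0 : E 4) 1, Gk 2 r (x, y) * W y) ^ 2 ∂(sphMeasure 4) ≤
      ENNReal.ofReal (131072 * Real.pi ^ 4 * r ^ 3) * ∫⁻ y in ball (0 : E 4) 1, W y ^ 2 := by
  have hG := Gk_meas 2 r
  have h1 : ∀ x, (∫⁻ y in ball (0 : E 4) 1, Gk 2 r (x, y) * W y) ^ 2 ≤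
      ENNReal.ofReal (64 * Real.pi ^ 2 * r ^ 2) * ∫⁻ y in ball (0 : E 4) 1, Gk 2 r (x, y) * W y ^ 2 := by
    intro x
    have hm : Measurable fun y => Gk 1 r (x, y) := (Gk_meas 1 r).comp (by fun_prop)
    have := cs_lint (volume.restrict (ball (0 : E 4) 1)) (fun y => Gk 1 r (x, y)) (fun y => Gk 1 r (x, y) * W y)
      hm.aemeasurable (hm.mul hW).aemeasurable
    simp only [← mul_assoc, ← sq, mul_pow, Gk_sq] at this
    refine this.trans ?_
    gcongr
    refine (setLIntegral_le_lintegral _ _).trans ?_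
    simp_rw [Gk_symm 2 r x]
    rw [Gk_int]
    refine (pot_bound volume (Real.pi ^ 2 / 2) (by positivity) 4 2 (by norm_num) (by norm_num) vol_growth x r hr).trans (le_of_eq ?_)
    congr 1; ring
  have h2 : ∫⁻ x, (∫⁻ y in ball (0 : E 4) 1, Gk 2 r (x, y) * W y ^ 2) ∂(sphMeasure 4) ≤
      ENNReal.ofReal (2048 * Real.pi ^ 2 * r) * ∫⁻ y in ball (0 : E 4) 1, W y ^ 2 := by
    rw [lintegral_lintegral_swap]
    · rw [← lintegral_const_mul _ (hW.pow_const 2)]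
      refine lintegral_mono fun y => ?_
      simp only
      have hmm : Measurable fun x => Gk 2 r (x, y) := hG.comp (by fun_prop)
      rw [lintegral_mul_const _ hmm, Gk_int]
      gcongr
      refine (pot_bound (sphMeasure 4) (32 * Real.pi ^ 2) (by positivity) 3 2 (by norm_num) (by norm_num) sph_growth y r hr).trans (le_of_eq ?_)
      congr 1; ring
    · exact (hG.mul ((hW.pow_const 2).comp measurable_snd)).aemeasurable
  have hm2 : Measurable fun x => ∫⁻ y in ball (0 : E 4) 1, Gk 2 r (x, y) * W y ^ 2 :=
    Measurable.lintegral_prod_right' (hG.mul ((hW.pow_const 2).comp measurable_snd))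
  calc _ ≤ ∫⁻ x, ENNReal.ofReal (64 * Real.pi ^ 2 * r ^ 2) * (∫⁻ y in ball (0 : E 4) 1, Gk 2 r (x, y) * W y ^ 2) ∂(sphMeasure 4) :=
        lintegral_mono h1
    _ = ENNReal.ofReal (64 * Real.pi ^ 2 * r ^ 2) * ∫⁻ x, ∫⁻ y in ball (0 : E 4) 1, Gk 2 r (x, y) * W y ^ 2 ∂volume ∂(sphMeasure 4) :=
        lintegral_const_mul _ hm2
    _ ≤ ENNReal.ofReal (64 * Real.pi ^ 2 * r ^ 2) * (ENNReal.ofReal (2048 * Real.pi ^ 2 * r) * ∫⁻ y in ball (0 : E 4) 1, W y ^ 2) := by gcongr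
    _ = ENNReal.ofReal (131072 * Real.pi ^ 4 * r ^ 3) * ∫⁻ y in ball (0 : E 4) 1, W y ^ 2 := by
      rw [← mul_assoc, ← ENNReal.ofReal_mul (by positivity)]
      congr 2; ring

lemma split_int (W : E 4 → ℝ≥0∞) (hW : Measurable W) (x x0 : E 4) (hx : ‖x‖ = 1) (ρ : ℝ) (hρ : 0 < ρ)
    (hxx : x ∈ ball x0 ρ) (r : ℝ) (hr : 0 < r) (hr2 : r ≤ 2) (A : ℝ) (hA : 0 ≤ A)
    (hWA : ∫⁻ y in ball (0 : E 4) 1 ∩ ball x0 (2 * ρ), W y ^ 2 ≤ ENNReal.ofReal A)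
    (hW2 : ∫⁻ y in ball (0 : E 4) 1, W y ^ 2 ≤ 2) :
    ∫⁻ y in ball (0 : E 4) 1, ENNReal.ofReal ((‖x - y‖ ^ 2)⁻¹) * W y ≤
      (∫⁻ y in ball (0 : E 4) 1, Gk 2 r (x, y) * W y) + ENNReal.ofReal √(Real.pi ^ 2 * Real.log (2 / r) * A) +
      ENNReal.ofReal ((ρ ^ 2)⁻¹ * (Real.pi ^ 2 / 2 + 2)) := by
  have hkm : ∀ p : ℕ, Measurable fun y => ENNReal.ofReal ((‖x - y‖ ^ p)⁻¹) := fun p =>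
    ENNReal.measurable_ofReal.comp ((by fun_prop : Continuous fun y : E 4 => ‖x - y‖ ^ p).measurable.inv)
  set k : E 4 → ℝ≥0∞ := fun y => ENNReal.ofReal ((‖x - y‖ ^ 2)⁻¹) with hk
  set f2 : E 4 → ℝ≥0∞ := (ball x0 (2 * ρ) ∩ (ball x r)ᶜ).indicator (fun y => k y * W y) with hf2
  have hS2 : MeasurableSet (ball x0 (2 * ρ) ∩ (ball x r)ᶜ) := measurableSet_ball.inter measurableSet_ball.compl
  have hkW : Measurable fun y => k y * W y := (hkm 2).mul hW
  have hpt : ∀ y, k y * W y ≤ Gk 2 r (x, y) * W y + f2 y + ENNReal.ofReal ((ρ ^ 2)⁻¹) * (1 + W y ^ 2) := by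
    intro y
    by_cases h1 : ‖x - y‖ < r
    · have : Gk 2 r (x, y) = k y := by unfold Gk; rw [Set.indicator_of_mem (by simpa using h1)]
      rw [this, add_assoc]; exact le_self_add
    by_cases h2 : y ∈ ball x0 (2 * ρ)
    · have h3 : y ∈ ball x0 (2 * ρ) ∩ (ball x r)ᶜ := by
        refine ⟨h2, ?_⟩
        simp only [Set.mem_compl_iff, mem_ball, dist_eq_norm]
        rwa [norm_sub_rev]
      have : f2 y = k y * W y := by rw [hf2, Set.indicator_of_mem h3]
      rw [this, add_right_comm]; exact le_add_self
    · refine le_trans ?_ le_add_self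
      have h4 : ρ ≤ ‖x - y‖ := by
        rw [mem_ball, not_lt] at h2
        rw [mem_ball] at hxx
        rw [← dist_eq_norm]
        have := dist_triangle y x x0
        rw [dist_comm y x] at this; linarith
      have h5 : k y ≤ ENNReal.ofReal ((ρ ^ 2)⁻¹) := by
        rw [hk]; apply ENNReal.ofReal_le_ofReal; gcongr
      refine mul_le_mul' h5 ?_
      rcases le_total (W y) 1 with h | h
      · exact h.trans le_self_add
      · refine le_trans ?_ le_add_self
        rw [sq]; exact le_mul_of_one_le_left' h
  have hfar : (∫⁻ y in ball (0 : E 4) 1, f2 y) ≤ ENNReal.ofReal √(Real.pi ^ 2 * Real.log (2 / r) * A) := by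
    have hl : 0 ≤ Real.log (2 / r) := Real.log_nonneg (by rw [le_div_iff₀ hr]; linarith)
    have e : ∫⁻ y in ball (0 : E 4) 1, f2 y = ∫⁻ y in ball (0 : E 4) 1 ∩ (ball x0 (2 * ρ) ∩ (ball x r)ᶜ), k y * W y := by
      rw [hf2, setLIntegral_indicator hS2, Set.inter_comm]
    have h := cs_lint (volume.restrict (ball (0 : E 4) 1 ∩ (ball x0 (2 * ρ) ∩ (ball x r)ᶜ))) k W (hkm 2).aemeasurable hW.aemeasurable
    rw [← e] at h
    have h1 : ∫⁻ y in ball (0 : E 4) 1 ∩ (ball x0 (2 * ρ) ∩ (ball x r)ᶜ), k y ^ 2 ≤ ENNReal.ofReal (Real.pi ^ 2 * Real.log (2 / r)) := by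
      refine le_trans ?_ (half_log x hx r hr hr2)
      refine (lintegral_mono_set (Set.inter_subset_inter_right _ Set.inter_subset_right)).trans (le_of_eq ?_)
      refine lintegral_congr fun y => ?_
      rw [hk]; simp only
      rw [← ENNReal.ofReal_pow (by positivity)]
      congr 1; rw [inv_pow, ← pow_mul]
    have h2 : ∫⁻ y in ball (0 : E 4) 1 ∩ (ball x0 (2 * ρ) ∩ (ball x r)ᶜ), W y ^ 2 ≤ ENNReal.ofReal A :=
      (lintegral_mono_set (Set.inter_subset_inter_right _ Set.inter_subset_left)).trans hWA
    have h3 := h.trans (mul_le_mul' h1 h2)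
    rw [← ENNReal.ofReal_mul (by positivity)] at h3
    rw [← ENNReal.pow_le_pow_left_iff two_ne_zero, ← ENNReal.ofReal_pow (Real.sqrt_nonneg _), Real.sq_sqrt (by positivity)]
    exact h3
  have hrest : ∫⁻ y in ball (0 : E 4) 1, ENNReal.ofReal ((ρ ^ 2)⁻¹) * (1 + W y ^ 2) ≤ ENNReal.ofReal ((ρ ^ 2)⁻¹ * (Real.pi ^ 2 / 2 + 2)) := by
    rw [lintegral_const_mul _ ((hW.pow_const 2).const_add 1), lintegral_add_left measurable_const, ENNReal.ofReal_mul (by positivity)]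
    gcongr
    rw [ENNReal.ofReal_add (by positivity) (by norm_num)]
    have := vol_growth 0 1 one_pos
    simp only [lintegral_const, one_mul, Measure.restrict_apply MeasurableSet.univ, Set.univ_inter]
    refine add_le_add ?_ (by simpa using hW2)
    simpa using this
  have hGm : Measurable fun y => Gk 2 r (x, y) * W y := ((Gk_meas 2 r).comp (by fun_prop)).mul hW
  refine (lintegral_mono hpt).trans ?_
  have hGf : Measurable fun y => Gk 2 r (x, y) * W y + f2 y := hGm.add (hkW.indicator hS2)
  rw [lintegral_add_left hGf, lintegral_add_left hGm]
  gcongr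

/-- the exponential level set estimate. -/
lemma level_est (ρ : ℝ) (hρ : 0 < ρ) (A : ℝ) (hA : 0 < A) : ∃ C : ℝ, 0 ≤ C ∧ ∃ C2 : ℝ, 0 ≤ C2 ∧
    ∀ (u : E 4 → ℝ), ContDiff ℝ (⊤ : ℕ∞) u → (∀ y ∈ sphere (0 : E 4) 1, fderiv ℝ u y y = 0) →
      ∫ y, u y ∂(sphMeasure 4) = 0 → ∫ y in ball (0 : E 4) 1, (lap 4 u y) ^ 2 ≤ 2 →
      ∀ x0 : E 4, ∫ y in ball (0 : E 4) 1 ∩ ball x0 (2 * ρ), (lap 4 u y) ^ 2 ≤ A →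
      ∀ t : ℝ, 0 ≤ t → sphMeasure 4 {x | x ∈ ball x0 ρ ∧ t + C < u x} ≤
        ENNReal.ofReal (C2 * Real.exp (-(12 * Real.pi ^ 2 * t ^ 2 / A))) := by
  set c0 := (ρ ^ 2)⁻¹ * (Real.pi ^ 2 / 2 + 2) + 3 * (2048 * Real.pi ^ 2 + 2) + 1 with hc0
  have hpi := Real.pi_pos
  refine ⟨c0 / (2 * Real.pi ^ 2), by positivity, 131072 * Real.pi ^ 4 * 8 * 2, by positivity, ?_⟩
  intro u hu hn hm hD x0 hAi t ht
  have hlc := lap_cont u hu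
  have hi2 : IntegrableOn (fun y => (lap 4 u y) ^ 2) (ball (0 : E 4) 1) :=
    ((hlc.pow 2).continuousOn.integrableOn_compact (isCompact_closedBall 0 1)).mono_set ball_subset_closedBall
  set W : E 4 → ℝ≥0∞ := fun y => ENNReal.ofReal |lap 4 u y| with hWd
  have hW : Measurable W := ENNReal.measurable_ofReal.comp hlc.abs.measurable
  have hWsq : ∀ y, W y ^ 2 = ENNReal.ofReal ((lap 4 u y) ^ 2) := by
    intro y; rw [hWd]; simp only
    rw [← ENNReal.ofReal_pow (abs_nonneg _), sq_abs]
  have hWA : ∫⁻ y in ball (0 : E 4) 1 ∩ ball x0 (2 * ρ), W y ^ 2 ≤ ENNReal.ofReal A := by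
    simp_rw [hWsq]
    rw [← ofReal_integral_eq_lintegral_ofReal (hi2.mono_set Set.inter_subset_left) (Eventually.of_forall fun y => sq_nonneg _)]
    exact ENNReal.ofReal_le_ofReal hAi
  have hW2 : ∫⁻ y in ball (0 : E 4) 1, W y ^ 2 ≤ 2 := by
    simp_rw [hWsq]
    rw [← ofReal_integral_eq_lintegral_ofReal hi2 (Eventually.of_forall fun y => sq_nonneg _)]
    exact (ENNReal.ofReal_le_ofReal hD).trans (by simp)
  set r := 2 * Real.exp (-(4 * Real.pi ^ 2 * t ^ 2 / A)) with hr
  have hr0 : 0 < r := by positivity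
  have hr2 : r ≤ 2 := by
    have : Real.exp (-(4 * Real.pi ^ 2 * t ^ 2 / A)) ≤ 1 := Real.exp_le_one_iff.2 (by
      have : 0 ≤ 4 * Real.pi ^ 2 * t ^ 2 / A := by positivity
      linarith)
    rw [hr]; linarith
  have hlog : Real.pi ^ 2 * Real.log (2 / r) * A = (2 * Real.pi ^ 2 * t) ^ 2 := by
    have : 2 / r = Real.exp (4 * Real.pi ^ 2 * t ^ 2 / A) := by
      rw [hr, Real.exp_neg]; field_simp
    rw [this, Real.log_exp]; field_simp; ring
  set N : E 4 → ℝ≥0∞ := fun x => ∫⁻ y in ball (0 : E 4) 1, Gk 2 r (x, y) * W y with hN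
  have hNm : Measurable N :=
    Measurable.lintegral_prod_right' (f := fun z : E 4 × E 4 => Gk 2 r z * W z.2) ((Gk_meas 2 r).mul (hW.comp measurable_snd))
  have hsub : ∀ᵐ x ∂(sphMeasure 4), x ∈ {x | x ∈ ball x0 ρ ∧ t + c0 / (2 * Real.pi ^ 2) < u x} → x ∈ {x | 1 ≤ N x ^ 2} := by
    filter_upwards [sph_ae] with x hx hxm
    obtain ⟨hxb, hxu⟩ := hxm
    have h1 := split_int W hW x x0 hx ρ hρ hxb r hr0 hr2 A hA.le hWA hW2
    rw [hlog, Real.sqrt_sq (by positivity)] at h1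
    obtain ⟨hI, h2⟩ := rep_real u hu hn hm x hx
    have h3 : ENNReal.ofReal (∫ y in ball (0 : E 4) 1, (‖x - y‖ ^ 2)⁻¹ * |lap 4 u y|) =
        ∫⁻ y in ball (0 : E 4) 1, ENNReal.ofReal ((‖x - y‖ ^ 2)⁻¹) * W y := by
      rw [ofReal_integral_eq_lintegral_ofReal hI (Eventually.of_forall fun y => by positivity)]
      refine lintegral_congr fun y => ?_
      rw [ENNReal.ofReal_mul (by positivity)]
    rw [← h3] at h1
    have h4 : 1 ≤ N x := by
      by_contra hlt
      have hlt' : N x < 1 := not_le.1 hlt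
      have h5 : ENNReal.ofReal (∫ y in ball (0 : E 4) 1, (‖x - y‖ ^ 2)⁻¹ * |lap 4 u y|) ≤
          ENNReal.ofReal (1 + 2 * Real.pi ^ 2 * t + (ρ ^ 2)⁻¹ * (Real.pi ^ 2 / 2 + 2)) := by
        refine h1.trans ?_
        rw [ENNReal.ofReal_add (by positivity) (by positivity), ENNReal.ofReal_add (by positivity) (by positivity), ENNReal.ofReal_one]
        gcongr
      have h6 := (ENNReal.ofReal_le_ofReal_iff (by positivity)).1 h5
      have h7 : 2 * Real.pi ^ 2 * (t + c0 / (2 * Real.pi ^ 2)) = 2 * Real.pi ^ 2 * t + c0 := by field_simp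
      have h8 : 2 * Real.pi ^ 2 * (t + c0 / (2 * Real.pi ^ 2)) < 2 * Real.pi ^ 2 * |u x| := by
        have := hxu.trans_le (le_abs_self _)
        gcongr
      rw [h7, hc0] at h8
      linarith
    exact one_le_pow_of_one_le' h4 2
  refine (measure_mono_ae hsub).trans ?_
  have hmk := mul_meas_ge_le_lintegral₀ (μ := sphMeasure 4) (hNm.pow_const 2).aemeasurable 1
  rw [one_mul] at hmk
  refine hmk.trans ((near_sq W hW r hr0).trans ?_)
  refine (mul_le_mul' le_rfl hW2).trans (le_of_eq ?_)
  rw [show (2 : ℝ≥0∞) = ENNReal.ofReal 2 by simp, ← ENNReal.ofReal_mul (by positivity)]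
  congr 1
  have : r ^ 3 = 8 * Real.exp (-(12 * Real.pi ^ 2 * t ^ 2 / A)) := by
    rw [hr, mul_pow, ← Real.exp_nat_mul]
    norm_num
    ring
  rw [this]; ring


lemma exp_layer (a g : ℝ) (ha : 0 ≤ a) :
    ENNReal.ofReal (Real.exp (a * g)) ≤ 1 + ∑' k : ℕ, {s : ℝ | (k : ℝ) < s}.indicator (fun _ => ENNReal.ofReal (Real.exp (a * (k + 1)))) g := by
  rcases le_or_gt g 0 with h | h
  · refine le_trans ?_ le_self_add
    rw [ENNReal.ofReal_le_one, Real.exp_le_one_iff]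
    exact mul_nonpos_of_nonneg_of_nonpos ha h
  · refine le_trans ?_ le_add_self
    obtain ⟨k, hk⟩ : ∃ k : ℕ, ⌈g⌉₊ = k + 1 := Nat.exists_eq_succ_of_ne_zero (Nat.ceil_pos.2 h).ne'
    have h1 : (k : ℝ) < g := by
      have := Nat.ceil_lt_add_one h.le
      rw [hk] at this; push_cast at this; linarith
    have h2 : g ≤ k + 1 := by
      have := Nat.le_ceil g
      rw [hk] at this; push_cast at this; exact this
    refine le_trans ?_ (ENNReal.le_tsum k)
    rw [Set.indicator_of_mem (by exact h1)]
    apply ENNReal.ofReal_le_ofReal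
    gcongr

lemma exp_est (ρ : ℝ) (hρ : 0 < ρ) (A A2 : ℝ) (hA : 0 < A) (hA2 : A < A2) : ∃ C : ℝ, ∃ K : ℝ, 0 ≤ K ∧
    ∀ (u : E 4 → ℝ), ContDiff ℝ (⊤ : ℕ∞) u → (∀ y ∈ sphere (0 : E 4) 1, fderiv ℝ u y y = 0) →
      ∫ y, u y ∂(sphMeasure 4) = 0 → ∫ y in ball (0 : E 4) 1, (lap 4 u y) ^ 2 ≤ 2 →
      ∀ x0 : E 4, ∫ y in ball (0 : E 4) 1 ∩ ball x0 (2 * ρ), (lap 4 u y) ^ 2 ≤ A →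
      ∀ m : ℝ, 0 < m → ∫⁻ x in ball x0 ρ, ENNReal.ofReal (Real.exp (3 * m * u x)) ∂(sphMeasure 4) ≤
        ENNReal.ofReal (K * Real.exp (3 * m * C + 3 * m ^ 2 * A2 / (16 * Real.pi ^ 2))) := by
  obtain ⟨C, hC0, C2, hC20, H⟩ := level_est ρ hρ A hA
  have hpi := Real.pi_pos
  have hA20 : 0 < A2 := hA.trans hA2
  set c := 12 * Real.pi ^ 2 / A - 12 * Real.pi ^ 2 / A2 with hc
  have hc0 : 0 < c := by
    rw [hc, sub_pos]; gcongr
  have hsum : Summable fun k : ℕ => Real.exp (k * (-c)) := Real.summable_exp_nat_mul_iff.2 (by linarith)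
  set T := ∑' k : ℕ, Real.exp (k * (-c)) with hT
  have hT0 : 0 ≤ T := tsum_nonneg fun k => (Real.exp_pos _).le
  refine ⟨C + 1, 2 * Real.pi ^ 2 + C2 * T, by positivity, ?_⟩
  intro u hu hn hm hD x0 hA' m hm0
  have hucm := hu.continuous.measurable
  set Q := Real.exp (3 * m ^ 2 * A2 / (16 * Real.pi ^ 2)) with hQ
  have hQ1 : 1 ≤ Q := Real.one_le_exp (by positivity)
  have hpt : ∀ x, ENNReal.ofReal (Real.exp (3 * m * u x)) ≤ ENNReal.ofReal (Real.exp (3 * m * C)) *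
      (1 + ∑' k : ℕ, {x | (k : ℝ) + C < u x}.indicator (fun _ => ENNReal.ofReal (Real.exp (3 * m * (k + 1)))) x) := by
    intro x
    have h1 := exp_layer (3 * m) (u x - C) (by positivity)
    have h2 : Real.exp (3 * m * u x) = Real.exp (3 * m * C) * Real.exp (3 * m * (u x - C)) := by
      rw [← Real.exp_add]; congr 1; ring
    rw [h2, ENNReal.ofReal_mul (Real.exp_pos _).le]
    refine mul_le_mul' le_rfl (h1.trans (le_of_eq ?_))
    congr 2; ext k
    simp only [Set.indicator, Set.mem_ofPred_eq, lt_sub_iff_add_lt]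
  have hms : ∀ k : ℕ, MeasurableSet {x | (k : ℝ) + C < u x} := fun k => measurableSet_lt measurable_const hucm
  have hterm : ∀ k : ℕ, ∫⁻ x in ball x0 ρ, {x | (k : ℝ) + C < u x}.indicator (fun _ => ENNReal.ofReal (Real.exp (3 * m * (k + 1)))) x ∂(sphMeasure 4)
      ≤ ENNReal.ofReal (C2 * Real.exp (3 * m) * Q * Real.exp (k * (-c))) := by
    intro k
    rw [lintegral_indicator (hms k), lintegral_const, Measure.restrict_apply MeasurableSet.univ, Set.univ_inter, Measure.restrict_apply (hms k)]
    have h1 := H u hu hn hm hD x0 hA' k (Nat.cast_nonneg k)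
    have h2 : {x | (k : ℝ) + C < u x} ∩ ball x0 ρ = {x | x ∈ ball x0 ρ ∧ (k : ℝ) + C < u x} := by
      ext x; simp [and_comm]
    rw [h2]
    refine (mul_le_mul' le_rfl h1).trans ?_
    rw [← ENNReal.ofReal_mul (Real.exp_pos _).le]
    apply ENNReal.ofReal_le_ofReal
    rw [show Real.exp (3 * m * (k + 1)) * (C2 * Real.exp (-(12 * Real.pi ^ 2 * k ^ 2 / A))) =
      C2 * (Real.exp (3 * m * (k + 1)) * Real.exp (-(12 * Real.pi ^ 2 * k ^ 2 / A))) by ring,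
      show C2 * Real.exp (3 * m) * Q * Real.exp (k * (-c)) = C2 * (Real.exp (3 * m) * (Q * Real.exp (k * (-c)))) by ring,
      hQ, ← Real.exp_add, ← Real.exp_add, ← Real.exp_add]
    refine mul_le_mul_of_nonneg_left (Real.exp_le_exp.2 ?_) hC20
    have hk2 : (k : ℝ) ≤ (k : ℝ) ^ 2 := by
      rcases Nat.eq_zero_or_pos k with h | h
      · simp [h]
      · have : (1 : ℝ) ≤ k := by exact_mod_cast h
        nlinarith
    have h3 : 3 * m * k ≤ 12 * Real.pi ^ 2 / A2 * k ^ 2 + 3 * m ^ 2 * A2 / (16 * Real.pi ^ 2) := by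
      have : 12 * Real.pi ^ 2 / A2 * k ^ 2 + 3 * m ^ 2 * A2 / (16 * Real.pi ^ 2) - 3 * m * k =
          (8 * Real.pi ^ 2 * k - m * A2) ^ 2 * 3 / (16 * Real.pi ^ 2 * A2) := by
        field_simp; ring
      have h4 : 0 ≤ (8 * Real.pi ^ 2 * k - m * A2) ^ 2 * 3 / (16 * Real.pi ^ 2 * A2) := by positivity
      linarith
    have h5 : 12 * Real.pi ^ 2 * (k:ℝ) ^ 2 / A = c * k ^ 2 + 12 * Real.pi ^ 2 / A2 * k ^ 2 := by
      rw [hc]; ring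
    rw [h5]
    nlinarith
  calc ∫⁻ x in ball x0 ρ, ENNReal.ofReal (Real.exp (3 * m * u x)) ∂(sphMeasure 4)
      ≤ ∫⁻ x in ball x0 ρ, ENNReal.ofReal (Real.exp (3 * m * C)) *
      (1 + ∑' k : ℕ, {x | (k : ℝ) + C < u x}.indicator (fun _ => ENNReal.ofReal (Real.exp (3 * m * (k + 1)))) x) ∂(sphMeasure 4) :=
        lintegral_mono hpt
    _ = ENNReal.ofReal (Real.exp (3 * m * C)) * (sphMeasure 4 (ball x0 ρ) + ∑' k : ℕ, ∫⁻ x in ball x0 ρ, {x | (k : ℝ) + C < u x}.indicator (fun _ => ENNReal.ofReal (Real.exp (3 * m * (k + 1)))) x ∂(sphMeasure 4)) := by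
      rw [lintegral_const_mul', lintegral_add_left measurable_const, lintegral_tsum]
      · simp
      · exact fun k => (measurable_const.indicator (hms k)).aemeasurable
      · exact ENNReal.ofReal_ne_top
    _ ≤ ENNReal.ofReal (Real.exp (3 * m * C)) * (ENNReal.ofReal (2 * Real.pi ^ 2) + ENNReal.ofReal (C2 * Real.exp (3 * m) * Q * T)) := by
      refine mul_le_mul' le_rfl (add_le_add ?_ ?_)
      · rw [← sph_mass, ofReal_measureReal]; exact measure_mono (Set.subset_univ _)
      · refine (ENNReal.tsum_le_tsum hterm).trans (le_of_eq ?_)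
        rw [← ENNReal.ofReal_tsum_of_nonneg (fun k => by positivity) (hsum.mul_left _), tsum_mul_left]
    _ ≤ _ := by
      rw [← ENNReal.ofReal_add (by positivity) (by positivity), ← ENNReal.ofReal_mul (by positivity)]
      apply ENNReal.ofReal_le_ofReal
      have e1 : 1 ≤ Real.exp (3 * m) := Real.one_le_exp (by positivity)
      have e2 : Real.exp (3 * m * (C + 1) + 3 * m ^ 2 * A2 / (16 * Real.pi ^ 2)) = Real.exp (3 * m * C) * (Real.exp (3 * m) * Q) := by
        rw [hQ, ← Real.exp_add, ← Real.exp_add]; congr 1; ring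
      have e3 : 1 ≤ Real.exp (3 * m) * Q := one_le_mul_of_one_le_of_one_le e1 hQ1
      rw [e2, show (2 * Real.pi ^ 2 + C2 * T) * (Real.exp (3 * m * C) * (Real.exp (3 * m) * Q)) =
        Real.exp (3 * m * C) * (2 * Real.pi ^ 2 * (Real.exp (3 * m) * Q) + C2 * Real.exp (3 * m) * Q * T) by ring]
      have e4 : 2 * Real.pi ^ 2 ≤ 2 * Real.pi ^ 2 * (Real.exp (3 * m) * Q) := le_mul_of_one_le_right (by positivity) e3
      exact mul_le_mul_of_nonneg_left (by linarith) (Real.exp_pos _).le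


lemma tgrad_nonneg (f : E 4 → ℝ) (x : E 4) (hx : ‖x‖ = 1) : 0 ≤ tgradNormSq 4 f x := by
  unfold tgradNormSq
  have h1 : inner ℝ (gradient f x) x = fderiv ℝ f x x := by
    unfold gradient; rw [InnerProductSpace.toDual_symm_apply]
  have h2 := abs_real_inner_le_norm (gradient f x) x
  rw [h1, hx, mul_one] at h2
  rw [sub_nonneg, ← sq_abs (fderiv ℝ f x x)]
  exact pow_le_pow_left₀ (abs_nonneg _) h2 2

lemma null_of_bump (ν : Measure (E 4)) [IsFiniteMeasure ν] (x0 : E 4) (s : ℝ) (hs : 0 < s)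
    (h : ∀ g : E 4 → ℝ, Continuous g → (∀ y, 0 ≤ g y) → (∀ y, g y ≤ 1) → (∀ y, y ∉ ball x0 s → g y = 0) →
      ∫ y, g y ∂ν ≤ 0) : ν (ball x0 (s / 2)) = 0 := by
  let b : ContDiffBump x0 := ⟨s / 2, s, by linarith, by linarith⟩
  have h1 := h b b.continuous (fun y => b.nonneg) (fun y => b.le_one) (fun y hy => by
    rw [← Function.notMem_support, b.support_eq]; exact hy)
  have hbi : Integrable b ν := Integrable.of_bound b.continuous.aestronglyMeasurable 1
    (Eventually.of_forall fun y => by rw [Real.norm_of_nonneg b.nonneg]; exact b.le_one)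
  have h2 : ν.real (ball x0 (s / 2)) ≤ ∫ y, b y ∂ν := by
    rw [← integral_indicator_one measurableSet_ball]
    refine integral_mono ((integrable_const (1:ℝ)).indicator measurableSet_ball) hbi fun y => ?_
    by_cases hy : y ∈ ball x0 (s / 2)
    · rw [Set.indicator_of_mem hy, b.one_of_mem_closedBall (ball_subset_closedBall hy)]; simp
    · rw [Set.indicator_of_notMem hy]; exact b.nonneg
  have h3 : ν.real (ball x0 (s / 2)) = 0 := le_antisymm (h2.trans h1) measureReal_nonneg
  exact (measureReal_eq_zero_iff).1 h3

lemma atoms (ν : Measure (E 4)) [IsFiniteMeasure ν] (N : ℕ) (X : Fin N → E 4)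
    (h0 : ν (Set.range X)ᶜ = 0) (h1 : ν.real Set.univ = 1) :
    ∃ w : Fin N → ℝ, (∀ i, 0 ≤ w i) ∧ (∑ i, w i) = 1 ∧
      ν = Measure.sum (fun i => ENNReal.ofReal (w i) • Measure.dirac (X i)) := by
  set T : Fin N → Set (E 4) := fun i => {X i} \ {y | ∃ j < i, X j = y} with hT
  have hTs : ∀ i, T i ⊆ {X i} := fun i => Set.diff_subset
  have hTm : ∀ i, MeasurableSet (T i) := fun i => ((Set.finite_singleton (X i)).subset (hTs i)).measurableSet
  have hdis : Pairwise (Function.onFun Disjoint T) := by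
    intro i j hij
    rw [Function.onFun, Set.disjoint_left]
    intro y hi hj
    rcases lt_or_gt_of_ne hij with h | h
    · exact hj.2 ⟨i, h, (hTs i hi).symm⟩
    · exact hi.2 ⟨j, h, (hTs j hj).symm⟩
  have hU : ⋃ i, T i = Set.range X := by
    apply subset_antisymm
    · refine Set.iUnion_subset fun i y hy => ⟨i, (hTs i hy).symm⟩
    · rintro _ ⟨i, rfl⟩
      obtain ⟨j, hj, hmin⟩ := WellFounded.has_min (wellFounded_lt (α := Fin N)) {j | X j = X i} ⟨i, rfl⟩
      have hj' : X j = X i := hj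
      refine Set.mem_iUnion.2 ⟨j, hj'.symm, ?_⟩
      rintro ⟨k, hk, hki⟩
      exact hmin k hki hk
  have hB : ∀ B, MeasurableSet B → ν B = ∑ i, ν (B ∩ T i) := by
    intro B hB
    have : ν B = ν (B ∩ Set.range X) := by
      refine measure_congr ?_
      have : ∀ᵐ y ∂ν, y ∈ Set.range X := by
        rw [ae_iff]; exact h0
      filter_upwards [this] with y hy
      apply propext
      exact ⟨fun h => ⟨h, hy⟩, fun h => h.1⟩
    rw [this, ← hU, Set.inter_iUnion, measure_iUnion, tsum_fintype]
    · intro i j hij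
      exact (hdis hij).mono Set.inter_subset_right Set.inter_subset_right
    · exact fun i => hB.inter (hTm i)
  refine ⟨fun i => ν.real (T i), fun i => measureReal_nonneg, ?_, ?_⟩
  · have := hB Set.univ MeasurableSet.univ
    simp only [Set.univ_inter] at this
    rw [← h1, measureReal_def, this, ENNReal.toReal_sum (fun i _ => measure_ne_top _ _)]
    rfl
  · ext B hBm
    rw [hB B hBm, Measure.sum_apply _ hBm, tsum_fintype]
    refine Finset.sum_congr rfl fun i _ => ?_
    rw [Measure.smul_apply, Measure.dirac_apply' _ hBm, ofReal_measureReal, smul_eq_mul]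
    by_cases h : X i ∈ B
    · rw [Set.indicator_of_mem h, Set.inter_eq_right.2 ((hTs i).trans (by simpa using h))]; simp
    · have : B ∩ T i = ∅ := by
        rw [Set.eq_empty_iff_forall_notMem]
        rintro y ⟨hy, hyT⟩
        have h5 : y = X i := hTs i hyT
        rw [h5] at hy; exact h hy
      rw [this, Set.indicator_of_notMem h]; simp

lemma choose_rad (σ : Measure (E 4)) [IsFiniteMeasure σ] (w : E 4 → ℝ) (hw : Continuous w) (hw0 : ∀ y, 0 ≤ w y)
    (x0 : E 4) (thr : ℝ) (hσ : σ {x0} < ENNReal.ofReal thr) :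
    ∃ a : ℝ, 0 ≤ a ∧ a < thr ∧ ∃ ρ : ℝ, 0 < ρ ∧ ∀ φ : E 4 → ℝ, Continuous φ → (∀ y, 0 ≤ φ y) → (∀ y, φ y ≤ 1) →
      (∀ y, y ∉ ball x0 (3 * ρ) → φ y = 0) →
      (∫ x in ball (0 : E 4) 1, w x * φ x) + ∫ x, φ x ∂σ ≤ a := by
  have hi : IntegrableOn w (ball (0 : E 4) 1) :=
    (hw.continuousOn.integrableOn_compact (isCompact_closedBall 0 1)).mono_set ball_subset_closedBall
  set M : Measure (E 4) := (volume.restrict (ball (0 : E 4) 1)).withDensity (fun y => ENNReal.ofReal (w y)) with hM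
  have hMf : IsFiniteMeasure M := isFiniteMeasure_withDensity_ofReal hi.2
  have hM0 : M {x0} = 0 := by
    refine withDensity_absolutelyContinuous _ _ ?_
    exact Measure.absolutelyContinuous_of_le Measure.restrict_le_self (by simp)
  have hlt : (σ + M) {x0} < ENNReal.ofReal thr := by
    rw [Measure.add_apply, hM0, add_zero]; exact hσ
  obtain ⟨U, hxU, hUo, hU⟩ := Set.exists_isOpen_lt_of_lt {x0} _ hlt
  have hx : x0 ∈ U := hxU rfl
  obtain ⟨ε, hε, hεU⟩ := Metric.isOpen_iff.1 hUo x0 hx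
  refine ⟨((σ + M) U).toReal, ENNReal.toReal_nonneg, ?_, ε / 3, by positivity, ?_⟩
  · exact (ENNReal.lt_ofReal_iff_toReal_lt (measure_ne_top _ _)).1 hU
  intro φ hφ h0 h1 hsupp
  rw [show 3 * (ε / 3) = ε by ring] at hsupp
  have hφU : ∀ y, y ∉ U → φ y = 0 := fun y hy => hsupp y fun h => hy (hεU h)
  rw [Measure.add_apply, ENNReal.toReal_add (measure_ne_top _ _) (measure_ne_top _ _), add_comm]
  refine add_le_add ?_ ?_
  · rw [← measureReal_def, ← integral_indicator_one hUo.measurableSet]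
    refine integral_mono (Integrable.of_bound hφ.aestronglyMeasurable 1
      (Eventually.of_forall fun y => by rw [Real.norm_of_nonneg (h0 y)]; exact h1 y))
      ((integrable_const (1:ℝ)).indicator hUo.measurableSet) fun y => ?_
    by_cases hy : y ∈ U
    · rw [Set.indicator_of_mem hy]; exact h1 y
    · rw [Set.indicator_of_notMem hy, hφU y hy]
  · have e : (M U).toReal = ∫ y in ball (0 : E 4) 1, U.indicator w y := by
      rw [hM, withDensity_apply _ hUo.measurableSet, setIntegral_indicator hUo.measurableSet, Measure.restrict_restrict hUo.measurableSet,
        integral_eq_lintegral_of_nonneg_ae (Eventually.of_forall hw0) hw.aestronglyMeasurable, Set.inter_comm]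
    rw [e]
    refine integral_mono ?_ (hi.indicator hUo.measurableSet) fun y => ?_
    · exact ((hw.mul hφ).continuousOn.integrableOn_compact (isCompact_closedBall 0 1)).mono_set ball_subset_closedBall
    · by_cases hy : y ∈ U
      · rw [Set.indicator_of_mem hy]; exact mul_le_of_le_one_right (hw0 y) (h1 y)
      · rw [Set.indicator_of_notMem hy]; simp [hφU y hy]


lemma cont_int (g : E 4 → ℝ) (hg : Continuous g) : Integrable g (sphMeasure 4) := by
  obtain ⟨C, hC⟩ := (isCompact_sphere (0 : E 4) 1).exists_bound_of_continuousOn hg.continuousOn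
  exact sph_int_of_bound g hg.measurable C fun y hy => hC y (by simpa using hy)

lemma decay (α b c K : ℝ) (hb : b < α) (m : ℕ → ℝ) (hm' : Tendsto m atTop atTop) :
    Tendsto (fun i => K * Real.exp (m i * c + m i ^ 2 * b) / Real.exp (α * m i ^ 2)) atTop (nhds 0) := by
  have h1 : Tendsto (fun i => m i * ((α - b) * m i + (-c))) atTop atTop :=
    hm'.atTop_mul_atTop₀ (tendsto_atTop_add_const_right _ _ (hm'.const_mul_atTop (by linarith)))
  have h2 := (Real.tendsto_exp_neg_atTop_nhds_zero.comp h1).const_mul K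
  rw [mul_zero] at h2
  refine h2.congr fun i => ?_
  simp only [Function.comp]
  rw [mul_div_assoc, ← Real.exp_sub]
  congr 2; ring

theorem stmt13 (α : ℝ) (hα : 0 < α) (m : ℕ → ℝ) (hm : ∀ i, 0 < m i)
    (hm' : Tendsto m atTop atTop)
    (f : ℕ → E 4 → ℝ) (u : ℕ → E 4 → ℝ) (u₀ : E 4 → ℝ)
    (hf : ∀ i, ContDiff ℝ (⊤ : ℕ∞) (f i)) (hu : ∀ i, ContDiff ℝ (⊤ : ℕ∞) (u i)) (hu₀ : ContDiff ℝ (⊤ : ℕ∞) u₀)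
    -- the `f_i` have mean zero on `S³`
    (hmean : ∀ i, ∫ x, f i x ∂(sphMeasure 4) = 0)
    -- `u_i` is the biharmonic extension of `f_i` with zero Neumann boundary condition
    (hbih : ∀ i, ∀ x ∈ Metric.ball (0 : E 4) 1, lap 4 (lap 4 (u i)) x = 0)
    (hbd' : ∀ i, ∀ x ∈ Metric.sphere (0 : E 4) 1, u i x = f i x)
    (hneu : ∀ i, ∀ x ∈ Metric.sphere (0 : E 4) 1, fderiv ℝ (u i) x x = 0)
    -- normalization
    (hnorm : ∀ i, (1 / 2 : ℝ) * ((∫ x in Metric.ball (0 : E 4) 1, (lap 4 (u i) x) ^ 2) +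
      2 * ∫ x, tgradNormSq 4 (f i) x ∂(sphMeasure 4)) = 1)
    (hlog : ∀ i, α * (m i) ^ 2 ≤
      Real.log (∫ x, Real.exp (3 * m i * f i x) ∂(sphMeasure 4)))
    -- `u_i ⇀ u₀` weakly in `H²(𝔹⁴)` : boundedness plus weak convergence against tests
    (hbdd : ∃ C : ℝ, ∀ i, (∫ x in Metric.ball (0 : E 4) 1,
      ((u i x) ^ 2 + ‖fderiv ℝ (u i) x‖ ^ 2 + ‖iteratedFDeriv ℝ 2 (u i) x‖ ^ 2)) ≤ C)
    (hweak : ∀ v : E 4 → ℝ, ContDiff ℝ (⊤ : ℕ∞) v →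
      Tendsto (fun i => ∫ x in Metric.ball (0 : E 4) 1, u i x * v x) atTop
        (nhds (∫ x in Metric.ball (0 : E 4) 1, u₀ x * v x)))
    (σ : Measure (E 4)) [IsFiniteMeasure σ]
    -- `(Δu_i)² dx ⇀ (Δu₀)² dx + σ` as measures on `𝔹⁴`
    (hσ : ∀ φ : E 4 → ℝ, Continuous φ →
      Tendsto (fun i => ∫ x in Metric.ball (0 : E 4) 1, (lap 4 (u i) x) ^ 2 * φ x) atTop
        (nhds ((∫ x in Metric.ball (0 : E 4) 1, (lap 4 u₀ x) ^ 2 * φ x) + ∫ x, φ x ∂σ)))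
    (ν : Measure (E 4)) [IsFiniteMeasure ν]
    -- `e^{3 m_i f_i}/∫ e^{3 m_i f_i} ⇀ ν` as measures on `S³`
    (hν : ∀ g : E 4 → ℝ, Continuous g →
      Tendsto (fun i => (∫ x, Real.exp (3 * m i * f i x) * g x ∂(sphMeasure 4)) /
          (∫ x, Real.exp (3 * m i * f i x) ∂(sphMeasure 4))) atTop
        (nhds (∫ x, g x ∂ν)))
    -- the set of atoms of `σ̂` of mass at least `(16/3)π²α` is `{x₁, …, x_N}`
    (N : ℕ) (X : Fin N → E 4)
    (hX : {y : E 4 | y ∈ Metric.sphere (0 : E 4) 1 ∧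
        ENNReal.ofReal ((16 / 3) * Real.pi ^ 2 * α) ≤ σ (cone 4 {y})} = Set.range X) :
    ∃ w : Fin N → ℝ, (∀ i, 0 ≤ w i) ∧ (∑ i, w i) = 1 ∧
      ν = Measure.sum (fun i => ENNReal.ofReal (w i) • Measure.dirac (X i)) := by
  have hpi := Real.pi_pos
  have hD : ∀ i, ∫ y in ball (0 : E 4) 1, (lap 4 (u i) y) ^ 2 ≤ 2 := by
    intro i
    have h1 : 0 ≤ ∫ x, tgradNormSq 4 (f i) x ∂(sphMeasure 4) := by
      refine integral_nonneg_of_ae ?_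
      filter_upwards [sph_ae] with x hx
      exact tgrad_nonneg _ x hx
    have := hnorm i
    linarith
  have hm0 : ∀ i, ∫ y, u i y ∂(sphMeasure 4) = 0 := by
    intro i
    rw [← hmean i]
    refine integral_congr_ae ?_
    filter_upwards [sph_ae] with x hx
    exact hbd' i x (by simpa using hx)
  have hcf : ∀ i, Continuous fun x => Real.exp (3 * m i * f i x) := fun i =>
    Real.continuous_exp.comp (continuous_const.mul (hf i).continuous)
  have hZ : ∀ i, 0 < ∫ x, Real.exp (3 * m i * f i x) ∂(sphMeasure 4) ∧
      Real.exp (α * m i ^ 2) ≤ ∫ x, Real.exp (3 * m i * f i x) ∂(sphMeasure 4) := by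
    intro i
    have h0 : 0 ≤ ∫ x, Real.exp (3 * m i * f i x) ∂(sphMeasure 4) :=
      integral_nonneg fun x => (Real.exp_pos _).le
    have h1 : 0 < ∫ x, Real.exp (3 * m i * f i x) ∂(sphMeasure 4) := by
      rcases h0.lt_or_eq with h | h
      · exact h
      · have := hlog i
        rw [← h, Real.log_zero] at this
        have := hm i
        have : 0 < α * m i ^ 2 := by positivity
        linarith
    exact ⟨h1, (Real.le_log_iff_exp_le h1).1 (hlog i)⟩
  have hmass : ν.real Set.univ = 1 := by
    have h1 := hν (fun _ => 1) continuous_const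
    have h2 : Tendsto (fun i => (∫ x, Real.exp (3 * m i * f i x) * (fun _ => (1 : ℝ)) x ∂(sphMeasure 4)) /
          (∫ x, Real.exp (3 * m i * f i x) ∂(sphMeasure 4))) atTop (nhds 1) := by
      refine tendsto_const_nhds.congr fun i => ?_
      simp only [mul_one]
      rw [div_self (hZ i).1.ne']
    have h3 := tendsto_nhds_unique h1 h2
    simpa using h3
  refine atoms ν N X ?_ hmass
  refine measure_null_of_locally_null _ fun x0 hx0 => ?_
  have key : ∃ s > 0, ν (ball x0 s) = 0 := by
    by_cases hxs : x0 ∈ sphere (0 : E 4) 1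
    · have hlt : σ (cone 4 {x0}) < ENNReal.ofReal ((16 / 3) * Real.pi ^ 2 * α) := by
        by_contra hcon
        apply hx0
        rw [← hX]
        exact ⟨hxs, not_lt.1 hcon⟩
      have hlt2 : σ {x0} < ENNReal.ofReal ((16 / 3) * Real.pi ^ 2 * α) := by
        refine lt_of_le_of_lt (measure_mono ?_) hlt
        rintro y rfl
        exact ⟨1, zero_le_one, le_rfl, y, rfl, by simp⟩
      obtain ⟨a, ha0, ha, ρ, hρ, hφ⟩ := choose_rad σ (fun y => (lap 4 u₀ y) ^ 2)
        ((lap_cont u₀ hu₀).pow 2) (fun y => sq_nonneg _) x0 _ hlt2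
      obtain ⟨A2, haA2, hA2⟩ := exists_between ha
      obtain ⟨A, haA, hAA2⟩ := exists_between haA2
      have hA : 0 < A := ha0.trans_lt haA
      obtain ⟨C, K, hK, hest⟩ := exp_est ρ hρ A A2 hA hAA2
      let b : ContDiffBump x0 := ⟨2 * ρ, 3 * ρ, by linarith, by linarith⟩
      have hb := hφ b b.continuous (fun y => b.nonneg) (fun y => b.le_one) (fun y hy => by
        rw [← Function.notMem_support, b.support_eq]; exact hy)
      have hev := (hσ b b.continuous).eventually_lt_const (hb.trans_lt haA)
      have hbb : A2 * 3 / (16 * Real.pi ^ 2) < α := by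
        rw [div_lt_iff₀ (by positivity)]; linarith
      refine ⟨ρ / 2, by positivity, null_of_bump ν x0 ρ hρ fun g hg hg0 hg1 hgs => ?_⟩
      refine le_of_tendsto_of_tendsto (hν g hg) (decay α (A2 * 3 / (16 * Real.pi ^ 2)) (3 * C) K hbb m hm') ?_
      filter_upwards [hev] with i hi
      have hintg : ∀ φ : E 4 → ℝ, Continuous φ → IntegrableOn φ (ball (0 : E 4) 1) := fun φ hc =>
        (hc.continuousOn.integrableOn_compact (isCompact_closedBall 0 1)).mono_set ball_subset_closedBall
      have hlc : Continuous fun y => (lap 4 (u i) y) ^ 2 := (lap_cont (u i) (hu i)).pow 2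
      have hloc : ∫ y in ball (0 : E 4) 1 ∩ ball x0 (2 * ρ), (lap 4 (u i) y) ^ 2 ≤ A := by
        refine le_trans ?_ hi.le
        rw [← setIntegral_indicator measurableSet_ball]
        refine integral_mono ((hintg _ hlc).indicator measurableSet_ball) (hintg _ (hlc.mul b.continuous)) fun y => ?_
        by_cases hy : y ∈ ball x0 (2 * ρ)
        · rw [Set.indicator_of_mem hy]
          simp only []
          rw [b.one_of_mem_closedBall (ball_subset_closedBall hy), mul_one]
        · rw [Set.indicator_of_notMem hy]; exact mul_nonneg (sq_nonneg _) b.nonneg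
      have h1 := hest (u i) (hu i) (hneu i) (hm0 i) (hD i) x0 hloc (m i) (hm i)
      have h2 : ∫ x, Real.exp (3 * m i * f i x) * g x ∂(sphMeasure 4) ≤
          K * Real.exp (m i * (3 * C) + m i ^ 2 * (A2 * 3 / (16 * Real.pi ^ 2))) := by
        rw [show m i * (3 * C) + m i ^ 2 * (A2 * 3 / (16 * Real.pi ^ 2)) =
          3 * m i * C + 3 * m i ^ 2 * A2 / (16 * Real.pi ^ 2) by ring]
        rw [integral_eq_lintegral_of_nonneg_ae
          (Eventually.of_forall fun x => mul_nonneg (Real.exp_pos _).le (hg0 x))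
          ((hcf i).mul hg).aestronglyMeasurable]
        refine ENNReal.toReal_le_of_le_ofReal (by positivity) (le_trans ?_ h1)
        rw [← lintegral_indicator measurableSet_ball]
        refine lintegral_mono_ae ?_
        filter_upwards [sph_ae] with x hx
        by_cases hy : x ∈ ball x0 ρ
        · rw [Set.indicator_of_mem hy, hbd' i x (by simpa using hx)]
          exact ENNReal.ofReal_le_ofReal (mul_le_of_le_one_right (Real.exp_pos _).le (hg1 x))
        · rw [hgs x hy]; simp
      have h3 : 0 ≤ K * Real.exp (m i * (3 * C) + m i ^ 2 * (A2 * 3 / (16 * Real.pi ^ 2))) := by positivity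
      exact div_le_div₀ h3 h2 (Real.exp_pos _) (hZ i).2
    · obtain ⟨s, hs, hsub⟩ := Metric.isOpen_iff.1 (isClosed_sphere (x := (0 : E 4)) (ε := 1)).isOpen_compl x0 hxs
      refine ⟨s / 2, by positivity, null_of_bump ν x0 s hs fun g hg hg0 hg1 hgs => ?_⟩
      refine le_of_eq (tendsto_nhds_unique (hν g hg) (tendsto_const_nhds.congr fun i => ?_))
      have : ∫ x, Real.exp (3 * m i * f i x) * g x ∂(sphMeasure 4) = 0 := by
        refine integral_eq_zero_of_ae ?_
        filter_upwards [sph_ae] with x hx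
        have : x ∉ ball x0 s := fun h => hsub h (by simpa using hx)
        simp [hgs x this]
      rw [this, zero_div]
  obtain ⟨s, hs, h⟩ := key
  exact ⟨ball x0 s, mem_nhdsWithin_of_mem_nhds (ball_mem_nhds x0 hs), h⟩
end
end

section
/- Let n ≥ 3, m ≥ 1, and let p be the restriction to S^{n-1} of a harmonic polynomial on ℝⁿ that is homogeneous of degree l₀ with 1 ≤ l₀ ≤ m. Let x̄_1, …, x̄_{n+1} ∈ S^{n-1} be pairwise distinct points and ν_1, …, ν_{n+1} ∈ (0,1) with Σ_{k=1}^{n+1} ν_k = 1 and Σ_{k=1}^{n+1} ν_k p(x̄_k) = 0, and let δ > 0 be small enough that the geodesic balls B_δ(x̄_k) ⊂ S^{n-1} are pairwise disjoint. For ε > 0 set φ_{ε,k}(x) = -log( ε² + dist_{S^{n-1}}(x, x̄_k)² ). Then there exists a constant C > 0, depending on p, δ and n but not on ε, such that for all 0 < ε < δ: | Σ_{k=1}^{n+1} ν_k ∫_{B_δ(x̄_k)} e^{(n-1)φ_{ε,k}(x)} p(x) dμ_{S^{n-1}}(x) | ≤ C Σ_{k=1}^{n+1} ν_k ∫_{B_δ(x̄_k)}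 e^{(n-1)φ_{ε,k}(x)} dist_{S^{n-1}}(x, x̄_k)³ dμ_{S^{n-1}}(x). -/
open MeasureTheory Metric Filter
open scoped ENNReal RealInnerProductSpace

noncomputable section

/-- The geodesic distance on the unit sphere: `dist(x,y) = arccos⟨x,y⟩` for unit vectors. -/
def gdist (n : ℕ) (x y : E n) : ℝ := Real.arccos ⟪x, y⟫

/-- The geodesic ball of radius `δ` in the unit sphere centered at `p`. -/
def gball (n : ℕ) (p : E n) (δ : ℝ) : Set (E n) :=
  {x | x ∈ Metric.sphere (0 : E n) 1 ∧ gdist n x p < δ}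

/-- Evaluation of a polynomial at a point of Euclidean space. -/
def ev {n : ℕ} (q : MvPolynomial (Fin n) ℝ) (x : E n) : ℝ := MvPolynomial.eval (fun j => x j) q

lemma continuous_ev {n : ℕ} (q : MvPolynomial (Fin n) ℝ) : Continuous (ev q) := by
  unfold ev
  exact (MvPolynomial.continuous_eval q).comp (by fun_prop)

lemma ev_bound {n : ℕ} (q : MvPolynomial (Fin n) ℝ) :
    ∀ b : ℝ, 0 < b → ∃ C : ℝ, 0 ≤ C ∧ ∀ x : E n, |ev q x| ≤ C * Real.exp (b * ‖x‖ ^ 2) := by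
  induction q using MvPolynomial.induction_on with
  | C a =>
    intro b hb
    refine ⟨|a|, abs_nonneg _, fun x => ?_⟩
    have : 1 ≤ Real.exp (b * ‖x‖ ^ 2) := Real.one_le_exp (by positivity)
    simp only [ev, MvPolynomial.eval_C]
    nlinarith [abs_nonneg a]
  | add p q hp hq =>
    intro b hb
    obtain ⟨C, hC, h1⟩ := hp b hb
    obtain ⟨D, hD, h2⟩ := hq b hb
    refine ⟨C + D, by positivity, fun x => ?_⟩
    have := abs_add_le (ev p x) (ev q x)
    have h3 : ev (p + q) x = ev p x + ev q x := by simp [ev]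
    rw [h3]
    nlinarith [h1 x, h2 x]
  | mul_X p i hp =>
    intro b hb
    obtain ⟨C, hC, h1⟩ := hp (b / 2) (by positivity)
    refine ⟨C * (1 + 2 / b), by positivity, fun x => ?_⟩
    have h3 : ev (p * MvPolynomial.X i) x = ev p x * x i := by simp [ev]
    rw [h3, abs_mul]
    have h4 : |x i| ≤ ‖x‖ := by simpa using PiLp.norm_apply_le x i
    have h5 : ‖x‖ ≤ (1 + 2 / b) * Real.exp (b / 2 * ‖x‖ ^ 2) := by
      have e1 : b / 2 * ‖x‖ ^ 2 + 1 ≤ Real.exp (b / 2 * ‖x‖ ^ 2) := Real.add_one_le_exp _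
      have e2 : (1 + 2 / b) * (b / 2 * ‖x‖ ^ 2 + 1) ≤ (1 + 2 / b) * Real.exp (b / 2 * ‖x‖ ^ 2) := by
        gcongr
      have e3 : (1 + 2 / b) * (b / 2 * ‖x‖ ^ 2 + 1) = b / 2 * ‖x‖ ^ 2 + 1 + ‖x‖ ^ 2 + 2 / b := by
        field_simp; ring
      have e4 : 0 ≤ b / 2 * ‖x‖ ^ 2 := by positivity
      have e5 : 0 ≤ 2 / b := by positivity
      nlinarith [sq_nonneg (‖x‖ - 1)]
    have h6 : Real.exp (b * ‖x‖ ^ 2) = Real.exp (b / 2 * ‖x‖ ^ 2) * Real.exp (b / 2 * ‖x‖ ^ 2) := by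
      rw [← Real.exp_add]; ring_nf
    calc |ev p x| * |x i| ≤ (C * Real.exp (b / 2 * ‖x‖ ^ 2)) *
          ((1 + 2 / b) * Real.exp (b / 2 * ‖x‖ ^ 2)) :=
          mul_le_mul (h1 x) (h4.trans h5) (abs_nonneg _) (by positivity)
      _ = _ := by rw [h6]; ring

/-- The Gaussian weight. -/
def gw {n : ℕ} (x : E n) : ℝ := Real.exp (-(1/2) * ‖x‖ ^ 2)

lemma continuous_gw {n : ℕ} : Continuous (gw : E n → ℝ) := by
  unfold gw; fun_prop

lemma integrable_gauss {n : ℕ} {b : ℝ} (hb : 0 < b) :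
    Integrable (fun x : E n => Real.exp (-b * ‖x‖ ^ 2)) := by
  have h := GaussianFourier.integrable_cexp_neg_mul_sq_norm_add (V := E n) (b := (b : ℂ))
    (by simpa using hb) 0 0
  have h2 := h.norm
  refine h2.congr (ae_of_all _ fun x => ?_)
  simp only [Complex.norm_exp]
  congr 1
  simp
  left
  norm_cast

lemma integrable_ev_gw {n : ℕ} (q : MvPolynomial (Fin n) ℝ) :
    Integrable (fun x : E n => ev q x * gw x) := by
  obtain ⟨C, hC, h⟩ := ev_bound q (1/4) (by norm_num)
  refine ((integrable_gauss (n := n) (b := 1/4) (by norm_num)).const_mul C).mono'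
    ((continuous_ev q).mul continuous_gw).aestronglyMeasurable (ae_of_all _ fun x => ?_)
  rw [Real.norm_eq_abs, abs_mul, abs_of_pos (show 0 < gw x from Real.exp_pos _)]
  calc |ev q x| * gw x ≤ C * Real.exp (1/4 * ‖x‖ ^ 2) * gw x := by
        gcongr
        · exact (Real.exp_pos _).le
        · exact h x
    _ = _ := by
      rw [gw, mul_assoc, ← Real.exp_add]; ring_nf

lemma ev_lineDeriv {n : ℕ} (q : MvPolynomial (Fin n) ℝ) (i : Fin n) (x : E n) :
    HasLineDerivAt ℝ (ev q) (ev (MvPolynomial.pderiv i q) x) x (EuclideanSpace.single i 1) := by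
  unfold HasLineDerivAt
  induction q using MvPolynomial.induction_on with
  | C a => simpa [ev] using hasDerivAt_const (0:ℝ) a
  | add p q hp hq =>
    have := hp.add hq
    convert this using 1
    · ext t; simp [ev]
    · simp [ev]
  | mul_X p j hp =>
    have h1 : HasDerivAt (fun t : ℝ => (x + t • EuclideanSpace.single i (1:ℝ) : E n) j)
        (if j = i then 1 else 0) 0 := by
      have := ((hasDerivAt_id (0:ℝ)).mul_const (if j = i then (1:ℝ) else 0)).const_add (x j)
      simpa [Pi.single_apply] using this
    have := hp.mul h1
    refine (this.congr_deriv ?_).congr_of_eventuallyEq (Eventually.of_forall fun t => ?_)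
    · simp only [ev, MvPolynomial.pderiv_mul, MvPolynomial.pderiv_X, Pi.single_apply, zero_smul,
        add_zero, map_add, map_mul, MvPolynomial.eval_X]
      by_cases hij : j = i
      · simp [hij]
      · simp [hij, Ne.symm hij]
    · simp [ev]

lemma gw_lineDeriv {n : ℕ} (i : Fin n) (x : E n) :
    HasLineDerivAt ℝ (gw : E n → ℝ) (-(x i) * gw x) x (EuclideanSpace.single i 1) := by
  have h1 : HasFDerivAt (fun y : E n => ‖y‖ ^ 2) (2 • (innerSL ℝ x)) x :=
    (hasStrictFDerivAt_norm_sq x).hasFDerivAt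
  have h2 := ((h1.const_mul (-(1/2) : ℝ)).exp).hasLineDerivAt (EuclideanSpace.single i 1)
  refine HasDerivAt.congr_deriv (f := fun t : ℝ => gw (x + t • EuclideanSpace.single i (1:ℝ))) h2 ?_
  simp [gw, EuclideanSpace.inner_single_right]
  ring

/-- The Gaussian functional on polynomials. -/
def Gam {n : ℕ} (q : MvPolynomial (Fin n) ℝ) : ℝ := ∫ x : E n, ev q x * gw x

lemma Gam_add {n : ℕ} (p q : MvPolynomial (Fin n) ℝ) : Gam (p + q) = Gam p + Gam q := by
  unfold Gam
  rw [← integral_add (integrable_ev_gw p) (integrable_ev_gw q)]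
  congr 1; ext x; simp [ev]; ring

lemma Gam_C_mul {n : ℕ} (c : ℝ) (q : MvPolynomial (Fin n) ℝ) :
    Gam (MvPolynomial.C c * q) = c * Gam q := by
  unfold Gam
  rw [← integral_const_mul]
  congr 1; ext x; simp [ev]; ring

lemma Gam_zero {n : ℕ} : Gam (0 : MvPolynomial (Fin n) ℝ) = 0 := by
  simp [Gam, ev]

lemma Gam_sum {n : ℕ} {ι : Type*} (s : Finset ι) (f : ι → MvPolynomial (Fin n) ℝ) :
    Gam (∑ i ∈ s, f i) = ∑ i ∈ s, Gam (f i) := by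
  classical
  induction s using Finset.induction_on with
  | empty => simp [Gam_zero]
  | insert a s ha ih => rw [Finset.sum_insert ha, Finset.sum_insert ha, Gam_add, ih]

lemma Gam_X_mul {n : ℕ} (i : Fin n) (f : MvPolynomial (Fin n) ℝ) :
    Gam (MvPolynomial.X i * f) = Gam (MvPolynomial.pderiv i f) := by
  have key := integral_bilinear_hasLineDerivAt_right_eq_neg_left_of_integrable
    (μ := (volume : Measure (E n))) (f := ev f) (f' := ev (MvPolynomial.pderiv i f))
    (g := gw) (g' := fun x => -(x i) * gw x) (v := EuclideanSpace.single i 1)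
    (B := ContinuousLinearMap.mul ℝ ℝ)
    (by simpa using integrable_ev_gw (MvPolynomial.pderiv i f))
    (by
      refine (integrable_ev_gw (MvPolynomial.X i * f)).neg.congr (ae_of_all _ fun x => ?_)
      simp [ev]; ring)
    (by simpa using integrable_ev_gw f)
    (fun x _ => ev_lineDeriv f i x) (fun x _ => gw_lineDeriv i x)
  simp only [ContinuousLinearMap.mul_apply'] at key
  unfold Gam
  have h2 : ∫ x : E n, ev (MvPolynomial.X i * f) x * gw x = -∫ x : E n, ev f x * (-(x i) * gw x) := by
    rw [← integral_neg]; congr 1; ext x; simp [ev]; ring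
  rw [h2, key, neg_neg]

/-- The linear form `⟨·, y⟩` as a polynomial. -/
def Lf {n : ℕ} (y : E n) : MvPolynomial (Fin n) ℝ :=
  ∑ i, MvPolynomial.C (y i) * MvPolynomial.X i

lemma ev_Lf {n : ℕ} (x y : E n) : ev (Lf y) x = ⟪x, y⟫ := by
  simp [ev, Lf, PiLp.inner_apply]

lemma pderiv_Lf {n : ℕ} (y : E n) (i : Fin n) :
    MvPolynomial.pderiv i (Lf y) = MvPolynomial.C (y i) := by
  simp [Lf, MvPolynomial.pderiv_C_mul, MvPolynomial.pderiv_X, Pi.single_apply]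

/-- Directional derivative. -/
def Dy {n : ℕ} (y : E n) (q : MvPolynomial (Fin n) ℝ) : MvPolynomial (Fin n) ℝ :=
  ∑ i, MvPolynomial.C (y i) * MvPolynomial.pderiv i q

/-- Laplacian. -/
def Lap {n : ℕ} (q : MvPolynomial (Fin n) ℝ) : MvPolynomial (Fin n) ℝ :=
  ∑ i, MvPolynomial.pderiv i (MvPolynomial.pderiv i q)

lemma pderiv_comm' {n : ℕ} (i j : Fin n) (q : MvPolynomial (Fin n) ℝ) :
    MvPolynomial.pderiv i (MvPolynomial.pderiv j q) =
      MvPolynomial.pderiv j (MvPolynomial.pderiv i q) := by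
  have h : ⁅(MvPolynomial.pderiv i : Derivation ℝ (MvPolynomial (Fin n) ℝ) (MvPolynomial (Fin n) ℝ)),
      (MvPolynomial.pderiv j : Derivation ℝ (MvPolynomial (Fin n) ℝ) (MvPolynomial (Fin n) ℝ))⁆
        = 0 := by
    apply MvPolynomial.derivation_ext
    intro k
    simp only [Derivation.commutator_apply, MvPolynomial.pderiv_X, Pi.single_apply]
    split_ifs <;> simp
  have := congrArg (fun D : Derivation ℝ (MvPolynomial (Fin n) ℝ) (MvPolynomial (Fin n) ℝ) => D q) h
  simpa [Derivation.commutator_apply, sub_eq_zero] using this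

lemma Lap_Dy {n : ℕ} (y : E n) (q : MvPolynomial (Fin n) ℝ) (h : Lap q = 0) :
    Lap (Dy y q) = 0 := by
  have : Lap (Dy y q) = Dy y (Lap q) := by
    simp only [Lap, Dy, map_sum, MvPolynomial.pderiv_C_mul, Finset.mul_sum]
    rw [Finset.sum_comm]
    refine Finset.sum_congr rfl fun i _ => Finset.sum_congr rfl fun j _ => ?_
    rw [pderiv_comm' j i, pderiv_comm' j i]
  rw [this, h]; simp [Dy]

lemma Dy_hom {n l : ℕ} (y : E n) (q : MvPolynomial (Fin n) ℝ) (h : q.IsHomogeneous (l + 1)) :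
    (Dy y q).IsHomogeneous l := by
  refine MvPolynomial.IsHomogeneous.sum _ _ _ fun i _ => ?_
  have h1 : (MvPolynomial.pderiv i q).IsHomogeneous l := h.pderiv
  simpa using (MvPolynomial.isHomogeneous_C (Fin n) (y i)).mul h1

lemma euler {n l : ℕ} (q : MvPolynomial (Fin n) ℝ) (h : q.IsHomogeneous l) :
    ∑ i, MvPolynomial.X i * MvPolynomial.pderiv i q = MvPolynomial.C (l : ℝ) * q := by
  rw [h.sum_X_mul_pderiv]; simp

lemma ev_Dy_self {n l : ℕ} (y : E n) (q : MvPolynomial (Fin n) ℝ) (h : q.IsHomogeneous l) :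
    ev (Dy y q) y = l * ev q y := by
  have := congrArg (fun r => ev r y) (euler q h)
  simpa [ev, Dy] using this

lemma sum_sq {n : ℕ} (y : E n) (hy : ‖y‖ = 1) : ∑ i, y i * y i = 1 := by
  have := EuclideanSpace.real_norm_sq_eq y
  rw [hy] at this
  simpa [sq] using this.symm

lemma Gam_Lf_step {n : ℕ} (j : ℕ) (y : E n) (hy : ‖y‖ = 1) :
    Gam (Lf y ^ (j + 2)) = (j + 1) * Gam (Lf y ^ j) := by
  have : Lf y ^ (j + 2) = ∑ i, MvPolynomial.C (y i) * (MvPolynomial.X i * Lf y ^ (j + 1)) := by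
    simp only [← mul_assoc]
    rw [← Finset.sum_mul, ← Lf]; ring
  rw [this, Gam_sum]
  simp only [Gam_C_mul, Gam_X_mul, MvPolynomial.pderiv_pow, pderiv_Lf]
  have h2 : ∀ i, Gam (((j + 1 : ℕ) : MvPolynomial (Fin n) ℝ) * Lf y ^ (j + 1 - 1) *
      MvPolynomial.C (y i)) = (j + 1) * y i * Gam (Lf y ^ j) := by
    intro i
    rw [← Gam_C_mul]
    congr 1
    simp
    ring
  simp only [h2]
  have : ∀ i, y i * ((j + 1) * y i * Gam (Lf y ^ j)) = (y i * y i) * ((j + 1) * Gam (Lf y ^ j)) := by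
    intro i; ring
  simp only [this]
  rw [← Finset.sum_mul, sum_sq y hy, one_mul]

lemma Gam_Lf_indep {n : ℕ} (j : ℕ) : ∃ M : ℝ, ∀ y : E n, ‖y‖ = 1 → Gam (Lf y ^ j) = M := by
  induction j using Nat.strong_induction_on with
  | _ j ih =>
    match j with
    | 0 => exact ⟨Gam (1 : MvPolynomial (Fin n) ℝ), fun y _ => by simp⟩
    | 1 =>
      refine ⟨0, fun y _ => ?_⟩
      rw [pow_one, Lf, Gam_sum]
      refine Finset.sum_eq_zero fun i _ => ?_
      have := Gam_X_mul i (1 : MvPolynomial (Fin n) ℝ)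
      rw [mul_one] at this
      rw [Gam_C_mul, this]; simp [Gam_zero]
    | j + 2 =>
      obtain ⟨M, hM⟩ := ih j (by omega)
      exact ⟨(j + 1) * M, fun y hy => by rw [Gam_Lf_step j y hy, hM y hy]⟩

lemma Gam_step {n l : ℕ} (j : ℕ) (y : E n) (q : MvPolynomial (Fin n) ℝ)
    (h : q.IsHomogeneous (l + 1)) (hh : Lap q = 0) :
    ((l + 1 : ℕ) : ℝ) * Gam (Lf y ^ j * q) = j * Gam (Lf y ^ (j - 1) * Dy y q) := by
  rw [← Gam_C_mul]
  have h1 : MvPolynomial.C ((l + 1 : ℕ) : ℝ) * (Lf y ^ j * q) =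
      ∑ i, MvPolynomial.X i * (Lf y ^ j * MvPolynomial.pderiv i q) := by
    rw [mul_left_comm, ← euler q h, Finset.mul_sum]
    exact Finset.sum_congr rfl fun i _ => by ring
  rw [h1, Gam_sum]
  simp only [Gam_X_mul]
  rw [← Gam_sum, ← Gam_C_mul]
  congr 1
  simp only [MvPolynomial.pderiv_mul, MvPolynomial.pderiv_pow, pderiv_Lf, Finset.sum_add_distrib]
  rw [← Finset.mul_sum, ← Lap, hh, mul_zero, add_zero, Dy, Finset.mul_sum, Finset.mul_sum]
  refine Finset.sum_congr rfl fun i _ => ?_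
  simp
  ring

/-- Funk-Hecke for monomials and the Gaussian. -/
lemma Gam_FH {n : ℕ} (l : ℕ) : ∀ j : ℕ, ∃ M : ℝ, ∀ (q : MvPolynomial (Fin n) ℝ),
    q.IsHomogeneous l → Lap q = 0 → ∀ y : E n, ‖y‖ = 1 → Gam (Lf y ^ j * q) = M * ev q y := by
  induction l with
  | zero =>
    intro j
    obtain ⟨M, hM⟩ := Gam_Lf_indep (n := n) j
    refine ⟨M, fun q hq _ y hy => ?_⟩
    obtain ⟨c, rfl⟩ : ∃ c, q = MvPolynomial.C c :=
      ⟨_, MvPolynomial.totalDegree_eq_zero_iff_eq_C.1 (Nat.le_zero.1 hq.totalDegree_le)⟩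
    rw [mul_comm, Gam_C_mul, hM y hy]
    simp [ev, mul_comm]
  | succ l ih =>
    intro j
    obtain ⟨M, hM⟩ := ih (j - 1)
    refine ⟨j * M, fun q hq hh y hy => ?_⟩
    have h1 := Gam_step j y q hq hh
    rw [hM _ (Dy_hom y q hq) (Lap_Dy y q hh) y hy, ev_Dy_self y q hq] at h1
    have h2 : ((l + 1 : ℕ) : ℝ) ≠ 0 := by positivity
    apply mul_left_cancel₀ h2
    rw [h1]; ring

lemma ev_smul {n N : ℕ} (q : MvPolynomial (Fin n) ℝ) (h : q.IsHomogeneous N) (r : ℝ) (x : E n) :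
    ev q (r • x) = r ^ N * ev q x := by
  unfold ev
  rw [MvPolynomial.eval_eq, MvPolynomial.eval_eq, Finset.mul_sum]
  refine Finset.sum_congr rfl fun d hd => ?_
  have h1 : ∑ i, d i = N := by
    have := h (MvPolynomial.mem_support_iff.1 hd)
    rw [← this, Finsupp.weight_apply, Finsupp.sum_fintype] <;> simp
  have h2 : ∏ i ∈ d.support, (r • x) i ^ d i = ∏ i, (r • x) i ^ d i :=
    Finset.prod_subset (Finset.subset_univ _) (by intro i _ hi; simp at hi; simp [hi])
  have h3 : ∏ i ∈ d.support, x i ^ d i = ∏ i, x i ^ d i :=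
    Finset.prod_subset (Finset.subset_univ _) (by intro i _ hi; simp at hi; simp [hi])
  rw [h2, h3]
  simp only [PiLp.smul_apply, smul_eq_mul, mul_pow, Finset.prod_mul_distrib]
  rw [Finset.prod_pow_eq_pow_sum, h1]; ring

/-- Radial factor. -/
def cN (n N : ℕ) : ℝ := ∫ r : Set.Ioi (0:ℝ), (r : ℝ) ^ N * Real.exp (-(1/2) * (r : ℝ) ^ 2)
  ∂(Measure.volumeIoiPow (n - 1))

lemma cN_pos (n N : ℕ) : 0 < cN n N := by
  have h1 : cN n N = ∫ r in Set.Ioi (0:ℝ), r ^ ((n - 1 + N : ℕ) : ℝ) *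
      Real.exp (-(1/2) * r ^ (2:ℝ)) := by
    simp only [cN, Measure.volumeIoiPow, ENNReal.ofReal]
    rw [integral_withDensity_eq_integral_smul,
        integral_subtype_comap measurableSet_Ioi
          fun a : ℝ ↦ Real.toNNReal (a ^ (n - 1)) • (a ^ N * Real.exp (-(1/2) * a ^ 2)),
        setIntegral_congr_fun measurableSet_Ioi fun x hx ↦ ?_]
    · simp only [NNReal.smul_def]
      rw [Real.coe_toNNReal _ (pow_nonneg (le_of_lt hx) _), Real.rpow_natCast, Real.rpow_two, pow_add,
        smul_eq_mul, mul_assoc]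
    · exact (measurable_subtype_coe.pow_const _).real_toNNReal
  rw [h1, integral_rpow_mul_exp_neg_mul_rpow (by norm_num)
    (lt_of_lt_of_le (by norm_num : (-1:ℝ) < 0) (Nat.cast_nonneg _)) (by norm_num)]
  have : 0 < Real.Gamma ((((n - 1 + N : ℕ) : ℝ) + 1) / 2) := Real.Gamma_pos_of_pos (by positivity)
  positivity

lemma polar {n N : ℕ} (hn : 0 < n) (q : MvPolynomial (Fin n) ℝ) (h : q.IsHomogeneous N) :
    Gam q = (∫ ω, ev q (ω : E n) ∂((volume : Measure (E n)).toSphere)) * cN n N := by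
  unfold Gam cN
  rw [← integral_prod_mul]
  have h0 : ∫ x : E n, ev q x * gw x =
      ∫ x : ({(0)}ᶜ : Set (E n)), ev q x * gw (x : E n) ∂((volume : Measure (E n)).comap (↑)) := by
    have : Nonempty (Fin n) := ⟨⟨0, hn⟩⟩
    rw [integral_subtype_comap (measurableSet_singleton _).compl fun x : E n ↦ ev q x * gw x,
        restrict_compl_singleton]
  rw [h0]
  have h1 := (volume : Measure (E n)).measurePreserving_homeomorphUnitSphereProd.integral_comp
        (Homeomorph.measurableEmbedding _)
        (fun z => ev q (z.1 : E n) * ((z.2 : ℝ) ^ N * Real.exp (-(1/2) * (z.2 : ℝ) ^ 2)))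
  rw [finrank_euclideanSpace_fin] at h1
  rw [← h1]
  congr 1; ext x
  have hx : ‖(x : E n)‖ ≠ 0 := norm_ne_zero_iff.2 x.2
  simp only [homeomorphUnitSphereProd_apply_fst_coe, homeomorphUnitSphereProd_apply_snd_coe]
  rw [ev_smul q h, gw]
  have h5 : ‖(x : E n)‖⁻¹ ^ N * ‖(x : E n)‖ ^ N = 1 := by
    rw [← mul_pow, inv_mul_cancel₀ hx, one_pow]
  linear_combination (-(ev q (x : E n) * Real.exp (-(1/2) * ‖(x : E n)‖ ^ 2))) * h5

/-- Surface measure. -/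
abbrev sg (n : ℕ) : Measure (sphere (0 : E n) 1) := (volume : Measure (E n)).toSphere

lemma sph_FH {n : ℕ} (hn : 0 < n) (l j : ℕ) : ∃ M : ℝ, ∀ (q : MvPolynomial (Fin n) ℝ),
    q.IsHomogeneous l → Lap q = 0 → ∀ y : E n, ‖y‖ = 1 →
      ∫ ω, ⟪(ω : E n), y⟫ ^ j * ev q ω ∂(sg n) = M * ev q y := by
  obtain ⟨M, hM⟩ := Gam_FH (n := n) l j
  refine ⟨M / cN n (j + l), fun q hq hh y hy => ?_⟩
  have hL : (Lf y).IsHomogeneous 1 := by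
    refine MvPolynomial.IsHomogeneous.sum _ _ _ fun i _ => ?_
    simpa using (MvPolynomial.isHomogeneous_C (Fin n) (y i)).mul (MvPolynomial.isHomogeneous_X ℝ i)
  have h1 : (Lf y ^ j * q).IsHomogeneous (j + l) := by
    simpa using (hL.pow j).mul hq
  have h2 := polar hn _ h1
  rw [hM q hq hh y hy] at h2
  have h3 : ∀ x : E n, ev (Lf y ^ j * q) x = ⟪x, y⟫ ^ j * ev q x := by
    intro x; rw [← ev_Lf]; simp [ev]
  simp only [h3] at h2
  have := (cN_pos n (j + l)).ne'
  field_simp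
  exact h2.symm

lemma int_bdd {n : ℕ} (g : ℝ → ℝ) (hg : Measurable g) (B : ℝ)
    (hB : ∀ t ∈ Set.Icc (-1:ℝ) 1, |g t| ≤ B) (y : E n) (hy : ‖y‖ = 1)
    (d : sphere (0 : E n) 1 → ℝ) (hd : Continuous d) :
    Integrable (fun ω : sphere (0 : E n) 1 => g ⟪(ω : E n), y⟫ * d ω) (sg n) := by
  have hdi : Integrable d (sg n) :=
    hd.integrable_of_hasCompactSupport (HasCompactSupport.of_compactSpace d)
  refine hdi.bdd_mul (c := B) ?_ (ae_of_all _ fun ω => ?_)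
  · exact (hg.comp (by fun_prop)).aestronglyMeasurable
  · apply hB
    have h := abs_real_inner_le_norm (ω : E n) y
    rw [hy, norm_eq_of_mem_sphere ω, mul_one] at h
    exact abs_le.1 h

lemma inner_mem {n : ℕ} (y : E n) (hy : ‖y‖ = 1) (ω : sphere (0 : E n) 1) :
    ⟪(ω : E n), y⟫ ∈ Set.Icc (-1:ℝ) 1 := by
  have h := abs_real_inner_le_norm (ω : E n) y
  rw [hy, norm_eq_of_mem_sphere ω, mul_one] at h
  exact abs_le.1 h

/-- Auxiliary measure on the line. -/
def nu {n m : ℕ} (w : Fin m → NNReal) (xb : Fin m → E n) (d : sphere (0 : E n) 1 → NNReal) :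
    Measure ℝ :=
  ∑ k, w k • Measure.map (fun ω : sphere (0 : E n) 1 => ⟪(ω : E n), xb k⟫)
    ((sg n).withDensity (fun ω => (d ω : ℝ≥0∞)))

lemma dens_finite {n : ℕ} (d : sphere (0 : E n) 1 → NNReal) (hd : Continuous d) :
    IsFiniteMeasure ((sg n).withDensity (fun ω => (d ω : ℝ≥0∞))) := by
  have hdi : Integrable (fun ω => (d ω : ℝ)) (sg n) :=
    (NNReal.continuous_coe.comp hd).integrable_of_hasCompactSupport
      (HasCompactSupport.of_compactSpace _)
  apply isFiniteMeasure_withDensity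
  have := hdi.lintegral_lt_top
  simpa using this.ne

lemma nu_finite {n m : ℕ} (w : Fin m → NNReal) (xb : Fin m → E n)
    (d : sphere (0 : E n) 1 → NNReal) (hd : Continuous d) : IsFiniteMeasure (nu w xb d) := by
  have := dens_finite d hd
  unfold nu
  infer_instance

lemma nu_int {n m : ℕ} (w : Fin m → NNReal) (xb : Fin m → E n) (hx : ∀ k, ‖xb k‖ = 1)
    (d : sphere (0 : E n) 1 → NNReal) (hd : Continuous d)
    (g : ℝ → ℝ) (hg : Measurable g) (B : ℝ) (hB : ∀ t ∈ Set.Icc (-1:ℝ) 1, |g t| ≤ B) :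
    ∫ t, g t ∂(nu w xb d) = ∑ k, (w k : ℝ) * ∫ ω : sphere (0 : E n) 1, g ⟪(ω : E n), xb k⟫ * d ω ∂(sg n) := by
  have hdm := hd.measurable
  have hm : ∀ k, Measurable (fun ω : sphere (0 : E n) 1 => ⟪(ω : E n), xb k⟫) :=
    fun k => by fun_prop
  unfold nu
  rw [integral_finsetSum_measure]
  · refine Finset.sum_congr rfl fun k _ => ?_
    rw [integral_smul_nnreal_measure, integral_map (hm k).aemeasurable hg.aestronglyMeasurable,
      integral_withDensity_eq_integral_smul hdm]
    simp [NNReal.smul_def, mul_comm]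
  · intro k _
    refine Integrable.smul_measure_nnreal ?_
    rw [integrable_map_measure hg.aestronglyMeasurable (hm k).aemeasurable,
      integrable_withDensity_iff_integrable_smul hdm]
    refine (int_bdd g hg B hB (xb k) (hx k) (fun ω => (d ω : ℝ)) (by fun_prop)).congr
      (ae_of_all _ fun ω => ?_)
    simp [NNReal.smul_def, mul_comm]

/-- Funk-Hecke, in the form needed. -/
lemma FH_zero {n m l : ℕ} (hn : 0 < n) (q : MvPolynomial (Fin n) ℝ) (hq : q.IsHomogeneous l) (hh : Lap q = 0)
    (w : Fin m → NNReal) (xb : Fin m → E n) (hx : ∀ k, ‖xb k‖ = 1)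
    (hmom : ∑ k, (w k : ℝ) * ev q (xb k) = 0)
    (g : ℝ → ℝ) (hg : Measurable g) (B : ℝ) (hB : ∀ t ∈ Set.Icc (-1:ℝ) 1, |g t| ≤ B) :
    ∑ k, (w k : ℝ) * ∫ ω, g ⟪(ω : E n), xb k⟫ * ev q ω ∂(sg n) = 0 := by
  have hqc : Continuous (fun ω : sphere (0 : E n) 1 => ev q (ω : E n)) :=
    (continuous_ev q).comp continuous_subtype_val
  -- polynomials
  have hpoly : ∀ P : Polynomial ℝ,
      ∑ k, (w k : ℝ) * ∫ ω, P.eval ⟪(ω : E n), xb k⟫ * ev q ω ∂(sg n) = 0 := by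
    intro P
    have hint : ∀ (P : Polynomial ℝ) k,
        Integrable (fun ω : sphere (0 : E n) 1 => P.eval ⟪(ω : E n), xb k⟫ * ev q ω) (sg n) := by
      intro P k
      refine Continuous.integrable_of_hasCompactSupport ?_ (HasCompactSupport.of_compactSpace _)
      exact (P.continuous.comp (by fun_prop)).mul hqc
    induction P using Polynomial.induction_on' with
    | add P Q hP hQ =>
      simp only [Polynomial.eval_add, add_mul]
      simp only [integral_add (hint P _) (hint Q _), mul_add, Finset.sum_add_distrib, hP, hQ,
        add_zero]
    | monomial j a =>
      obtain ⟨M, hM⟩ := sph_FH hn l j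
      simp only [Polynomial.eval_monomial, mul_assoc, integral_const_mul]
      have : ∀ k, (w k : ℝ) * (a * ∫ ω, ⟪(ω : E n), xb k⟫ ^ j * ev q ω ∂(sg n)) =
          (a * M) * ((w k : ℝ) * ev q (xb k)) := by
        intro k; rw [hM q hq hh _ (hx k)]; ring
      simp only [this]
      rw [← Finset.mul_sum, hmom, mul_zero]
  -- continuous functions
  have hcont : ∀ f : ℝ → ℝ, Continuous f →
      ∑ k, (w k : ℝ) * ∫ ω, f ⟪(ω : E n), xb k⟫ * ev q ω ∂(sg n) = 0 := by
    intro f hf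
    have hint : ∀ (f : ℝ → ℝ), Continuous f → ∀ k,
        Integrable (fun ω : sphere (0 : E n) 1 => f ⟪(ω : E n), xb k⟫ * ev q ω) (sg n) := by
      intro f hf k
      refine Continuous.integrable_of_hasCompactSupport ?_ (HasCompactSupport.of_compactSpace _)
      exact (hf.comp (by fun_prop)).mul hqc
    set K : ℝ := ∑ k, (w k : ℝ) * ∫ ω, |ev q (ω : E n)| ∂(sg n) with hK
    have hKnn : 0 ≤ K := Finset.sum_nonneg fun k _ =>
      mul_nonneg (w k).2 (integral_nonneg fun _ => abs_nonneg _)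
    have hest : ∀ e : ℝ, 0 < e →
        |∑ k, (w k : ℝ) * ∫ ω, f ⟪(ω : E n), xb k⟫ * ev q ω ∂(sg n)| ≤ e * K := by
      intro e he
      obtain ⟨P, hP⟩ := exists_polynomial_near_of_continuousOn (-1) 1 f hf.continuousOn e he
      have h1 : ∑ k, (w k : ℝ) * ∫ ω, f ⟪(ω : E n), xb k⟫ * ev q ω ∂(sg n) =
          ∑ k, (w k : ℝ) * ∫ ω, (f ⟪(ω : E n), xb k⟫ - P.eval ⟪(ω : E n), xb k⟫) * ev q ω
            ∂(sg n) := by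
        rw [← sub_zero (∑ k, (w k : ℝ) * ∫ ω, f ⟪(ω : E n), xb k⟫ * ev q ω ∂(sg n)), ← hpoly P,
          ← Finset.sum_sub_distrib]
        refine Finset.sum_congr rfl fun k _ => ?_
        simp only [sub_mul]
        rw [integral_sub (hint f hf k) (hint _ P.continuous k), mul_sub]
      rw [h1]
      refine (Finset.abs_sum_le_sum_abs _ _).trans ?_
      rw [hK, Finset.mul_sum]
      refine Finset.sum_le_sum fun k _ => ?_
      rw [abs_mul, abs_of_nonneg (w k).coe_nonneg, mul_left_comm]
      refine mul_le_mul_of_nonneg_left ?_ (w k).2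
      rw [← integral_const_mul, ← Real.norm_eq_abs]
      refine norm_integral_le_of_norm_le ?_ (ae_of_all _ fun ω => ?_)
      · refine Continuous.integrable_of_hasCompactSupport ?_ (HasCompactSupport.of_compactSpace _)
        exact continuous_const.mul hqc.abs
      · rw [Real.norm_eq_abs, abs_mul, abs_sub_comm]
        exact mul_le_mul_of_nonneg_right (hP _ (inner_mem _ (hx k) ω)).le (abs_nonneg _)
    by_contra hne
    have hpos := abs_pos.2 hne
    have := hest (|∑ k, (w k : ℝ) * ∫ ω, f ⟪(ω : E n), xb k⟫ * ev q ω ∂(sg n)| / (2 * (K + 1)))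
      (by positivity)
    rw [div_mul_eq_mul_div, le_div_iff₀ (by positivity)] at this
    nlinarith
  -- measures
  set dp : sphere (0 : E n) 1 → NNReal := fun ω => Real.toNNReal (ev q (ω : E n)) with hdp
  set dm : sphere (0 : E n) 1 → NNReal := fun ω => Real.toNNReal (-ev q (ω : E n)) with hdm
  have hdpc : Continuous dp := continuous_real_toNNReal.comp hqc
  have hdmc : Continuous dm := continuous_real_toNNReal.comp hqc.neg
  have hsub : ∀ ω : sphere (0 : E n) 1, ev q (ω : E n) = (dp ω : ℝ) - dm ω := by
    intro ω
    simp only [hdp, hdm, Real.coe_toNNReal']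
    rcases le_total 0 (ev q (ω : E n)) with h | h
    · rw [max_eq_left h, max_eq_right (by linarith)]; ring
    · rw [max_eq_right h, max_eq_left (by linarith)]; ring
  have hT : ∀ (g : ℝ → ℝ), Measurable g → ∀ B : ℝ, (∀ t ∈ Set.Icc (-1:ℝ) 1, |g t| ≤ B) →
      ∑ k, (w k : ℝ) * ∫ ω, g ⟪(ω : E n), xb k⟫ * ev q ω ∂(sg n) =
        ∫ t, g t ∂(nu w xb dp) - ∫ t, g t ∂(nu w xb dm) := by
    intro g hg B hB
    rw [nu_int w xb hx dp hdpc g hg B hB, nu_int w xb hx dm hdmc g hg B hB,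
      ← Finset.sum_sub_distrib]
    refine Finset.sum_congr rfl fun k _ => ?_
    rw [← mul_sub, ← integral_sub]
    · simp only [hsub, mul_sub]
    · exact int_bdd g hg B hB _ (hx k) (fun ω => (dp ω : ℝ)) (by fun_prop)
    · exact int_bdd g hg B hB _ (hx k) (fun ω => (dm ω : ℝ)) (by fun_prop)
  have := nu_finite w xb dp hdpc
  have := nu_finite w xb dm hdmc
  have heq : nu w xb dp = nu w xb dm := by
    refine ext_of_forall_integral_eq_of_IsFiniteMeasure fun f => ?_
    have h1 := hT f f.continuous.measurable ‖f‖ (fun t _ => f.norm_coe_le_norm t)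
    rw [hcont f f.continuous] at h1
    linarith
  rw [hT g hg B hB, heq, sub_self]

theorem stmt16 (n : ℕ) (hn : 3 ≤ n) (m l₀ : ℕ) (hm : 1 ≤ m) (hl₀ : 1 ≤ l₀) (hl₀m : l₀ ≤ m)
    (p : MvPolynomial (Fin n) ℝ)
    -- `p` is harmonic and homogeneous of degree `l₀`
    (hhom : p.IsHomogeneous l₀)
    (hharm : ∑ i : Fin n, MvPolynomial.pderiv i (MvPolynomial.pderiv i p) = 0)
    (xb : Fin (n + 1) → E n) (hxb : ∀ k, xb k ∈ Metric.sphere (0 : E n) 1)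
    (hxbinj : Function.Injective xb)
    (w : Fin (n + 1) → ℝ) (hw : ∀ k, w k ∈ Set.Ioo (0:ℝ) 1) (hwsum : ∑ k, w k = 1)
    (hmom : ∑ k, w k * MvPolynomial.eval (fun j => xb k j) p = 0)
    (δ : ℝ) (hδ : 0 < δ)
    -- the geodesic balls `B_δ(x̄_k)` are pairwise disjoint
    (hdisj : ∀ k l, k ≠ l → Disjoint (gball n (xb k) δ) (gball n (xb l) δ)) :
    ∃ C > (0:ℝ), ∀ ε : ℝ, 0 < ε → ε < δ →
      |∑ k, w k * ∫ x in gball n (xb k) δ,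
          Real.exp (((n:ℝ) - 1) * (-Real.log (ε ^ 2 + (gdist n x (xb k)) ^ 2))) *
            MvPolynomial.eval (fun j => x j) p ∂(sphMeasure n)| ≤
        C * ∑ k, w k * ∫ x in gball n (xb k) δ,
          Real.exp (((n:ℝ) - 1) * (-Real.log (ε ^ 2 + (gdist n x (xb k)) ^ 2))) *
            (gdist n x (xb k)) ^ 3 ∂(sphMeasure n) := by
  have hx : ∀ k, ‖xb k‖ = 1 := fun k => mem_sphere_zero_iff_norm.1 (hxb k)
  have hcv : ∀ (k : Fin (n + 1)) (F : E n → ℝ), ∫ x in gball n (xb k) δ, F x ∂(sphMeasure n) =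
      ∫ ω : sphere (0 : E n) 1, (gball n (xb k) δ).indicator F ω ∂(sg n) := by
    intro k F
    have hms : MeasurableSet (gball n (xb k) δ) := by
      have : Measurable (fun x : E n => gdist n x (xb k)) :=
        Real.continuous_arccos.measurable.comp (by fun_prop)
      exact (isClosed_sphere.measurableSet).inter (measurableSet_lt this measurable_const)
    rw [← integral_indicator hms, sphMeasure,
      (MeasurableEmbedding.subtype_coe isClosed_sphere.measurableSet).integral_map]
  refine ⟨1, one_pos, fun ε hε _ => ?_⟩
  set g : ℝ → ℝ := fun t => if Real.arccos t < δ then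
    Real.exp (((n:ℝ) - 1) * (-Real.log (ε ^ 2 + (Real.arccos t) ^ 2))) else 0 with hg
  have hgm : Measurable g := by
    refine Measurable.ite (measurableSet_lt Real.continuous_arccos.measurable measurable_const) ?_
      measurable_const
    have := Real.continuous_arccos.measurable
    fun_prop
  have hn1 : (0:ℝ) ≤ (n:ℝ) - 1 := by
    have : (3:ℝ) ≤ n := by exact_mod_cast hn
    linarith
  have hgB : ∀ t ∈ Set.Icc (-1:ℝ) 1, |g t| ≤ Real.exp (((n:ℝ) - 1) * (-Real.log (ε ^ 2))) := by
    intro t _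
    simp only [hg]
    split_ifs
    · rw [abs_of_pos (Real.exp_pos _)]
      gcongr
      nlinarith [sq_nonneg (Real.arccos t)]
    · simpa using (Real.exp_pos _).le
  have hz := FH_zero (by omega) p hhom hharm (fun k => ⟨w k, (hw k).1.le⟩) xb hx
    hmom g hgm _ hgB
  have hL : ∑ k, w k * ∫ x in gball n (xb k) δ,
          Real.exp (((n:ℝ) - 1) * (-Real.log (ε ^ 2 + (gdist n x (xb k)) ^ 2))) *
            MvPolynomial.eval (fun j => x j) p ∂(sphMeasure n) = 0 := by
    rw [← hz]
    refine Finset.sum_congr rfl fun k _ => ?_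
    rw [hcv]
    congr 2
    ext ω
    by_cases h : gdist n ω (xb k) < δ
    · rw [Set.indicator_of_mem (show (ω : E n) ∈ gball n (xb k) δ from ⟨ω.2, h⟩)]
      have h' : Real.arccos ⟪(ω : E n), xb k⟫ < δ := h
      simp only [hg, if_pos h']
      rfl
    · rw [Set.indicator_of_notMem (fun h2 => h h2.2)]
      have h' : ¬ Real.arccos ⟪(ω : E n), xb k⟫ < δ := h
      simp only [hg, if_neg h', zero_mul]
  rw [hL, abs_zero, one_mul]
  refine Finset.sum_nonneg fun k _ => mul_nonneg (hw k).1.le (integral_nonneg fun x => ?_)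
  exact mul_nonneg (Real.exp_pos _).le (pow_nonneg (Real.arccos_nonneg _) 3)
end
end
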